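/- arXiv:math/0312253 — 10 statements merged into one kernel-verified Lean document; each statement's English description precedes it below -/
import Mathlib

section
/- Let E be a real inner product space, let ζ̄ = (ζ₁, …, ζ_r) and ζ̄' = (ζ'₁, …, ζ'_r) be two lists of mutually orthogonal unit vectors in E of the same length r ≥ 1, and let ν, ν' ∈ E with ‖ν‖ = ‖ν'‖. Then the angle sequence (−⟪ν,ζ₁⟫, …, −⟪ν,ζ_r⟫) is lexicographically smaller than (−⟪ν',ζ'₁⟫, …, −⟪ν',ζ'_r⟫) if and only if there exists ε₀ > 0 such that ‖ν − ε·J_{ζ̄}(ε)‖ < ‖ν' − ε·J_{ζ̄'}(ε)‖ for all 0 < ε < ε₀. (Proposition 4.4 of the paper, for jet frames of equal order; note that ‖ν − ε·J_{ζ̄}(ε)‖ is the distance from x+ν to x+ε·J_{ζ̄}(ε) for any base point x.) -/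
open scoped RealInnerProductSpace

/-- The unit jet `J_{ζ̄}(ε) = (ε ζ₁ + ⋯ + ε^r ζ_r) / √(ε² + ⋯ + ε^{2r})` associated
to a finite list `ζ̄ = (ζ₁, …, ζ_r)` of vectors (for the empty list this is `0`). -/
noncomputable def unitJet {E : Type*} [NormedAddCommGroup E] [InnerProductSpace ℝ E]
    {r : ℕ} (ζ : Fin r → E) (ε : ℝ) : E :=
  (Real.sqrt (∑ i : Fin r, ε ^ (2 * (i.1 + 1))))⁻¹ • ∑ i : Fin r, ε ^ (i.1 + 1) • ζ i

/-- Strict lexicographic order on real sequences of a common length `r`. -/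
def LexLT {r : ℕ} (a b : Fin r → ℝ) : Prop :=
  ∃ i : Fin r, (∀ j : Fin r, j < i → a j = b j) ∧ a i < b i

open Filter Topology in
/-- A real polynomial without constant term whose first nonzero coefficient is positive is
positive on a right neighbourhood of `0`. -/
theorem eventually_sum_pow_succ_mul_pos {r : ℕ} (d : Fin r → ℝ) (i : Fin r)
    (h0 : ∀ j < i, d j = 0) (hi : 0 < d i) :
    ∀ᶠ ε in 𝓝[>] (0 : ℝ), 0 < ∑ j : Fin r, ε ^ (j.1 + 1) * d j := by
  have hc : Continuous fun ε : ℝ => ∑ j : Fin r, ε ^ (j.1 - i.1) * d j := by fun_prop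
  have hz : ∑ j : Fin r, (0 : ℝ) ^ (j.1 - i.1) * d j = d i := by
    rw [Finset.sum_eq_single i]
    · simp
    · intro j _ hj
      rcases lt_or_gt_of_ne hj with h | h
      · simp [h0 j h]
      · rw [zero_pow (Nat.sub_ne_zero_of_lt h), zero_mul]
    · simp
  have hev : ∀ᶠ ε in 𝓝 (0 : ℝ), 0 < ∑ j : Fin r, ε ^ (j.1 - i.1) * d j :=
    hc.continuousAt.eventually (lt_mem_nhds (hi.trans_eq hz.symm))
  filter_upwards [hev.filter_mono nhdsWithin_le_nhds, self_mem_nhdsWithin] with ε h hε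
  have key : ∑ j : Fin r, ε ^ (j.1 + 1) * d j =
      ε ^ (i.1 + 1) * ∑ j : Fin r, ε ^ (j.1 - i.1) * d j := by
    rw [Finset.mul_sum]
    refine Finset.sum_congr rfl fun j _ => ?_
    rcases lt_or_ge j i with hj | hj
    · simp [h0 j hj]
    · have hij : i.1 ≤ j.1 := hj
      rw [← mul_assoc, ← pow_add]
      congr 2
      omega
  rw [key]
  exact mul_pos (pow_pos hε _) h

open Filter Topology in
/-- The sign of a polynomial without constant term to the right of `0` is positive exactly when
its first nonzero coefficient is. -/
theorem lexLT_neg_iff_eventually_sum_pos {r : ℕ} (a b : Fin r → ℝ) :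
    LexLT (fun i => -a i) (fun i => -b i) ↔
      ∀ᶠ ε in 𝓝[>] (0 : ℝ), 0 < ∑ j : Fin r, ε ^ (j.1 + 1) * (a j - b j) := by
  constructor
  · rintro ⟨i, h0, hi⟩
    refine eventually_sum_pow_succ_mul_pos _ i (fun j hj => ?_) ?_
    · have := h0 j hj
      simp only [neg_inj] at this
      simp [this]
    · simpa using hi
  · intro h
    by_cases hd : ∃ i, a i - b i ≠ 0
    · obtain ⟨i, hi, hmin⟩ := WellFounded.has_min (wellFounded_lt (α := Fin r))
        {i | a i - b i ≠ 0} hd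
      have h0 : ∀ j < i, a j - b j = 0 := fun j hj => by
        by_contra hne
        exact hmin j hne hj
      refine ⟨i, fun j hj => by simpa using sub_eq_zero.1 (h0 j hj), ?_⟩
      rcases lt_or_gt_of_ne (show a i - b i ≠ 0 from hi) with hlt | hgt
      · have h' := eventually_sum_pow_succ_mul_pos (fun j => -(a j - b j)) i
          (fun j hj => by simp only [h0 j hj, neg_zero]) (neg_pos.2 hlt)
        obtain ⟨ε, h₁, h₂⟩ := (h.and h').exists
        simp only [mul_neg, Finset.sum_neg_distrib] at h₂
        linarith
      · simpa using hgt
    · push Not at hd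
      obtain ⟨ε, hε⟩ := h.exists
      simp [hd] at hε

section UnitJet

variable {E : Type*} [NormedAddCommGroup E] [InnerProductSpace ℝ E] {r : ℕ}

theorem sum_pow_two_mul_succ_pos (hr : 1 ≤ r) {ε : ℝ} (hε : 0 < ε) :
    0 < ∑ i : Fin r, ε ^ (2 * (i.1 + 1)) :=
  Finset.sum_pos (fun _ _ => pow_pos hε _) ⟨⟨0, hr⟩, Finset.mem_univ _⟩

theorem norm_unitJet (hr : 1 ≤ r) {ζ : Fin r → E} (hζ : Orthonormal ℝ ζ) {ε : ℝ} (hε : 0 < ε) :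
    ‖unitJet ζ ε‖ = 1 := by
  have hS := Real.sqrt_pos.2 (sum_pow_two_mul_succ_pos hr hε)
  have hn : ‖∑ i : Fin r, ε ^ (i.1 + 1) • ζ i‖ = √(∑ i : Fin r, ε ^ (2 * (i.1 + 1))) := by
    rw [norm_eq_sqrt_real_inner, hζ.inner_sum]
    congr 1
    refine Finset.sum_congr rfl fun i _ => ?_
    simp only [conj_trivial]
    ring
  rw [unitJet, norm_smul, hn, norm_inv, Real.norm_of_nonneg hS.le, inv_mul_cancel₀ hS.ne']

theorem inner_unitJet (ν : E) (ζ : Fin r → E) (ε : ℝ) :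
    ⟪ν, unitJet ζ ε⟫ =
      (√(∑ i : Fin r, ε ^ (2 * (i.1 + 1))))⁻¹ * ∑ i : Fin r, ε ^ (i.1 + 1) * ⟪ν, ζ i⟫ := by
  simp only [unitJet, inner_smul_right, inner_sum]

theorem norm_sub_smul_unitJet_lt_iff (hr : 1 ≤ r) {ζ ζ' : Fin r → E}
    (hζ : Orthonormal ℝ ζ) (hζ' : Orthonormal ℝ ζ') {ν ν' : E} (hnorm : ‖ν‖ = ‖ν'‖)
    {ε : ℝ} (hε : 0 < ε) :
    ‖ν - ε • unitJet ζ ε‖ < ‖ν' - ε • unitJet ζ' ε‖ ↔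
      0 < ∑ j : Fin r, ε ^ (j.1 + 1) * (⟪ν, ζ j⟫ - ⟪ν', ζ' j⟫) := by
  have hS := inv_pos.2 (Real.sqrt_pos.2 (sum_pow_two_mul_succ_pos hr hε))
  rw [← sq_lt_sq₀ (norm_nonneg _) (norm_nonneg _), norm_sub_sq_real, norm_sub_sq_real,
    norm_smul, norm_smul, norm_unitJet hr hζ hε, norm_unitJet hr hζ' hε, hnorm,
    add_lt_add_iff_right, sub_lt_sub_iff_left, mul_lt_mul_iff_right₀ two_pos,
    inner_smul_right, inner_smul_right, mul_lt_mul_iff_right₀ hε, inner_unitJet, inner_unitJet,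
    mul_lt_mul_iff_right₀ hS, ← sub_pos, ← Finset.sum_sub_distrib]
  simp only [mul_sub]

end UnitJet

/-- Proposition 4.4 (for jet frames of equal order): the angle sequence of `ζ̄`
with respect to `ν` is lexicographically smaller than that of `ζ̄'` with respect
to `ν'` if and only if, for all sufficiently small `ε > 0`, the point `x + ν` is
closer to `x + ε·J_{ζ̄}(ε)` than `x' + ν'` is to `x' + ε·J_{ζ̄'}(ε)`. -/
theorem lexLT_angle_seq_iff_dist_lt {E : Type*} [NormedAddCommGroup E] [InnerProductSpace ℝ E]
    {r : ℕ} (hr : 1 ≤ r) (ζ ζ' : Fin r → E)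
    (hζ : Orthonormal ℝ ζ) (hζ' : Orthonormal ℝ ζ')
    (ν ν' : E) (hnorm : ‖ν‖ = ‖ν'‖) :
    LexLT (fun i => -⟪ν, ζ i⟫) (fun i => -⟪ν', ζ' i⟫) ↔
      ∃ ε₀ > 0, ∀ ε : ℝ, 0 < ε → ε < ε₀ →
        ‖ν - ε • unitJet ζ ε‖ < ‖ν' - ε • unitJet ζ' ε‖ := by
  rw [lexLT_neg_iff_eventually_sum_pos, (nhdsGT_basis (0 : ℝ)).eventually_iff]
  refine exists_congr fun ε₀ => and_congr_right fun _ => ?_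
  exact ⟨fun h ε h₁ h₂ => (norm_sub_smul_unitJet_lt_iff hr hζ hζ' hnorm h₁).2 (h ⟨h₁, h₂⟩),
    fun h ε hε => (norm_sub_smul_unitJet_lt_iff hr hζ hζ' hnorm hε.1).1 (h ε hε.1 hε.2)⟩
end

section
/- Let E be a real inner product space, let ζ̄ = (ζ₁, …, ζ_r) and ζ̄' = (ζ'₁, …, ζ'_r) be lists of mutually orthogonal unit vectors in E of the same length r, let ν ∈ E, and set aₖ = ⟪ν,ζₖ⟫ and bₖ = ⟪ν,ζ'ₖ⟫. If 1 ≤ i ≤ r and aₖ = bₖ for all k < i, then (⟪ν, J_{ζ̄}(ε)⟫ − ⟪ν, J_{ζ̄'}(ε)⟫)/ε^{i−1} tends to aᵢ − bᵢ as ε → 0⁺. (The asymptotic claim established in the proof of Proposition 4.4 of the paper.) -/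
open scoped RealInnerProductSpace

/-- For `ε > 0`, one factor `ε` cancels between the numerator and the norm of the jet. -/
theorem inner_unitJet_of_pos {E : Type*} [NormedAddCommGroup E] [InnerProductSpace ℝ E]
    {r : ℕ} (ζ : Fin r → E) (ν : E) {ε : ℝ} (hε : 0 < ε) :
    ⟪ν, unitJet ζ ε⟫ =
      (Real.sqrt (∑ j : Fin r, ε ^ (2 * j.1)))⁻¹ * ∑ j : Fin r, ε ^ j.1 * ⟪ν, ζ j⟫ := by
  have hnorm : Real.sqrt (∑ j : Fin r, ε ^ (2 * (j.1 + 1))) =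
      ε * Real.sqrt (∑ j : Fin r, ε ^ (2 * j.1)) := by
    have hsum : ∑ j : Fin r, ε ^ (2 * (j.1 + 1)) = ε ^ 2 * ∑ j : Fin r, ε ^ (2 * j.1) := by
      rw [Finset.mul_sum]
      exact Finset.sum_congr rfl fun j _ => by ring
    rw [hsum, Real.sqrt_mul (sq_nonneg ε), Real.sqrt_sq hε.le]
  have hinner : ∑ j : Fin r, ε ^ (j.1 + 1) * ⟪ν, ζ j⟫ =
      ε * ∑ j : Fin r, ε ^ j.1 * ⟪ν, ζ j⟫ := by
    rw [Finset.mul_sum]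
    exact Finset.sum_congr rfl fun j _ => by ring
  simp only [unitJet, real_inner_smul_right, inner_sum]
  rw [hnorm, hinner]
  field_simp

/-- The asymptotic claim from the proof of Proposition 4.4: writing `aₖ = ⟪ν, ζₖ⟫`
and `bₖ = ⟪ν, ζ'ₖ⟫` (`k` running over `Fin r`, so index `i : Fin r` corresponds to
the 1-based index `i+1` and `ε^{i}` to `ε^{(i+1)-1}`), if `aₖ = bₖ` for all `k < i`,
then `(⟪ν, J_{ζ̄}(ε)⟫ - ⟪ν, J_{ζ̄'}(ε)⟫)/ε^{i}` tends to `aᵢ - bᵢ` as `ε → 0⁺`. -/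
theorem tendsto_inner_unitJet_sub_div_pow {E : Type*} [NormedAddCommGroup E]
    [InnerProductSpace ℝ E] {r : ℕ} (ζ ζ' : Fin r → E)
    (hζ : Orthonormal ℝ ζ) (hζ' : Orthonormal ℝ ζ')
    (ν : E) (i : Fin r)
    (hagree : ∀ j : Fin r, j < i → ⟪ν, ζ j⟫ = ⟪ν, ζ' j⟫) :
    Filter.Tendsto
      (fun ε : ℝ => (⟪ν, unitJet ζ ε⟫ - ⟪ν, unitJet ζ' ε⟫) / ε ^ (i : ℕ))
      (nhdsWithin 0 (Set.Ioi 0)) (nhds (⟪ν, ζ i⟫ - ⟪ν, ζ' i⟫)) := by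
  let c : Fin r → ℝ := fun j => ⟪ν, ζ j⟫ - ⟪ν, ζ' j⟫
  have hc0 : ∀ j < i, c j = 0 := fun j hj => sub_eq_zero.mpr (hagree j hj)
  have : NeZero r := ⟨i.pos.ne'⟩
  let g : ℝ → ℝ := fun ε =>
    (Real.sqrt (∑ j : Fin r, ε ^ (2 * j.1)))⁻¹ * ∑ j : Fin r, ε ^ (j.1 - i.1) * c j
  have hsum : ∑ j : Fin r, (0 : ℝ) ^ (2 * j.1) = 1 := by
    rw [Finset.sum_eq_single (0 : Fin r)]
    · simp
    · intro j _ hj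
      have : j.1 ≠ 0 := Fin.val_ne_zero_iff.mpr hj
      simp [this]
    · simp
  have hg0 : g 0 = c i := by
    simp only [g, hsum, Real.sqrt_one, inv_one, one_mul]
    rw [Finset.sum_eq_single i]
    · simp
    · intro j _ hj
      rcases lt_or_gt_of_ne hj with h | h
      · simp [hc0 j h]
      · have : j.1 - i.1 ≠ 0 := Nat.sub_ne_zero_of_lt h
        simp [this]
    · simp
  have hg : ContinuousAt g 0 := by
    refine ContinuousAt.mul (ContinuousAt.inv₀ (by fun_prop) ?_) (by fun_prop)
    simp only [hsum, Real.sqrt_one, ne_eq, one_ne_zero, not_false_eq_true]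
  have hlim : Filter.Tendsto g (nhdsWithin 0 (Set.Ioi 0)) (nhds (c i)) :=
    hg0 ▸ hg.tendsto.mono_left nhdsWithin_le_nhds
  apply hlim.congr'
  filter_upwards [self_mem_nhdsWithin] with ε hε
  have hε : 0 < ε := hε
  rw [inner_unitJet_of_pos ζ ν hε, inner_unitJet_of_pos ζ' ν hε, ← mul_sub,
    ← Finset.sum_sub_distrib, mul_div_assoc, Finset.sum_div]
  change _ * _ = _ * _
  congr 1
  refine Finset.sum_congr rfl fun j _ => ?_
  rw [← mul_sub]
  change _ = ε ^ j.1 * c j / ε ^ i.1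
  rcases lt_or_ge j i with h | h
  · simp [hc0 j h]
  · rw [pow_sub₀ ε hε.ne' h]
    ring
end

section
/- Let E be a real inner product space, let C ⊆ E be a convex cone, and let ν ∈ E satisfy ⟪ν, c⟫ ≤ 0 for all c ∈ C. Suppose ζ ∈ C is a unit vector such that ⟪ν, ζ⟫ ≥ ⟪ν, c⟫ for every unit vector c ∈ C. Then for every w ∈ E with ⟪w, ζ⟫ = 0 and with ζ + ε·w ∈ C for all sufficiently small ε > 0, one has ⟪ν, w⟫ ≤ 0. (Lemma 4.8 of the paper: ν remains an outer support vector at the origin of the iterated tangent cone.) -/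
open scoped RealInnerProductSpace

/-- Lemma 4.8: let `C` be a convex cone, `ν` an outer support vector for `C` at the
origin, and `ζ ∈ C` a unit vector maximizing `⟪ν, ·⟫` among unit vectors of `C`.
Then `ν` is an outer support vector at the origin of the iterated tangent cone:
for every `w` orthogonal to `ζ` with `ζ + ε·w ∈ C` for all sufficiently small
`ε > 0`, one has `⟪ν, w⟫ ≤ 0`. -/
theorem outer_support_iterated_tangent_cone {E : Type*} [NormedAddCommGroup E]
    [InnerProductSpace ℝ E] (C : Set E)
    (hC_add : ∀ x ∈ C, ∀ y ∈ C, x + y ∈ C)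
    (hC_smul : ∀ x ∈ C, ∀ t : ℝ, 0 < t → t • x ∈ C)
    (hC_ne : C.Nonempty)
    (ν : E) (hν : ∀ c ∈ C, ⟪ν, c⟫ ≤ 0)
    (ζ : E) (hζC : ζ ∈ C) (hζ : ‖ζ‖ = 1)
    (hmax : ∀ c ∈ C, ‖c‖ = 1 → ⟪ν, c⟫ ≤ ⟪ν, ζ⟫)
    (w : E) (hw : ⟪w, ζ⟫ = 0)
    (hwtan : ∃ ε₀ > 0, ∀ ε : ℝ, 0 < ε → ε < ε₀ → ζ + ε • w ∈ C) :
    ⟪ν, w⟫ ≤ 0 := by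
  obtain ⟨ε₀, hε₀, htan⟩ := hwtan
  have hε : 0 < ε₀ / 2 := half_pos hε₀
  have hcC : ζ + (ε₀ / 2) • w ∈ C := htan _ hε (half_lt_self hε₀)
  set c := ζ + (ε₀ / 2) • w with hc
  have hinner : ⟪c, ζ⟫ = 1 := by
    rw [hc, inner_add_left, real_inner_smul_left, hw, real_inner_self_eq_norm_sq, hζ]
    norm_num
  have hnorm : 1 ≤ ‖c‖ := by
    simpa [hinner, hζ] using real_inner_le_norm c ζ
  have hpos : 0 < ‖c‖ := one_pos.trans_le hnorm
  have hle := hmax (‖c‖⁻¹ • c) (hC_smul c hcC _ (inv_pos.mpr hpos))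
    (by rw [norm_smul, norm_inv, norm_norm, inv_mul_cancel₀ hpos.ne'])
  rw [real_inner_smul_right, inv_mul_le_iff₀ hpos] at hle
  have hνc : ⟪ν, c⟫ = ⟪ν, ζ⟫ + ε₀ / 2 * ⟪ν, w⟫ := by
    rw [hc, inner_add_right, real_inner_smul_right]
  have hmul : ‖c‖ * ⟪ν, ζ⟫ ≤ ⟪ν, ζ⟫ := by nlinarith [hν ζ hζC]
  have hprod : ε₀ / 2 * ⟪ν, w⟫ ≤ 0 := by linarith
  exact nonpos_of_mul_nonpos_right hprod hε
end

section
/- Let E be a real inner product space, let v₁, …, vₖ ∈ E be finitely many nonzero vectors (k ≥ 1), let C = {λ₁·v₁ + ⋯ + λₖ·vₖ : λᵢ ≥ 0 for all i} be the polyhedral cone they generate, and let ν ∈ E satisfy ⟪ν, vᵢ⟫ ≤ 0 for all i. Then for every nonzero c ∈ C, ⟪ν, c⟫/‖c‖ ≤ max_{1≤i≤k} ⟪ν, vᵢ⟫/‖vᵢ‖. In particular, the maximum of ⟪ν, ζ⟫ over unit vectors ζ ∈ C is attained at one of the normalized generators vᵢ/‖vᵢ‖, i.e., the minimum angle between ν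 and a unit vector of C occurs along a ray of C. (Proposition 4.9 of the paper, for finitely generated cones.) -/
open scoped RealInnerProductSpace

/-- Proposition 4.9 (for finitely generated cones): if `ν` satisfies
`⟪ν, vᵢ⟫ ≤ 0` for all generators `vᵢ` of the polyhedral cone
`C = {λ₁ v₁ + ⋯ + λₖ vₖ : λᵢ ≥ 0}`, then for every nonzero `c ∈ C` the cosine
`⟪ν, c⟫/‖c‖` is at most the maximum of the cosines `⟪ν, vᵢ⟫/‖vᵢ‖` over the
generators; i.e. the minimum angle between `ν` and a unit vector of `C` occurs
along a ray of `C`. -/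
theorem inner_div_norm_le_sup_generators {E : Type*} [NormedAddCommGroup E]
    [InnerProductSpace ℝ E] {k : ℕ} (hk : 1 ≤ k)
    (v : Fin k → E) (hv : ∀ i, v i ≠ 0)
    (ν : E) (hν : ∀ i, ⟪ν, v i⟫ ≤ 0)
    (c : E) (hc0 : c ≠ 0)
    (hc : ∃ lam : Fin k → ℝ, (∀ i, 0 ≤ lam i) ∧ c = ∑ i, lam i • v i) :
    ⟪ν, c⟫ / ‖c‖ ≤
      Finset.univ.sup' (Finset.univ_nonempty_iff.mpr (Fin.pos_iff_nonempty.mp hk))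
        (fun i => ⟪ν, v i⟫ / ‖v i‖) := by
  obtain ⟨lam, hlam, rfl⟩ := hc
  set M := Finset.univ.sup' (Finset.univ_nonempty_iff.mpr (Fin.pos_iff_nonempty.mp hk))
    (fun i => ⟪ν, v i⟫ / ‖v i‖)
  have hM0 : M ≤ 0 :=
    Finset.sup'_le _ _ fun i _ => div_nonpos_of_nonpos_of_nonneg (hν i) (norm_nonneg _)
  have hinner (i : Fin k) : ⟪ν, v i⟫ ≤ M * ‖v i‖ :=
    (div_le_iff₀ (norm_pos_iff.mpr (hv i))).mp
      (Finset.le_sup' (fun i => ⟪ν, v i⟫ / ‖v i‖) (Finset.mem_univ i))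
  have hnorm : ‖∑ i, lam i • v i‖ ≤ ∑ i, lam i * ‖v i‖ :=
    norm_sum_le_of_le _ fun i _ => by rw [norm_smul, Real.norm_of_nonneg (hlam i)]
  rw [div_le_iff₀ (norm_pos_iff.mpr hc0)]
  calc ⟪ν, ∑ i, lam i • v i⟫ = ∑ i, lam i * ⟪ν, v i⟫ := by
        simp only [inner_sum, real_inner_smul_right]
    _ ≤ ∑ i, lam i * (M * ‖v i‖) :=
        Finset.sum_le_sum fun i _ => mul_le_mul_of_nonneg_left (hinner i) (hlam i)
    _ = M * ∑ i, lam i * ‖v i‖ := by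
        rw [Finset.mul_sum]
        exact Finset.sum_congr rfl fun i _ => mul_left_comm _ _ _
    _ ≤ M * ‖∑ i, lam i • v i‖ := mul_le_mul_of_nonpos_left hnorm hM0
end

section
/- Let V ⊆ EuclideanSpace ℝ (Fin d) be a nonempty convex polyhedron, i.e., an intersection of finitely many closed half-spaces {y : ⟪uⱼ, y⟫ ≤ cⱼ} (j in a finite index set). Let x ∈ V and let ν be an outer support vector for V at x. Then there exists a minimal jet frame at x along V: a jet frame ζ̄* at x along V such that for every jet frame ζ̄ at x along V, the angle sequence of ζ̄* is lexicographically less than or equal to the angle sequence of ζ̄. (The existence statement of Theorem 4.12 of the paper.) -/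
open scoped RealInnerProductSpace

/-- A jet frame at `x` along `V`: a (possibly empty) finite list of mutually
orthogonal unit vectors such that `x + ε·J_{ζ̄}(ε)` lies in the relative
(intrinsic) interior of `V` for all sufficiently small `ε > 0`. -/
def IsJetFrame {E : Type*} [NormedAddCommGroup E] [InnerProductSpace ℝ E]
    (V : Set E) (x : E) {r : ℕ} (ζ : Fin r → E) : Prop :=
  Orthonormal ℝ ζ ∧
    ∃ ε₀ > 0, ∀ ε : ℝ, 0 < ε → ε < ε₀ → x + ε • unitJet ζ ε ∈ intrinsicInterior ℝ V

/-- Padding a finite real sequence with zeros on the right. -/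
def pad {r : ℕ} (a : Fin r → ℝ) : ℕ → ℝ := fun n => if h : n < r then a ⟨n, h⟩ else 0

/-- Lexicographic comparison (`≤`) of padded real sequences. -/
def LexLE (a b : ℕ → ℝ) : Prop :=
  a = b ∨ ∃ n : ℕ, (∀ m : ℕ, m < n → a m = b m) ∧ a n < b n

open Filter Topology

section JetList

variable {E : Type*} [NormedAddCommGroup E] [InnerProductSpace ℝ E]

/-- The polynomial curve `z₁ + ε z₂ + ε² z₃ + ⋯` with coefficients in a list. -/
def jetPoly : List E → ℝ → E
  | [], _ => 0
  | z :: l, ε => z + ε • jetPoly l ε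

/-- Jet frames inside `L` into the open cone cut out by `⟪u j, ·⟫ < 0` for `j ∈ A`, described
vector by vector: each new vector may only be used to satisfy constraints that are not yet
satisfied strictly. -/
def IsJetList {ι : Type*} (u : ι → E) : Set ι → Submodule ℝ E → List E → Prop
  | A, _, [] => A = ∅
  | A, L, z :: l => z ∈ L ∧ ‖z‖ = 1 ∧ (∀ j ∈ A, ⟪u j, z⟫ ≤ 0) ∧
      IsJetList u {j | j ∈ A ∧ ⟪u j, z⟫ = 0} (L ⊓ (ℝ ∙ z)ᗮ) l

/-- The angle sequence of a list, padded with zeros. -/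
def listAngles (ν : E) (l : List E) : ℕ → ℝ := fun n => -⟪ν, l.getD n 0⟫

theorem pad_eq_listAngles (ν : E) {r : ℕ} (ζ : Fin r → E) :
    pad (fun i => -⟪ν, ζ i⟫) = listAngles ν (List.ofFn ζ) := by
  funext n
  by_cases h : n < r <;> simp [pad, listAngles, h, List.getD]

theorem lexLE_iff (a b : ℕ → ℝ) : LexLE a b ↔ toLex a ≤ toLex b := by
  rw [le_iff_eq_or_lt]
  simp only [LexLE, toLex_inj]
  rfl

theorem LexLE.trans {a b c : ℕ → ℝ} (hab : LexLE a b) (hbc : LexLE b c) : LexLE a c := by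
  rw [lexLE_iff] at *
  exact hab.trans hbc

theorem lexLE_listAngles_cons_of_lt {ν z z' : E} (l l' : List E) (h : ⟪ν, z'⟫ < ⟪ν, z⟫) :
    LexLE (listAngles ν (z :: l)) (listAngles ν (z' :: l')) :=
  Or.inr ⟨0, by simp, by simpa [listAngles] using h⟩

theorem lexLE_listAngles_cons_of_eq {ν z z' : E} {l l' : List E} (h : ⟪ν, z⟫ = ⟪ν, z'⟫)
    (hl : LexLE (listAngles ν l) (listAngles ν l')) :
    LexLE (listAngles ν (z :: l)) (listAngles ν (z' :: l')) := by
  rcases hl with hl | ⟨n, hn, hlt⟩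
  · left
    funext k
    cases k with
    | zero => simp [listAngles, h]
    | succ k => simpa [listAngles] using congrFun hl k
  · refine Or.inr ⟨n + 1, fun m hm => ?_, by simpa [listAngles] using hlt⟩
    cases m with
    | zero => simp [listAngles, h]
    | succ m => simpa [listAngles] using hn m (by omega)

theorem listAngles_map {ν : E} (R : E ≃ₗᵢ[ℝ] E) (hR : R ν = ν) (l : List E) :
    listAngles ν (l.map R) = listAngles ν l := by
  funext n
  have h : (l.map R).getD n 0 = R (l.getD n 0) := by
    rw [← map_zero R, List.getD_map, map_zero]
  rw [listAngles, listAngles, h]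
  nth_rewrite 1 [← hR]
  rw [R.inner_map_map]

theorem mem_orthogonal_span_singleton {z v : E} : v ∈ (ℝ ∙ z)ᗮ ↔ ⟪z, v⟫ = 0 :=
  Submodule.mem_orthogonal_singleton_iff_inner_right

theorem IsJetList.map {ι : Type*} {u : ι → E} (R : E ≃ₗᵢ[ℝ] E) {l : List E} {A : Set ι}
    {L L' : Submodule ℝ E} (hu : ∀ j ∈ A, R (u j) = u j) (hL : ∀ v ∈ L, R v ∈ L')
    (hl : IsJetList u A L l) : IsJetList u A L' (l.map R) := by
  induction l generalizing A L L' with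
  | nil => exact hl
  | cons z l ih =>
    obtain ⟨hz, hz1, hle, hl⟩ := hl
    have hin : ∀ j ∈ A, ⟪u j, R z⟫ = ⟪u j, z⟫ := fun j hj => by
      nth_rewrite 1 [← hu j hj]
      exact R.inner_map_map _ _
    refine ⟨hL z hz, by simpa using hz1, fun j hj => by rw [hin j hj]; exact hle j hj, ?_⟩
    have hA : {j | j ∈ A ∧ ⟪u j, R z⟫ = 0} = {j | j ∈ A ∧ ⟪u j, z⟫ = 0} := by
      ext j
      exact and_congr_right fun hj => by rw [hin j hj]
    rw [hA]
    refine ih (fun j hj => hu j hj.1) (fun v hv => Submodule.mem_inf.2 ⟨hL v (Submodule.mem_inf.1 hv).1, ?_⟩) hl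
    have := mem_orthogonal_span_singleton.1 (Submodule.mem_inf.1 hv).2
    rw [mem_orthogonal_span_singleton, R.inner_map_map, this]

theorem IsJetList.mem {ι : Type*} {u : ι → E} {A : Set ι} {L : Submodule ℝ E}
    {l : List E} (hl : IsJetList u A L l) : ∀ z ∈ l, z ∈ L := by
  induction l generalizing A L with
  | nil => simp
  | cons z l ih =>
    intro y hy
    rcases List.mem_cons.1 hy with rfl | hy
    · exact hl.1
    · exact (ih hl.2.2.2 y hy).1

theorem IsJetList.norm_eq_one {ι : Type*} {u : ι → E} {A : Set ι} {L : Submodule ℝ E}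
    {l : List E} (hl : IsJetList u A L l) : ∀ z ∈ l, ‖z‖ = 1 := by
  induction l generalizing A L with
  | nil => simp
  | cons z l ih =>
    intro y hy
    rcases List.mem_cons.1 hy with rfl | hy
    · exact hl.2.1
    · exact ih hl.2.2.2 y hy

theorem IsJetList.pairwise {ι : Type*} {u : ι → E} {A : Set ι} {L : Submodule ℝ E}
    {l : List E} (hl : IsJetList u A L l) : l.Pairwise fun y z => ⟪y, z⟫ = 0 := by
  induction l generalizing A L with
  | nil => simp
  | cons z l ih =>
    refine List.pairwise_cons.2 ⟨fun y hy => ?_, ih hl.2.2.2⟩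
    exact mem_orthogonal_span_singleton.1 (hl.2.2.2.mem y hy).2

theorem eventually_add_smul_inner_lt {a b : E} {c : ℝ} {f : ℝ → E}
    (h : ⟪a, b⟫ < c) (hf : Tendsto f (𝓝[>] (0 : ℝ)) (𝓝 0)) :
    ∀ᶠ ε in 𝓝[>] (0 : ℝ), ⟪a, b + f ε⟫ < c := by
  have : Tendsto (fun ε => ⟪a, b + f ε⟫) (𝓝[>] (0 : ℝ)) (𝓝 ⟪a, b + 0⟫) :=
    tendsto_const_nhds.inner (tendsto_const_nhds.add hf)
  rw [add_zero] at this
  exact this.eventually_lt_const h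

theorem continuous_jetPoly (l : List E) : Continuous (jetPoly l) := by
  induction l with
  | nil => exact continuous_const
  | cons z l ih => exact continuous_const.add (continuous_id.smul ih)

theorem tendsto_smul_jetPoly (l : List E) :
    Tendsto (fun ε : ℝ => ε • jetPoly l ε) (𝓝[>] 0) (𝓝 0) := by
  have h : Continuous fun ε : ℝ => ε • jetPoly l ε := continuous_id.smul (continuous_jetPoly l)
  simpa using (h.tendsto 0).mono_left nhdsWithin_le_nhds

theorem jetPoly_mem {L : Submodule ℝ E} {l : List E} (h : ∀ z ∈ l, z ∈ L) (ε : ℝ) :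
    jetPoly l ε ∈ L := by
  induction l with
  | nil => exact L.zero_mem
  | cons z l ih =>
    exact L.add_mem (h z (by simp))
      (L.smul_mem _ (ih fun y hy => h y (by simp [hy])))

theorem IsJetList.eventually_inner_neg {ι : Type*} {u : ι → E} {A : Set ι} {L : Submodule ℝ E}
    {l : List E} (hl : IsJetList u A L l) {j : ι} (hj : j ∈ A) :
    ∀ᶠ ε in 𝓝[>] (0 : ℝ), ⟪u j, jetPoly l ε⟫ < 0 := by
  induction l generalizing A L with
  | nil =>
    have hA : A = ∅ := hl
    simp [hA] at hj
  | cons z l ih =>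
    obtain ⟨-, -, hle, hl⟩ := hl
    rcases (hle j hj).lt_or_eq with h | h
    · exact eventually_add_smul_inner_lt h (tendsto_smul_jetPoly l)
    · filter_upwards [ih hl ⟨hj, h⟩, self_mem_nhdsWithin] with ε hε hpos
      rw [jetPoly, inner_add_right, h, zero_add, inner_smul_right]
      exact mul_neg_of_pos_of_neg hpos hε

theorem isJetList_of_eventually {ι : Type*} {u : ι → E} {A : Set ι} {L : Submodule ℝ E}
    (hLc : IsClosed (L : Set E)) {l : List E} (h1 : ∀ z ∈ l, ‖z‖ = 1)
    (h0 : l.Pairwise fun y z => ⟪y, z⟫ = 0)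
    (hL : ∀ᶠ ε in 𝓝[>] (0 : ℝ), jetPoly l ε ∈ L)
    (hA : ∀ j ∈ A, ∀ᶠ ε in 𝓝[>] (0 : ℝ), ⟪u j, jetPoly l ε⟫ < 0) : IsJetList u A L l := by
  induction l generalizing A L with
  | nil =>
    refine Set.eq_empty_iff_forall_notMem.2 fun j hj => ?_
    obtain ⟨ε, hε⟩ := (hA j hj).exists
    simp [jetPoly] at hε
  | cons z l ih =>
    have hlim : Tendsto (jetPoly (z :: l)) (𝓝[>] (0 : ℝ)) (𝓝 z) := by
      simpa [jetPoly] using tendsto_const_nhds.add (tendsto_smul_jetPoly l)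
    have hz : z ∈ L := hLc.mem_of_tendsto hlim hL
    obtain ⟨hzl, h0⟩ := List.pairwise_cons.1 h0
    refine ⟨hz, h1 z (by simp), fun j hj => ?_, ?_⟩
    · exact le_of_tendsto (tendsto_const_nhds.inner hlim) ((hA j hj).mono fun _ h => h.le)
    refine ih (hLc.inter (Submodule.isClosed_orthogonal _)) (fun y hy => h1 y (by simp [hy])) h0
      ?_ fun j hj => ?_
    · filter_upwards [hL, self_mem_nhdsWithin] with ε hε hpos
      refine ⟨?_, jetPoly_mem (fun y hy => mem_orthogonal_span_singleton.2 (hzl y hy)) ε⟩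
      have := (L.add_mem_iff_right hz).1 hε
      exact (L.smul_mem_iff (ne_of_gt hpos)).1 this
    · filter_upwards [hA j hj.1, self_mem_nhdsWithin] with ε hε hpos
      rw [jetPoly, inner_add_right, hj.2, zero_add, inner_smul_right] at hε
      exact neg_of_mul_neg_right hε (le_of_lt hpos)

theorem exists_minimal_jetList [FiniteDimensional ℝ E] {ι : Type*} [Finite ι] (u : ι → E) (ν : E)
    (A : Set ι) (L : Submodule ℝ E)
    (hν : ∀ v ∈ L, (∀ j ∈ A, ⟪u j, v⟫ ≤ 0) → ⟪ν, v⟫ ≤ 0)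
    (hp : ∃ p ∈ L, ∀ j ∈ A, ⟪u j, p⟫ < 0) :
    ∃ l, IsJetList u A L l ∧
      ∀ l', IsJetList u A L l' → LexLE (listAngles ν l) (listAngles ν l') := by
  induction hn : Module.finrank ℝ L using Nat.strong_induction_on generalizing A L with
  | _ n ih =>
  subst hn
  obtain ⟨p, hpL, hp⟩ := hp
  rcases A.eq_empty_or_nonempty with rfl | ⟨j₀, hj₀⟩
  · refine ⟨[], rfl, fun l' hl' => Or.inl ?_⟩
    have h0 : ∀ v ∈ L, ⟪ν, v⟫ = 0 := fun v hv => by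
      have h1 := hν v hv (by simp)
      have h2 := hν (-v) (L.neg_mem hv) (by simp)
      rw [inner_neg_right] at h2
      linarith
    funext k
    have : l'.getD k 0 ∈ L := by
      rw [List.getD_eq_getElem?_getD]
      rcases hk : l'[k]? with _ | z
      · simp
      · exact hl'.mem z (List.mem_of_getElem? hk)
    rw [listAngles, listAngles, h0 _ this]
    simp
  set K : Set E := Metric.sphere 0 1 ∩ {v | v ∈ L ∧ ∀ j ∈ A, ⟪u j, v⟫ ≤ 0}
  have hKc : IsCompact K := by
    refine (isCompact_sphere 0 1).inter_right ((Submodule.closed_of_finiteDimensional L).inter ?_)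
    have h : {v : E | ∀ j ∈ A, ⟪u j, v⟫ ≤ 0} = ⋂ j ∈ A, {v | ⟪u j, v⟫ ≤ 0} := by
      ext v
      simp
    change IsClosed {v : E | ∀ j ∈ A, ⟪u j, v⟫ ≤ 0}
    rw [h]
    exact isClosed_biInter fun j _ =>
      isClosed_le (continuous_const.inner continuous_id) continuous_const
  have hcone : ∀ v ∈ L, (∀ j ∈ A, ⟪u j, v⟫ ≤ 0) → v ≠ 0 → ‖v‖⁻¹ • v ∈ K := by
    refine fun v hv hle hv0 => ⟨?_, L.smul_mem _ hv, fun j hj => ?_⟩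
    · simp [norm_smul, hv0]
    · rw [inner_smul_right]
      exact mul_nonpos_of_nonneg_of_nonpos (by positivity) (hle j hj)
  have hp0 : p ≠ 0 := by
    rintro rfl
    simpa using hp j₀ hj₀
  obtain ⟨z₀, hz₀, hmax⟩ := hKc.exists_isMaxOn
    ⟨_, hcone p hpL (fun j hj => (hp j hj).le) hp0⟩
    (f := fun v => ⟪ν, v⟫) (continuous_const.inner continuous_id).continuousOn
  set M : Set E := {z | z ∈ K ∧ ⟪ν, z⟫ = ⟪ν, z₀⟫}
  let act : E → Set ι := fun z => {j | j ∈ A ∧ ⟪u j, z⟫ = 0}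
  have hstep : ∀ z ∈ M, ∃ l, IsJetList u (act z) (L ⊓ (ℝ ∙ z)ᗮ) l ∧
      ∀ l', IsJetList u (act z) (L ⊓ (ℝ ∙ z)ᗮ) l' →
        LexLE (listAngles ν l) (listAngles ν l') := by
    rintro z ⟨⟨hz1, hzL, hzA⟩, hzν⟩
    have hz1 : ‖z‖ = 1 := by simpa using hz1
    have hzz : ⟪z, z⟫ = 1 := by rw [real_inner_self_eq_norm_sq, hz1, one_pow]
    refine ih _ ?_ _ _ ?_ ?_ rfl
    · refine Submodule.finrank_lt_finrank_of_lt (lt_of_le_of_ne inf_le_left fun h => ?_)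
      have : z ∈ L ⊓ (ℝ ∙ z)ᗮ := h.symm.le hzL
      have := mem_orthogonal_span_singleton.1 this.2
      rw [hzz] at this
      exact one_ne_zero this
    · rintro v ⟨hvL, hvz⟩ hvA
      have hvz := mem_orthogonal_span_singleton.1 hvz
      have hev : ∀ᶠ ε in 𝓝[>] (0 : ℝ), ∀ j, j ∈ A → ⟪u j, z + ε • v⟫ ≤ 0 := by
        refine eventually_all.2 fun j => ?_
        by_cases hj : j ∈ A
        · rcases (hzA j hj).lt_or_eq with h | h
          · have h0 : Tendsto (fun ε : ℝ => ε • v) (𝓝[>] 0) (𝓝 0) := by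
              simpa [jetPoly] using tendsto_smul_jetPoly [v]
            exact (eventually_add_smul_inner_lt h h0).mono fun _ h _ => h.le
          · filter_upwards [self_mem_nhdsWithin] with ε hε _
            rw [inner_add_right, h, zero_add, inner_smul_right]
            exact mul_nonpos_of_nonneg_of_nonpos (le_of_lt hε) (hvA j ⟨hj, h⟩)
        · simp [hj]
      obtain ⟨ε, hε, hpos⟩ := (hev.and self_mem_nhdsWithin).exists
      have hpos : 0 < ε := hpos
      set y := z + ε • v with hy
      have hzy : ⟪z, y⟫ = 1 := by
        rw [hy, inner_add_right, inner_smul_right, hvz, hzz]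
        simp
      have hy1 : 1 ≤ ‖y‖ := by
        have := real_inner_le_norm z y
        rwa [hzy, hz1, one_mul] at this
      have hy0 : y ≠ 0 := by
        rw [← norm_pos_iff]
        linarith
      have hyK := hmax (hcone y (L.add_mem hzL (L.smul_mem _ hvL)) hε hy0)
      have hyK : ‖y‖⁻¹ * ⟪ν, y⟫ ≤ ⟪ν, z⟫ := by
        rw [hzν, ← inner_smul_right]
        exact hyK
      rw [inv_mul_le_iff₀ (by linarith)] at hyK
      have hzle := hν z hzL hzA
      have : ⟪ν, y⟫ ≤ ⟪ν, z⟫ := by nlinarith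
      rw [hy, inner_add_right, inner_smul_right] at this
      by_contra! hcon
      nlinarith [mul_pos hpos hcon]
    · refine ⟨p - ⟪z, p⟫ • z, ⟨L.sub_mem hpL (L.smul_mem _ hzL), ?_⟩, fun j hj => ?_⟩
      · rw [SetLike.mem_coe, mem_orthogonal_span_singleton, inner_sub_right, inner_smul_right, hzz]
        ring
      · rw [inner_sub_right, inner_smul_right, hj.2, mul_zero, sub_zero]
        exact hp j hj.1
  choose! f hf hfmin using hstep
  choose! rep hrep hact using fun (B : Set ι) (hB : B ∈ act '' M) => hB
  obtain ⟨B, hB, hBmin⟩ := (Set.toFinite (act '' M)).exists_minimalFor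
    (fun B => toLex (listAngles ν (f (rep B)))) _ ⟨_, z₀, ⟨hz₀, rfl⟩, rfl⟩
  obtain ⟨⟨hz1, hzL, hzA⟩, hzν⟩ := hrep B hB
  refine ⟨rep B :: f (rep B), ⟨hzL, by simpa using hz1, hzA, hf _ (hrep B hB)⟩, fun l' hl' => ?_⟩
  cases l' with
  | nil => exact absurd (show A = ∅ from hl') (Set.Nonempty.ne_empty ⟨j₀, hj₀⟩)
  | cons y l' =>
  obtain ⟨hyL, hy1, hyA, hl'⟩ := hl'
  have hyK : y ∈ K := ⟨by simpa using hy1, hyL, hyA⟩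
  have hyle : ⟪ν, y⟫ ≤ ⟪ν, z₀⟫ := hmax hyK
  rcases hyle.lt_or_eq with hlt | heq
  · exact lexLE_listAngles_cons_of_lt _ _ (by rwa [hzν])
  refine lexLE_listAngles_cons_of_eq (hzν.trans heq.symm) ?_
  have hyM : act y ∈ act '' M := ⟨y, ⟨hyK, heq⟩, rfl⟩
  set z := rep (act y)
  obtain ⟨⟨hz1', hzL', -⟩, hzν'⟩ := hrep _ hyM
  have hle : LexLE (listAngles ν (f (rep B))) (listAngles ν (f z)) := by
    rw [lexLE_iff]
    rcases le_total (toLex (listAngles ν (f (rep B)))) (toLex (listAngles ν (f z))) with h | h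
    · exact h
    · exact hBmin hyM h
  refine hle.trans ?_
  -- The reflection exchanging `y` and `z` fixes `ν` and all constraints active at both.
  let R : E ≃ₗᵢ[ℝ] E := (ℝ ∙ (y - z))ᗮ.reflection
  have hfix : ∀ v, ⟪v, y⟫ = ⟪v, z⟫ → R v = v := fun v hv =>
    Submodule.reflection_mem_subspace_eq_self (mem_orthogonal_span_singleton.2 (by
      rw [real_inner_comm, inner_sub_right, hv, sub_self]))
  have hRy : R y = z := Submodule.reflection_sub (by rw [hy1]; simpa using hz1'.symm)
  have hRL : ∀ v ∈ L, R v ∈ L := fun v hv => by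
    have h1 : R v = v - (2 : ℝ) • (ℝ ∙ (y - z)).starProjection v := by
      simp only [R]
      rw [Submodule.reflection_orthogonal_apply, Submodule.reflection_apply, two_smul, two_smul]
      abel
    rw [h1]
    refine L.sub_mem hv (L.smul_mem _ ?_)
    exact (Submodule.span_singleton_le_iff_mem _ _).2 (L.sub_mem hyL hzL')
      (Submodule.starProjection_apply_mem _ _)
  rw [← listAngles_map R (hfix ν (heq.trans hzν'.symm)) l']
  refine hfmin z (hrep _ hyM) _ ?_
  rw [hact _ hyM]
  refine IsJetList.map R (fun j hj => hfix _ ?_) 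
    (fun v hv => Submodule.mem_inf.2 ⟨hRL v (Submodule.mem_inf.1 hv).1, ?_⟩) hl'
  · have hj' : j ∈ act z := by rw [hact _ hyM]; exact hj
    rw [hj.2, hj'.2]
  · rw [mem_orthogonal_span_singleton, ← hRy, R.inner_map_map]
    exact mem_orthogonal_span_singleton.1 (Submodule.mem_inf.1 hv).2

theorem sum_smul_eq_smul_jetPoly {r : ℕ} (ζ : Fin r → E) (ε : ℝ) :
    ∑ i : Fin r, ε ^ (i.1 + 1) • ζ i = ε • jetPoly (List.ofFn ζ) ε := by
  induction r with
  | zero => simp [jetPoly]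
  | succ r ih =>
    rw [Fin.sum_univ_succ, List.ofFn_succ, jetPoly, smul_add, ← ih, Finset.smul_sum]
    congr 1
    · simp
    · refine Finset.sum_congr rfl fun i _ => ?_
      rw [smul_smul, Fin.val_succ]
      ring_nf

theorem exists_smul_unitJet_eq {r : ℕ} (ζ : Fin r → E) :
    ∃ t : ℝ → ℝ, (∀ ε, 0 < ε → 0 < t ε ∧ t ε ≤ ε) ∧
      ∀ ε, ε • unitJet ζ ε = t ε • jetPoly (List.ofFn ζ) ε := by
  cases r with
  | zero => exact ⟨id, fun ε h => ⟨h, le_rfl⟩, fun ε => by simp [unitJet, jetPoly]⟩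
  | succ r =>
    refine ⟨fun ε => ε * ((Real.sqrt (∑ i : Fin (r + 1), ε ^ (2 * (i.1 + 1))))⁻¹ * ε),
      fun ε hε => ?_, fun ε => ?_⟩
    · have h : ε ≤ Real.sqrt (∑ i : Fin (r + 1), ε ^ (2 * (i.1 + 1))) := by
        refine Real.le_sqrt_of_sq_le ?_
        rw [Fin.sum_univ_succ]
        simp only [Fin.val_zero, zero_add, mul_one, le_add_iff_nonneg_right]
        positivity
      have hpos := hε.trans_le h
      refine ⟨by positivity, mul_le_of_le_one_right hε.le ?_⟩
      rwa [inv_mul_le_iff₀ hpos, mul_one]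
    · rw [unitJet, sum_smul_eq_smul_jetPoly]
      simp only [smul_smul]

theorem mem_intrinsicInterior_polyhedron_iff [FiniteDimensional ℝ E] {ι : Type*} [Finite ι]
    {u : ι → E} {c : ι → ℝ} {V : Set E} (hV : V = ⋂ j : ι, {y : E | ⟪u j, y⟫ ≤ c j}) {x : E}
    (hx : x ∈ V) (y : E) :
    y ∈ intrinsicInterior ℝ V ↔ y - x ∈ vectorSpan ℝ V ∧
      ∀ j, (∃ v ∈ vectorSpan ℝ V, ⟪u j, v⟫ ≠ 0) → ⟪u j, y⟫ < c j := by
  have hVm : ∀ z, z ∈ V ↔ ∀ j, ⟪u j, z⟫ ≤ c j := fun z => by simp [hV]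
  have hxa : x ∈ affineSpan ℝ V := subset_affineSpan ℝ V hx
  have haff : ∀ z, z ∈ affineSpan ℝ V ↔ z - x ∈ vectorSpan ℝ V := fun z => by
    rw [← direction_affineSpan, ← vsub_eq_sub, AffineSubspace.vsub_right_mem_direction_iff_mem hxa]
  rw [mem_intrinsicInterior]
  constructor
  · rintro ⟨⟨z, hz⟩, hzi, rfl⟩
    refine ⟨(haff z).1 hz, fun j ⟨v, hv, hjv⟩ => ?_⟩
    have hzV := (hVm z).1 (interior_subset (s := Subtype.val ⁻¹' V) hzi)
    refine lt_of_le_of_ne (hzV j) fun heq => ?_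
    have hmem : ∀ t : ℝ, z + (t * ⟪u j, v⟫) • v ∈ affineSpan ℝ V := fun t => by
      rw [haff, add_sub_right_comm]
      exact Submodule.add_mem _ ((haff z).1 hz) (Submodule.smul_mem _ _ hv)
    have hcont : Continuous fun t : ℝ => (⟨z + (t * ⟪u j, v⟫) • v, hmem t⟩ : affineSpan ℝ V) := by
      fun_prop
    have h0 : ∀ᶠ t in 𝓝[>] (0 : ℝ), z + (t * ⟪u j, v⟫) • v ∈ V := by
      refine nhdsWithin_le_nhds ?_
      refine hcont.continuousAt.preimage_mem_nhds (t := Subtype.val ⁻¹' V) ?_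
      simpa using mem_interior_iff_mem_nhds.1 hzi
    obtain ⟨t, ht, hpos⟩ := (h0.and self_mem_nhdsWithin).exists
    have hpos : 0 < t := hpos
    have := (hVm _).1 ht j
    rw [inner_add_right, inner_smul_right, heq] at this
    have : 0 < ⟪u j, v⟫ * ⟪u j, v⟫ := mul_self_pos.2 hjv
    nlinarith
  · rintro ⟨hy, hlt⟩
    refine ⟨⟨y, (haff y).2 hy⟩, ?_, rfl⟩
    rw [mem_interior_iff_mem_nhds]
    have hev : ∀ᶠ z : affineSpan ℝ V in 𝓝 ⟨y, (haff y).2 hy⟩, ∀ j,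
        (∃ v ∈ vectorSpan ℝ V, ⟪u j, v⟫ ≠ 0) → ⟪u j, (z : E)⟫ < c j := by
      refine eventually_all.2 fun j => ?_
      by_cases hj : ∃ v ∈ vectorSpan ℝ V, ⟪u j, v⟫ ≠ 0
      · have hc : Continuous fun z : affineSpan ℝ V => ⟪u j, (z : E)⟫ :=
          continuous_const.inner continuous_subtype_val
        exact ((hc.tendsto ⟨y, (haff y).2 hy⟩).eventually_lt_const (hlt j hj)).mono fun _ h _ => h
      · exact Eventually.of_forall fun _ h => absurd h hj
    filter_upwards [hev] with z hz
    refine (hVm z).2 fun j => ?_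
    by_cases hj : ∃ v ∈ vectorSpan ℝ V, ⟪u j, v⟫ ≠ 0
    · exact (hz j hj).le
    · push Not at hj
      have := hj _ ((haff z).1 z.2)
      rw [inner_sub_right, sub_eq_zero] at this
      rw [this]
      exact (hVm x).1 hx j

theorem orthonormal_iff_ofFn {r : ℕ} (ζ : Fin r → E) :
    Orthonormal ℝ ζ ↔ (∀ z ∈ List.ofFn ζ, ‖z‖ = 1) ∧
      (List.ofFn ζ).Pairwise fun y z => ⟪y, z⟫ = 0 := by
  rw [Orthonormal, List.pairwise_ofFn]
  refine and_congr (by simp [List.mem_ofFn]) ⟨fun h i j hij => h hij.ne, fun h i j hij => ?_⟩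
  rcases hij.lt_or_gt with hij | hij
  · exact h hij
  · rw [real_inner_comm]
    exact h hij

theorem isJetFrame_iff_isJetList [FiniteDimensional ℝ E] {ι : Type*} [Finite ι]
    {u : ι → E} {c : ι → ℝ} {V : Set E} (hV : V = ⋂ j : ι, {y : E | ⟪u j, y⟫ ≤ c j}) {x : E}
    (hx : x ∈ V) {r : ℕ} (ζ : Fin r → E) :
    IsJetFrame V x ζ ↔
      IsJetList u {j | (∃ v ∈ vectorSpan ℝ V, ⟪u j, v⟫ ≠ 0) ∧ ⟪u j, x⟫ = c j}
        (vectorSpan ℝ V) (List.ofFn ζ) := by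
  have hxm : ∀ j, ⟪u j, x⟫ ≤ c j := by simpa [hV] using hx
  obtain ⟨t, ht, hjet⟩ := exists_smul_unitJet_eq ζ
  have hfilter : (∃ ε₀ > 0, ∀ ε : ℝ, 0 < ε → ε < ε₀ → x + ε • unitJet ζ ε ∈ intrinsicInterior ℝ V)
      ↔ ∀ᶠ ε in 𝓝[>] (0 : ℝ), x + ε • unitJet ζ ε ∈ intrinsicInterior ℝ V := by
    rw [Filter.Eventually, mem_nhdsGT_iff_exists_Ioo_subset]
    exact exists_congr fun a => and_congr_right fun _ =>
      ⟨fun h ε hε => h ε hε.1 hε.2, fun h ε h0 h1 => h ⟨h0, h1⟩⟩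
  rw [IsJetFrame, hfilter, orthonormal_iff_ofFn]
  simp only [hjet, mem_intrinsicInterior_polyhedron_iff hV hx, add_sub_cancel_left]
  constructor
  · rintro ⟨⟨h1, h0⟩, hev⟩
    refine isJetList_of_eventually (Submodule.closed_of_finiteDimensional _) h1 h0 ?_
      fun j hj => ?_
    · filter_upwards [hev, self_mem_nhdsWithin] with ε hε hpos
      exact (Submodule.smul_mem_iff _ (ht ε hpos).1.ne').1 hε.1
    · filter_upwards [hev, self_mem_nhdsWithin] with ε hε hpos
      have := hε.2 j hj.1
      rw [inner_add_right, hj.2, inner_smul_right] at this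
      exact neg_of_mul_neg_right (by linarith) (ht ε hpos).1.le
  · intro hl
    refine ⟨⟨hl.norm_eq_one, hl.pairwise⟩, ?_⟩
    refine Eventually.and
      (Eventually.of_forall fun ε => Submodule.smul_mem _ _ (jetPoly_mem hl.mem ε))
      (eventually_all.2 fun j => ?_)
    by_cases hj : ∃ v ∈ vectorSpan ℝ V, ⟪u j, v⟫ ≠ 0
    · rcases (hxm j).lt_or_eq with h | h
      · have ht0 : Tendsto t (𝓝[>] 0) (𝓝 0) := by
          refine tendsto_of_tendsto_of_tendsto_of_le_of_le' tendsto_const_nhds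
            (tendsto_id.mono_left nhdsWithin_le_nhds) ?_ ?_
          · filter_upwards [self_mem_nhdsWithin] with ε hε using (ht ε hε).1.le
          · filter_upwards [self_mem_nhdsWithin] with ε hε using (ht ε hε).2
        have hlim := ht0.smul
          (((continuous_jetPoly (List.ofFn ζ)).tendsto 0).mono_left nhdsWithin_le_nhds)
        rw [zero_smul] at hlim
        exact (eventually_add_smul_inner_lt h hlim).mono fun _ h _ => h
      · filter_upwards [hl.eventually_inner_neg ⟨hj, h⟩, self_mem_nhdsWithin] with ε hε hpos _
        rw [inner_add_right, h, inner_smul_right]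
        have := mul_neg_of_pos_of_neg (ht ε hpos).1 hε
        linarith
    · exact Eventually.of_forall fun _ h => absurd h hj

end JetList

/-- Theorem 4.12 (existence part): given a nonempty convex polyhedron `V` (an
intersection of finitely many closed half-spaces) in Euclidean space, a point
`x ∈ V`, and an outer support vector `ν` for `V` at `x`, there exists a minimal
jet frame at `x` along `V`: a jet frame whose angle sequence is
lexicographically smallest among angle sequences of all jet frames at `x`
along `V`. -/
theorem exists_minimal_jet_frame {d : ℕ} {ι : Type*} [Fintype ι]
    (u : ι → EuclideanSpace ℝ (Fin d)) (c : ι → ℝ)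
    (V : Set (EuclideanSpace ℝ (Fin d)))
    (hV : V = ⋂ j : ι, {y : EuclideanSpace ℝ (Fin d) | ⟪u j, y⟫ ≤ c j})
    (x : EuclideanSpace ℝ (Fin d)) (hx : x ∈ V)
    (ν : EuclideanSpace ℝ (Fin d)) (hν : ∀ y ∈ V, ⟪ν, y⟫ ≤ ⟪ν, x⟫) :
    ∃ (r : ℕ) (ζ : Fin r → EuclideanSpace ℝ (Fin d)), IsJetFrame V x ζ ∧
      ∀ (r' : ℕ) (ζ' : Fin r' → EuclideanSpace ℝ (Fin d)), IsJetFrame V x ζ' →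
        LexLE (pad fun i => -⟪ν, ζ i⟫) (pad fun i => -⟪ν, ζ' i⟫) := by
  have hVm : ∀ z, z ∈ V ↔ ∀ j, ⟪u j, z⟫ ≤ c j := fun z => by simp [hV]
  have hVc : Convex ℝ V := by
    rw [hV]
    exact convex_iInter fun j => convex_halfSpace_le (innerₛₗ ℝ (u j)).isLinear (c j)
  obtain ⟨y, hy⟩ := Set.Nonempty.intrinsicInterior hVc ⟨x, hx⟩
  obtain ⟨hyL, hy⟩ := (mem_intrinsicInterior_polyhedron_iff hV hx y).1 hy
  set A : Set ι := {j | (∃ v ∈ vectorSpan ℝ V, ⟪u j, v⟫ ≠ 0) ∧ ⟪u j, x⟫ = c j}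
  have hp : ∀ j ∈ A, ⟪u j, y - x⟫ < 0 := fun j hj => by
    rw [inner_sub_right, hj.2]
    exact sub_neg.2 (hy j hj.1)
  have hcone : ∀ v ∈ vectorSpan ℝ V, (∀ j ∈ A, ⟪u j, v⟫ ≤ 0) → ⟪ν, v⟫ ≤ 0 := by
    intro v hv hle
    have hlim : Tendsto (fun ε : ℝ => ε • v) (𝓝[>] 0) (𝓝 0) := by
      simpa [jetPoly] using tendsto_smul_jetPoly [v]
    have hev : ∀ᶠ ε in 𝓝[>] (0 : ℝ), ∀ j, ⟪u j, x + ε • v⟫ ≤ c j := by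
      refine eventually_all.2 fun j => ?_
      rcases ((hVm x).1 hx j).lt_or_eq with h | h
      · exact (eventually_add_smul_inner_lt h hlim).mono fun _ h => h.le
      · filter_upwards [self_mem_nhdsWithin] with ε hε
        rw [inner_add_right, h, inner_smul_right]
        have hjv : ⟪u j, v⟫ ≤ 0 := by
          by_cases hj : ⟪u j, v⟫ = 0
          · exact hj.le
          · exact hle j ⟨⟨v, hv, hj⟩, h⟩
        have := mul_nonpos_of_nonneg_of_nonpos (le_of_lt hε) hjv
        linarith
    obtain ⟨ε, hε, hpos⟩ := (hev.and self_mem_nhdsWithin).exists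
    have h := hν _ ((hVm _).2 hε)
    rw [inner_add_right, inner_smul_right] at h
    exact nonpos_of_mul_nonpos_right (by linarith) hpos
  obtain ⟨l, hl, hmin⟩ := exists_minimal_jetList u ν A (vectorSpan ℝ V) hcone ⟨y - x, hyL, hp⟩
  refine ⟨l.length, l.get, ?_, fun r' ζ' hζ' => ?_⟩
  · rw [isJetFrame_iff_isJetList hV hx, List.ofFn_get]
    exact hl
  · rw [pad_eq_listAngles, pad_eq_listAngles, List.ofFn_get]
    exact hmin _ ((isJetFrame_iff_isJetList hV hx ζ').1 hζ')
end

section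
/- Let n ≥ 2 and let P ⊆ EuclideanSpace ℝ (Fin n) be a convex polytope with nonempty interior, i.e., the convex hull of a finite set of points, with interior P ≠ ∅, and let S = frontier P. Then for all a, b ∈ S the intrinsic distance μ(a,b) is finite and is attained: there exists a path in S from a to b whose length equals μ(a,b). (The existence of length-minimizing paths asserted in Section 1 of the paper.) -/
open scoped RealInnerProductSpace ENNReal

/-- A path in `S` from `a` to `b`: a continuous map `γ` on `[0,1]` with
`γ 0 = a`, `γ 1 = b`, and image contained in `S`. -/
def IsPathIn {E : Type*} [NormedAddCommGroup E] [InnerProductSpace ℝ E]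
    (S : Set E) (a b : E) (γ : ℝ → E) : Prop :=
  ContinuousOn γ (Set.Icc 0 1) ∧ γ 0 = a ∧ γ 1 = b ∧ Set.MapsTo γ (Set.Icc 0 1) S

/-- The length of a path: its total variation on `[0,1]`. -/
noncomputable def pathLength {E : Type*} [NormedAddCommGroup E] [InnerProductSpace ℝ E]
    (γ : ℝ → E) : ℝ≥0∞ :=
  eVariationOn γ (Set.Icc 0 1)

/-- The intrinsic distance in `S`: the infimum of lengths of paths in `S`
from `a` to `b`. -/
noncomputable def intrinsicDist {E : Type*} [NormedAddCommGroup E] [InnerProductSpace ℝ E]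
    (S : Set E) (a b : E) : ℝ≥0∞ :=
  ⨅ (γ : ℝ → E) (_ : IsPathIn S a b γ), pathLength γ

/-- A shortest path in `S` from `a` to `b`: a path in `S` from `a` to `b` whose
length equals the intrinsic distance `μ(a,b)`. -/
def IsShortestPath {E : Type*} [NormedAddCommGroup E] [InnerProductSpace ℝ E]
    (S : Set E) (a b : E) (γ : ℝ → E) : Prop :=
  IsPathIn S a b γ ∧ pathLength γ = intrinsicDist S a b

/-- A face of `P`: a nonempty convex subset of `P` that is extreme in `P`. -/
def IsFace {E : Type*} [NormedAddCommGroup E] [InnerProductSpace ℝ E]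
    (P F : Set E) : Prop :=
  F.Nonempty ∧ Convex ℝ F ∧ IsExtreme ℝ P F

/-- The dimension of a face: the dimension of its affine span. -/
noncomputable def faceDim {E : Type*} [NormedAddCommGroup E] [InnerProductSpace ℝ E]
    (F : Set E) : ℕ :=
  Module.finrank ℝ (affineSpan ℝ F).direction

open Set Filter Topology NNReal

section Reparametrization

/-- The variation of a continuous function of bounded variation depends continuously on the
endpoint. -/
theorem BoundedVariationOn.continuousOn_variationOnFromTo {α E : Type*} [LinearOrder α]
    [TopologicalSpace α] [OrderTopology α] [PseudoMetricSpace E] {f : α → E} {s : Set α}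
    (hf : BoundedVariationOn f s) (hc : ContinuousOn f s) {a : α} (ha : a ∈ s) :
    ContinuousOn (variationOnFromTo f s a) s := by
  intro x hx
  have hl : Tendsto (fun y => (eVariationOn f (s ∩ Icc y x)).toReal) (𝓝[s] x) (𝓝 0) :=
    (ENNReal.tendsto_toReal ENNReal.zero_ne_top).comp
      (hf.tendsto_eVariationOn_Icc_zero_left ((hc x hx).mono inter_subset_left))
  have hr : Tendsto (fun y => (eVariationOn f (s ∩ Icc x y)).toReal) (𝓝[s] x) (𝓝 0) :=
    (ENNReal.tendsto_toReal ENNReal.zero_ne_top).comp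
      (hf.tendsto_eVariationOn_Icc_zero_right x ((hc x hx).mono inter_subset_left))
  refine tendsto_iff_dist_tendsto_zero.2 <|
    squeeze_zero' (Eventually.of_forall fun _ => dist_nonneg) ?_ (by simpa using hl.add hr)
  filter_upwards [self_mem_nhdsWithin] with y hy
  rw [Real.dist_eq, variationOnFromTo.sub_right hf.locallyBoundedVariationOn ha hy hx]
  rcases le_total x y with h | h
  · rw [variationOnFromTo.eq_of_le _ _ h, abs_of_nonneg ENNReal.toReal_nonneg]
    exact le_add_of_nonneg_left ENNReal.toReal_nonneg
  · rw [variationOnFromTo.eq_of_ge _ _ h, abs_neg, abs_of_nonneg ENNReal.toReal_nonneg]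
    exact le_add_of_nonneg_right ENNReal.toReal_nonneg

theorem LocallyBoundedVariationOn.dist_le_variationOnFromTo {α E : Type*} [LinearOrder α]
    [PseudoMetricSpace E] {f : α → E} {s : Set α} (hf : LocallyBoundedVariationOn f s) {a x y : α}
    (ha : a ∈ s) (hx : x ∈ s) (hy : y ∈ s) :
    dist (f x) (f y) ≤ dist (variationOnFromTo f s a x) (variationOnFromTo f s a y) := by
  wlog h : x ≤ y generalizing x y
  · rw [dist_comm (f x), dist_comm (variationOnFromTo f s a x)]
    exact this hy hx (le_of_not_ge h)
  rw [dist_comm (variationOnFromTo f s a x), Real.dist_eq, variationOnFromTo.sub_right hf ha hy hx,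
    variationOnFromTo.eq_of_le _ _ h, abs_of_nonneg ENNReal.toReal_nonneg]
  exact BoundedVariationOn.dist_le (hf x y hx hy) ⟨hx, le_rfl, h⟩ ⟨hy, h, le_rfl⟩

variable {E : Type*} [NormedAddCommGroup E] [InnerProductSpace ℝ E] {S : Set E} {a b : E}

theorem LipschitzOnWith.pathLength_le {γ : ℝ → E} {C : ℝ≥0}
    (h : LipschitzOnWith C γ (Icc 0 1)) : pathLength γ ≤ C := by
  simpa using! h.comp_eVariationOn_le (mapsTo_id (Icc (0 : ℝ) 1))

/-- Reparametrization of a rectifiable path proportionally to arc length, extended to all of `ℝ`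
by constants. -/
theorem IsPathIn.exists_lipschitzWith {γ : ℝ → E} (hγ : IsPathIn S a b γ) {C : ℝ≥0}
    (hC : pathLength γ = C) :
    ∃ δ : ℝ → E, LipschitzWith C δ ∧ δ 0 = a ∧ δ 1 = b ∧ ∀ t, δ t ∈ S := by
  obtain ⟨hcont, h0, h1, hS⟩ := hγ
  have hbv : BoundedVariationOn γ (Icc 0 1) := by
    rw [BoundedVariationOn, ← pathLength, hC]
    exact ENNReal.coe_ne_top
  have hloc := hbv.locallyBoundedVariationOn
  have m0 : (0 : ℝ) ∈ Icc (0 : ℝ) 1 := by simp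
  have m1 : (1 : ℝ) ∈ Icc (0 : ℝ) 1 := by simp
  set V := variationOnFromTo γ (Icc 0 1) 0 with hV
  have hV0 : V 0 = 0 := variationOnFromTo.self _ _ _
  have hV1 : V 1 = C := by
    rw [hV, variationOnFromTo.eq_of_le _ _ zero_le_one, inter_self, ← pathLength, hC,
      ENNReal.coe_toReal]
  have hex : ∀ t : ℝ, ∃ s ∈ Icc (0 : ℝ) 1, V s = C * (projIcc (0 : ℝ) 1 zero_le_one t : ℝ) := by
    intro t
    obtain ⟨p0, p1⟩ := (projIcc (0 : ℝ) 1 zero_le_one t).2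
    refine intermediate_value_Icc zero_le_one (hbv.continuousOn_variationOnFromTo hcont m0) ?_
    rw [← hV, hV0, hV1]
    exact ⟨mul_nonneg C.2 p0, mul_le_of_le_one_right C.2 p1⟩
  choose σ hσ hVσ using hex
  have eq_of_V_eq : ∀ {x y}, x ∈ Icc (0 : ℝ) 1 → y ∈ Icc (0 : ℝ) 1 → V x = V y → γ x = γ y := by
    intro x y hx hy h
    refine dist_le_zero.1 ((hloc.dist_le_variationOnFromTo m0 hx hy).trans ?_)
    rw [← hV, h, dist_self]
  refine ⟨γ ∘ σ, LipschitzWith.of_dist_le_mul fun x y => ?_, ?_, ?_, fun t => hS (hσ t)⟩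
  · refine (hloc.dist_le_variationOnFromTo m0 (hσ x) (hσ y)).trans ?_
    rw [← hV, hVσ, hVσ, Real.dist_eq, ← mul_sub, abs_mul, NNReal.abs_eq]
    gcongr
    exact abs_projIcc_sub_projIcc zero_le_one
  · exact (eq_of_V_eq (hσ 0) m0 (by simp [hVσ, hV0])).trans h0
  · exact (eq_of_V_eq (hσ 1) m1 (by simp [hVσ, hV1])).trans h1

/-- In a compact set, two points joined by a rectifiable path are joined by a shortest one. -/
theorem IsCompact.exists_isShortestPath (hS : IsCompact S) (h : intrinsicDist S a b < ⊤) :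
    ∃ γ, IsShortestPath S a b γ := by
  obtain ⟨γ₀, hγ₀, hlt⟩ : ∃ γ, IsPathIn S a b γ ∧ pathLength γ < ⊤ := by
    simpa [intrinsicDist, iInf_lt_iff] using h
  lift pathLength γ₀ to ℝ≥0 using hlt.ne with L hL
  set K : Set (ℝ → E) := {f | LipschitzWith L f ∧ f 0 = a ∧ f 1 = b ∧ ∀ t, f t ∈ S} with hK
  have hKpath : ∀ f ∈ K, IsPathIn S a b f := fun f hf =>
    ⟨hf.1.continuous.continuousOn, hf.2.1, hf.2.2.1, fun t _ => hf.2.2.2 t⟩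
  have hKc : IsCompact K := by
    refine (isCompact_univ_pi fun _ : ℝ => hS).of_isClosed_subset ?_ fun f hf t _ => hf.2.2.2 t
    simp only [hK, lipschitzWith_iff_dist_le_mul, ofPred_and, ofPred_forall]
    refine .inter ?_ (.inter ?_ (.inter ?_ ?_))
    · exact isClosed_iInter fun x => isClosed_iInter fun y =>
        isClosed_le ((continuous_apply x).dist (continuous_apply y)) continuous_const
    · exact isClosed_eq (continuous_apply 0) continuous_const
    · exact isClosed_eq (continuous_apply 1) continuous_const
    · exact isClosed_iInter fun t => hS.isClosed.preimage (continuous_apply t)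
  have hlsc : LowerSemicontinuousOn (pathLength : (ℝ → E) → ℝ≥0∞) K := fun f _ v hv =>
    eVariationOn.lowerSemicontinuous_aux (F := fun g : ℝ → E => g)
      (fun x _ => ((continuous_apply x).tendsto f).mono_left nhdsWithin_le_nhds) hv
  obtain ⟨γ, hγ, hmin⟩ := hlsc.exists_isMinOn (hγ₀.exists_lipschitzWith hL.symm) hKc
  refine ⟨γ, hKpath γ hγ, le_antisymm (le_iInf₂ fun δ hδ => ?_) (iInf₂_le γ (hKpath γ hγ))⟩
  rcases le_total (L : ℝ≥0∞) (pathLength δ) with hle | hle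
  · exact (hγ.1.lipschitzOnWith.pathLength_le).trans hle
  · lift pathLength δ to ℝ≥0 using ne_top_of_le_ne_top ENNReal.coe_ne_top hle with M hM
    obtain ⟨η, hη, hη'⟩ := hδ.exists_lipschitzWith hM.symm
    exact (hmin ⟨hη.weaken (ENNReal.coe_le_coe.1 hle), hη'⟩).trans hη.lipschitzOnWith.pathLength_le

end Reparametrization

section RadialProjection

theorem LipschitzWith.exists_lipschitzOnWith_inv_smul {E : Type*} [NormedAddCommGroup E]
    [NormedSpace ℝ E] {f : E → ℝ} {K : ℝ≥0} (hf : LipschitzWith K f) {t : Set E}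
    (ht : IsCompact t) (hpos : ∀ x ∈ t, 0 < f x) :
    ∃ C, LipschitzOnWith C (fun x => (f x)⁻¹ • x) t := by
  obtain ⟨R, hR⟩ := ht.exists_bound_of_continuousOn continuousOn_id
  obtain ⟨M, hM⟩ := ht.exists_bound_of_continuousOn
    (hf.continuous.continuousOn.inv₀ fun x hx => (hpos x hx).ne')
  refine ⟨Real.toNNReal (M + M * K * M * R), LipschitzOnWith.of_dist_le' fun x hx y hy => ?_⟩
  have hMx : |(f x)⁻¹| ≤ M := hM x hx
  have hMy : |(f y)⁻¹| ≤ M := hM y hy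
  have hRy : ‖y‖ ≤ R := hR y hy
  have hM0 : 0 ≤ M := (abs_nonneg _).trans hMx
  have hfxy : |f y - f x| ≤ K * ‖x - y‖ := by
    simpa [Real.dist_eq, dist_eq_norm, abs_sub_comm] using hf.dist_le_mul x y
  have hinv : (f x)⁻¹ - (f y)⁻¹ = (f x)⁻¹ * (f y - f x) * (f y)⁻¹ := by
    have := (hpos x hx).ne'
    have := (hpos y hy).ne'
    field_simp
  rw [dist_eq_norm, dist_eq_norm]
  calc ‖(f x)⁻¹ • x - (f y)⁻¹ • y‖
      = ‖(f x)⁻¹ • (x - y) + ((f x)⁻¹ - (f y)⁻¹) • y‖ := by congr 1; module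
    _ ≤ |(f x)⁻¹| * ‖x - y‖ + |(f x)⁻¹| * |f y - f x| * |(f y)⁻¹| * ‖y‖ := by
        refine (norm_add_le _ _).trans_eq ?_
        rw [norm_smul, norm_smul, hinv, Real.norm_eq_abs, Real.norm_eq_abs, abs_mul, abs_mul]
    _ ≤ M * ‖x - y‖ + M * (K * ‖x - y‖) * M * R := by gcongr
    _ = (M + M * K * M * R) * ‖x - y‖ := by ring

variable {E : Type*} [NormedAddCommGroup E] [InnerProductSpace ℝ E] {a b : E}

/-- The radial projection of a segment avoiding an interior point is a rectifiable path. -/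
theorem Convex.intrinsicDist_frontier_lt_top_of_notMem_segment {P : Set E} (hP : Convex ℝ P)
    (hb : Bornology.IsBounded P) {c : E} (hc : c ∈ interior P) (ha : a ∈ frontier P)
    (hb' : b ∈ frontier P) (hcab : c ∉ segment ℝ a b) :
    intrinsicDist (frontier P) a b < ⊤ := by
  set Q : Set E := (c + ·) ⁻¹' P with hQ
  have hQc : Convex ℝ Q := hP.translate_preimage_right c
  have hQ0 : Q ∈ 𝓝 (0 : E) := by
    refine (continuous_const_add c).continuousAt.preimage_mem_nhds ?_
    simpa [mem_interior_iff_mem_nhds] using hc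
  have hQb : Bornology.IsBounded Q := by
    have : Q = (-c + ·) '' P := by
      rw [hQ, image_add_left, neg_neg]
    rw [this]
    exact (IsometryEquiv.addLeft (-c)).isometry.lipschitz.isBounded_image hb
  have hQf : ∀ x, gauge Q x = 1 ↔ c + x ∈ frontier P := fun x => by
    rw [gauge_eq_one_iff_mem_frontier hQc hQ0, hQ,
      show (c + ·) ⁻¹' P = Homeomorph.addLeft c ⁻¹' P from rfl, ← Homeomorph.preimage_frontier]
    rfl
  have hpos : ∀ x, x ≠ 0 → 0 < gauge Q x := fun x hx =>
    (gauge_pos (absorbent_nhds_zero hQ0) ((NormedSpace.isVonNBounded_iff ℝ).2 hQb)).2 hx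
  obtain ⟨K, hK⟩ := hQc.lipschitz_gauge hQ0
  set l : ℝ → E := fun t => AffineMap.lineMap a b t - c with hl
  have hlc : Continuous l := by fun_prop
  have hl0 : ∀ t ∈ Icc (0 : ℝ) 1, l t ≠ 0 := fun t ht h => hcab <| by
    rw [segment_eq_image_lineMap]
    exact ⟨t, ht, sub_eq_zero.1 h⟩
  obtain ⟨C, hC⟩ := hK.exists_lipschitzOnWith_inv_smul (t := l '' Icc 0 1)
    (isCompact_Icc.image hlc) (by rintro _ ⟨t, ht, rfl⟩; exact hpos _ (hl0 t ht))
  have hll : LipschitzWith (nndist a b) l :=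
    LipschitzWith.of_dist_le_mul fun x y => by
      simp [hl, dist_lineMap_lineMap, mul_comm]
  have hγ : LipschitzOnWith (C * nndist a b) (fun t => c + (gauge Q (l t))⁻¹ • l t) (Icc 0 1) := by
    have := hC.comp (hll.lipschitzOnWith (s := Icc 0 1)) (mapsTo_image _ _)
    exact fun x hx y hy => by simpa using this hx hy
  refine (iInf₂_le _ ⟨hγ.continuousOn, ?_, ?_, fun t ht => ?_⟩).trans_lt
    (hγ.pathLength_le.trans_lt ENNReal.coe_lt_top)
  · have : gauge Q (a - c) = 1 := (hQf _).2 (by simpa using ha)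
    simp [hl, this]
  · have : gauge Q (b - c) = 1 := (hQf _).2 (by simpa using hb')
    simp [hl, this]
  · rw [← hQf, gauge_smul_of_nonneg (inv_nonneg.2 (gauge_nonneg _)), smul_eq_mul,
      inv_mul_cancel₀ (hpos _ (hl0 t ht)).ne']

theorem IsOpen.exists_notMem_segment (hE : 1 < Module.finrank ℝ E) {U : Set E} (hU : IsOpen U)
    (hne : U.Nonempty) (a b : E) : ∃ c ∈ U, c ∉ segment ℝ a b := by
  by_contra! h
  have htop : affineSpan ℝ {a, b} = ⊤ := by
    rw [eq_top_iff, ← hU.affineSpan_eq_top hne]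
    refine affineSpan_le.2 fun x hx => ?_
    exact convexHull_subset_affineSpan (𝕜 := ℝ) _
      (segment_subset_convexHull (by simp) (by simp) (h x hx))
  have := (collinear_pair ℝ a b).finrank_le_one
  rw [← direction_affineSpan, htop, AffineSubspace.direction_top, finrank_top ℝ E] at this
  omega

end RadialProjection

/-- Existence of length-minimizing paths (Section 1): on the boundary
`S = frontier P` of a convex polytope `P ⊆ ℝⁿ` (`n ≥ 2`) with nonempty interior,
for all `a, b ∈ S` the intrinsic distance is finite and attained by some path. -/
theorem exists_shortest_path_on_boundary {n : ℕ} (hn : 2 ≤ n)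
    (P : Set (EuclideanSpace ℝ (Fin n)))
    (hP : ∃ A : Finset (EuclideanSpace ℝ (Fin n)),
      P = convexHull ℝ (A : Set (EuclideanSpace ℝ (Fin n))))
    (hint : (interior P).Nonempty) :
    ∀ a ∈ frontier P, ∀ b ∈ frontier P,
      intrinsicDist (frontier P) a b < ⊤ ∧
      ∃ γ : ℝ → EuclideanSpace ℝ (Fin n),
        IsPathIn (frontier P) a b γ ∧
        pathLength γ = intrinsicDist (frontier P) a b := by
  obtain ⟨A, rfl⟩ := hP
  intro a ha b hb
  have hcomp : IsCompact (convexHull ℝ (A : Set (EuclideanSpace ℝ (Fin n)))) :=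
    A.finite_toSet.isCompact_convexHull (𝕜 := ℝ)
  obtain ⟨c, hc, hcab⟩ := isOpen_interior.exists_notMem_segment
    (by rwa [finrank_euclideanSpace_fin]) hint a b
  have hfin := (convex_convexHull ℝ _).intrinsicDist_frontier_lt_top_of_notMem_segment
    hcomp.isBounded hc ha hb hcab
  exact ⟨hfin, (hcomp.of_isClosed_subset isClosed_frontier
    hcomp.isClosed.frontier_subset).exists_isShortestPath hfin⟩
end

section
/- Let E be a real inner product space and let γ : [0,1] → E be a continuous path whose length (total variation eVariationOn γ (Set.Icc 0 1)) equals the distance ‖γ(1) − γ(0)‖ between its endpoints. Then the image γ([0,1]) equals the straight segment [γ(0), γ(1)]. (A claim used in the proof of Lemma 2.3 of the paper: the unique shortest path in Euclidean space between two points is the straight segment.) -/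
open Set

/-- If the variation of `f` on `[a, b]` is the distance between the endpoint values, then every
intermediate value lies weakly between them. -/
theorem wbtw_of_eVariationOn_eq_edist {E : Type*} [NormedAddCommGroup E] [NormedSpace ℝ E]
    [StrictConvexSpace ℝ E] {f : ℝ → E} {a b t : ℝ}
    (h : eVariationOn f (Icc a b) = edist (f a) (f b)) (ht : t ∈ Icc a b) :
    Wbtw ℝ (f a) (f t) (f b) := by
  have hadd : eVariationOn f (Icc a t) + eVariationOn f (Icc t b) = eVariationOn f (Icc a b) := by
    simpa using eVariationOn.Icc_add_Icc f (s := univ) ht.1 ht.2 (mem_univ t)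
  have hle : edist (f a) (f t) + edist (f t) (f b) ≤ edist (f a) (f b) := by
    rw [← h, ← hadd]
    exact add_le_add
      (eVariationOn.edist_le f (left_mem_Icc.2 ht.1) (right_mem_Icc.2 ht.1))
      (eVariationOn.edist_le f (left_mem_Icc.2 ht.2) (right_mem_Icc.2 ht.2))
  rw [← dist_add_dist_eq_iff]
  refine le_antisymm ?_ (dist_triangle _ _ _)
  rwa [edist_dist, edist_dist, edist_dist, ← ENNReal.ofReal_add dist_nonneg dist_nonneg,
    ENNReal.ofReal_le_ofReal_iff dist_nonneg] at hle

/-- Points of a segment are determined by their distance to an endpoint. -/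
theorem Wbtw.eq_of_dist_left_eq {E : Type*} [NormedAddCommGroup E] [NormedSpace ℝ E]
    {x y p q : E} (hp : Wbtw ℝ x p y) (hq : Wbtw ℝ x q y) (h : dist x p = dist x q) : p = q := by
  obtain ⟨r, hr, rfl⟩ := hp
  obtain ⟨s, hs, rfl⟩ := hq
  rw [dist_left_lineMap, dist_left_lineMap, Real.norm_of_nonneg hr.1,
    Real.norm_of_nonneg hs.1] at h
  rcases mul_eq_mul_right_iff.1 h with rfl | hxy
  · rfl
  · simp [dist_eq_zero.1 hxy]


/-- A claim used in the proof of Lemma 2.3: if a continuous path `γ : [0,1] → E`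
in a real inner product space has length (total variation on `[0,1]`) equal to
the distance between its endpoints, then its image is the straight segment
between its endpoints. -/
theorem image_eq_segment_of_length_eq_dist {E : Type*} [NormedAddCommGroup E]
    [InnerProductSpace ℝ E] (γ : ℝ → E)
    (hcont : ContinuousOn γ (Set.Icc 0 1))
    (hlen : eVariationOn γ (Set.Icc 0 1) = ENNReal.ofReal ‖γ 1 - γ 0‖) :
    γ '' Set.Icc 0 1 = segment ℝ (γ 0) (γ 1) := by
  have hbtw : ∀ t ∈ Icc (0 : ℝ) 1, Wbtw ℝ (γ 0) (γ t) (γ 1) := fun t ht ↦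
    wbtw_of_eVariationOn_eq_edist
      (by rw [hlen, edist_dist, dist_comm, dist_eq_norm]) ht
  refine Subset.antisymm ?_ fun p hp ↦ ?_
  · rintro _ ⟨t, ht, rfl⟩
    exact mem_segment_iff_wbtw.2 (hbtw t ht)
  · rw [mem_segment_iff_wbtw] at hp
    have hdist : dist (γ 0) p ∈ Icc (dist (γ 0) (γ 0)) (dist (γ 0) (γ 1)) := by
      rw [dist_self, ← hp.dist_add_dist]
      exact ⟨dist_nonneg, le_add_of_nonneg_right dist_nonneg⟩
    have hdist_cont : ContinuousOn (fun t ↦ dist (γ 0) (γ t)) (Icc 0 1) := by fun_prop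
    obtain ⟨t, ht, htp⟩ :=
      intermediate_value_Icc zero_le_one hdist_cont hdist
    exact ⟨t, ht, (hbtw t ht).eq_of_dist_left_eq hp htp⟩
end

section
/- Fix d ≥ 1, let P ⊆ EuclideanSpace ℝ (Fin (d+1)) be a convex polytope with nonempty interior, let S = frontier P, and let γ be a shortest path in S. If 0 ≤ s < t ≤ 1 and both γ(s) and γ(t) lie in a common proper face F of P, then γ([s,t]) equals the straight segment [γ(s), γ(t)]. (The key claim in the proof of Lemma 2.3 of the paper.) -/
open scoped RealInnerProductSpace ENNReal

open Topology

/-- A proper face of a convex set is contained in the frontier. -/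
theorem IsFace.subset_frontier {E : Type*} [NormedAddCommGroup E] [InnerProductSpace ℝ E]
    {P F : Set E} (hF : IsFace P F) (hne : F ≠ P) : F ⊆ frontier P := by
  obtain ⟨-, -, hext⟩ := hF
  intro x hx
  refine ⟨subset_closure (hext.subset hx), fun hint => hne (hext.subset.antisymm fun y hy => ?_)⟩
  have hcont : ContinuousAt (fun ε : ℝ => x + ε • (x - y)) 0 := by fun_prop
  have hev : ∀ᶠ ε : ℝ in 𝓝 0, x + ε • (x - y) ∈ P :=
    hcont.eventually_mem (by simpa using mem_interior_iff_mem_nhds.1 hint)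
  obtain ⟨ε, hε, hε₀⟩ :=
    ((hev.filter_mono nhdsWithin_le_nhds).and (self_mem_nhdsWithin (s := Set.Ioi (0 : ℝ)))).exists
  have hε₀ : 0 < ε := hε₀
  refine hext.left_mem_of_mem_openSegment hy hε hx
    ⟨ε / (1 + ε), 1 / (1 + ε), by positivity, by positivity, by field_simp; ring, ?_⟩
  rw [← sub_eq_zero]
  match_scalars <;> field_simp <;> ring

/-- Two points of the frontier of a compact convex body, radially projected from an interior point
off the line joining them, are joined by a Lipschitz curve in the frontier. -/
theorem exists_isPathIn_frontier_pathLength_ne_top {E : Type*} [NormedAddCommGroup E]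
    [InnerProductSpace ℝ E] (hdim : 1 < Module.finrank ℝ E) {P : Set E}
    (hconv : Convex ℝ P) (hcomp : IsCompact P) (hint : (interior P).Nonempty) {a b : E}
    (ha : a ∈ frontier P) (hb : b ∈ frontier P) :
    ∃ σ : ℝ → E, IsPathIn (frontier P) a b σ ∧ pathLength σ ≠ ⊤ := by
  obtain ⟨o, ho, hol⟩ : ∃ o ∈ interior P, o ∉ line[ℝ, a, b] := by
    by_contra! h
    have htop : line[ℝ, a, b] = ⊤ := top_le_iff.1
      ((isOpen_interior.affineSpan_eq_top hint) ▸ affineSpan_le.2 h)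
    have h₁ : Module.finrank ℝ (vectorSpan ℝ {a, b}) ≤ 1 :=
      collinear_iff_finrank_le_one.1 (collinear_pair ℝ a b)
    rw [← direction_affineSpan, htop, AffineSubspace.direction_top, finrank_top] at h₁
    omega
  set K : Set E := (fun x => o + x) ⁻¹' P with hK
  have hKconv : Convex ℝ K := hconv.translate_preimage_right o
  have hK₀ : K ∈ 𝓝 (0 : E) :=
    (show ContinuousAt (fun x => o + x) 0 by fun_prop).preimage_mem_nhds
      (by simpa using mem_interior_iff_mem_nhds.1 ho)
  have hKfr : ∀ x, o + x ∈ frontier P ↔ gauge K x = 1 := fun x => by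
    rw [gauge_eq_one_iff_mem_frontier hKconv hK₀]
    exact Set.ext_iff.1 ((Homeomorph.addLeft o).preimage_frontier P) x
  have hKb : Bornology.IsVonNBounded ℝ K := by
    rw [NormedSpace.isVonNBounded_iff]
    have : IsCompact K := (Homeomorph.addLeft o).isCompact_preimage.2 hcomp
    exact this.isBounded
  obtain ⟨C, hC⟩ := hKconv.lipschitz_gauge hK₀
  set x : ℝ → E := fun u => AffineMap.lineMap a b u - o with hx
  have hxcont : Continuous x := by
    simp only [hx, AffineMap.lineMap_apply_module]; fun_prop
  have hx₀ : ∀ u, x u ≠ 0 := fun u h => hol <| by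
    rw [← sub_eq_zero.1 h]; exact AffineMap.lineMap_mem_affineSpan_pair u a b
  have hg : ∀ u, 0 < gauge K (x u) := fun u =>
    (gauge_pos (absorbent_nhds_zero hK₀) hKb).2 (hx₀ u)
  have hxd : ∀ u v, ‖x u - x v‖ = dist u v * dist a b := fun u v => by
    rw [← dist_lineMap_lineMap, dist_eq_norm]; simp [hx]
  have hgd : ∀ u v, |gauge K (x u) - gauge K (x v)| ≤ C * (dist u v * dist a b) := fun u v => by
    have := hC.dist_le_mul (x u) (x v)
    rwa [dist_eq_norm (x u), hxd] at this
  have hgcont : Continuous fun u => (gauge K (x u))⁻¹ :=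
    ((continuous_gauge hKconv hK₀).comp hxcont).inv₀ fun u => (hg u).ne'
  obtain ⟨M, hM⟩ := (isCompact_Icc (a := (0 : ℝ)) (b := 1)).exists_bound_of_continuousOn
    hgcont.continuousOn
  obtain ⟨N, hN⟩ := (isCompact_Icc (a := (0 : ℝ)) (b := 1)).exists_bound_of_continuousOn
    hxcont.continuousOn
  have hM₀ : 0 ≤ M := (norm_nonneg _).trans (hM 0 (by simp))
  have hN₀ : 0 ≤ N := (norm_nonneg _).trans (hN 0 (by simp))
  set σ : ℝ → E := fun u => o + (gauge K (x u))⁻¹ • x u with hσ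
  have hσl : LipschitzOnWith (Real.toNNReal (M * dist a b + M * M * (C * dist a b) * N)) σ
      (Set.Icc 0 1) := by
    refine LipschitzOnWith.of_dist_le_mul fun u hu v hv => ?_
    rw [Real.coe_toNNReal _ (by positivity), dist_eq_norm]
    have hMu := hM u hu
    have hMv := hM v hv
    have hinv : ‖(gauge K (x u))⁻¹ - (gauge K (x v))⁻¹‖ ≤ M * M * (C * (dist u v * dist a b)) := by
      have h₁ : (gauge K (x u))⁻¹ - (gauge K (x v))⁻¹ =
          (gauge K (x u))⁻¹ * (gauge K (x v))⁻¹ * (gauge K (x v) - gauge K (x u)) := by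
        have := (hg u).ne'
        have := (hg v).ne'
        field_simp
      rw [h₁, norm_mul, norm_mul, Real.norm_eq_abs (gauge K (x v) - _), abs_sub_comm]
      have := hgd u v
      gcongr
    calc ‖σ u - σ v‖
        = ‖(gauge K (x u))⁻¹ • (x u - x v) +
            ((gauge K (x u))⁻¹ - (gauge K (x v))⁻¹) • x v‖ := by
          congr 1; simp only [hσ]; module
      _ ≤ ‖(gauge K (x u))⁻¹‖ * ‖x u - x v‖ +
            ‖(gauge K (x u))⁻¹ - (gauge K (x v))⁻¹‖ * ‖x v‖ := by
          grw [norm_add_le, norm_smul, norm_smul]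
      _ ≤ M * (dist u v * dist a b) + M * M * (C * (dist u v * dist a b)) * N := by
          rw [hxd]; have := hN v hv; gcongr
      _ = _ := by ring
  refine ⟨σ, ⟨hσl.continuousOn, ?_, ?_, fun u _ => ?_⟩, ?_⟩
  · have : gauge K (a - o) = 1 := (hKfr _).1 (by simpa using ha)
    simp [hσ, hx, this]
  · have : gauge K (b - o) = 1 := (hKfr _).1 (by simpa using hb)
    simp [hσ, hx, this]
  · rw [hσ, hKfr, gauge_smul_of_nonneg (inv_nonneg.2 (hg u).le), smul_eq_mul,
      inv_mul_cancel₀ (hg u).ne']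
  · have : BoundedVariationOn σ (Set.Icc 0 1) := by
      simpa using hσl.locallyBoundedVariationOn 0 1 (by simp) (by simp)
    exact this

/-- The constant-speed parametrization of a segment has variation at most the distance between
the endpoints. -/
theorem eVariationOn_lineMap_le {E : Type*} [NormedAddCommGroup E] [InnerProductSpace ℝ E]
    (p q : E) {s t : ℝ} (hst : s < t) :
    eVariationOn (fun u => AffineMap.lineMap p q ((u - s) / (t - s)) : ℝ → E) (Set.Icc s t)
      ≤ edist p q := by
  have hl : LipschitzWith (nndist p q) (AffineMap.lineMap p q : ℝ → E) :=
    LipschitzWith.of_dist_le_mul fun u v => by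
      rw [dist_lineMap_lineMap, mul_comm, coe_nndist]
  have hmono : MonotoneOn (fun u : ℝ => (u - s) / (t - s)) (Set.Icc s t) := fun u _ v _ huv => by
    have : 0 < t - s := sub_pos.2 hst
    dsimp only
    gcongr
  have hvar : eVariationOn (fun u : ℝ => (u - s) / (t - s)) (Set.Icc s t) = 1 := by
    have := hmono.eVariationOn_eq (Set.left_mem_Icc.2 hst.le) (Set.right_mem_Icc.2 hst.le)
    simpa [div_self (sub_pos.2 hst).ne'] using this
  calc eVariationOn ((AffineMap.lineMap p q : ℝ → E) ∘ fun u : ℝ => (u - s) / (t - s))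
        (Set.Icc s t)
      ≤ nndist p q * eVariationOn (fun u : ℝ => (u - s) / (t - s)) (Set.Icc s t) :=
        hl.lipschitzOnWith.comp_eVariationOn_le (Set.mapsTo_univ _ _)
    _ ≤ nndist p q * 1 := by rw [hvar]
    _ = edist p q := by rw [mul_one, edist_nndist]

/-- A shortest path of finite length has minimal variation between two points whose segment lies
in the set. -/
theorem IsShortestPath.eVariationOn_le_edist {E : Type*} [NormedAddCommGroup E]
    [InnerProductSpace ℝ E] {S : Set E} {a b : E} {γ : ℝ → E} (hγ : IsShortestPath S a b γ)
    (hfin : pathLength γ ≠ ⊤) {s t : ℝ} (hs : 0 ≤ s) (hst : s < t) (ht : t ≤ 1)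
    (hseg : segment ℝ (γ s) (γ t) ⊆ S) :
    eVariationOn γ (Set.Icc s t) ≤ edist (γ s) (γ t) := by
  classical
  obtain ⟨⟨hcont, h0, h1, hmaps⟩, hlen⟩ := hγ
  have hts : 0 < t - s := sub_pos.2 hst
  set L : ℝ → E := fun u => AffineMap.lineMap (γ s) (γ t) ((u - s) / (t - s)) with hL
  set η : ℝ → E := fun u => if u ∈ Set.Icc s t then L u else γ u with hη
  have hLs : L s = γ s := by simp [hL]
  have hLt : L t = γ t := by simp [hL, div_self hts.ne']
  have e₁ : Set.EqOn η γ (Set.Icc 0 s) := fun u hu => by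
    by_cases h : u ∈ Set.Icc s t
    · obtain rfl : u = s := le_antisymm hu.2 h.1
      simp only [hη, if_pos h, hLs]
    · simp only [hη, if_neg h]
  have e₂ : Set.EqOn η L (Set.Icc s t) := fun u hu => by simp only [hη, if_pos hu]
  have e₃ : Set.EqOn η γ (Set.Icc t 1) := fun u hu => by
    by_cases h : u ∈ Set.Icc s t
    · obtain rfl : u = t := le_antisymm h.2 hu.1
      simp only [hη, if_pos h, hLt]
    · simp only [hη, if_neg h]
  have hLc : Continuous L := by
    simp only [hL, AffineMap.lineMap_apply_module]; fun_prop
  have hηc : ContinuousOn η (Set.Icc 0 1) := by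
    rw [← Set.Icc_union_Icc_eq_Icc (hs.trans hst.le) ht, ← Set.Icc_union_Icc_eq_Icc hs hst.le]
    refine ContinuousOn.union_of_isClosed (ContinuousOn.union_of_isClosed ?_ ?_ isClosed_Icc
      isClosed_Icc) ?_ (isClosed_Icc.union isClosed_Icc) isClosed_Icc
    · exact (hcont.mono (Set.Icc_subset_Icc_right (hst.le.trans ht))).congr e₁
    · exact hLc.continuousOn.congr e₂
    · exact (hcont.mono (Set.Icc_subset_Icc_left (hs.trans hst.le))).congr e₃
  have hηp : IsPathIn S a b η := by
    refine ⟨hηc, ?_, ?_, fun u hu => ?_⟩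
    · rw [e₁ ⟨le_rfl, hs⟩, h0]
    · rw [e₃ ⟨ht, le_rfl⟩, h1]
    · by_cases h : u ∈ Set.Icc s t
      · rw [e₂ h]
        refine hseg ?_
        rw [segment_eq_image_lineMap]
        exact ⟨_, ⟨div_nonneg (sub_nonneg.2 h.1) hts.le,
          (div_le_one hts).2 (sub_le_sub_right h.2 s)⟩, rfl⟩
      · simp only [hη, if_neg h]; exact hmaps hu
  have hsplit : ∀ f : ℝ → E, pathLength f = eVariationOn f (Set.Icc 0 s) +
      eVariationOn f (Set.Icc s t) + eVariationOn f (Set.Icc t 1) := fun f => by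
    have h₁ := eVariationOn.Icc_add_Icc f (s := Set.univ) hs hst.le (Set.mem_univ s)
    have h₂ := eVariationOn.Icc_add_Icc f (s := Set.univ) (hs.trans hst.le) ht (Set.mem_univ t)
    simp only [Set.univ_inter] at h₁ h₂
    rw [h₁, h₂, pathLength]
  have hle : pathLength γ ≤ pathLength η := hlen ▸ iInf₂_le η hηp
  rw [hsplit γ] at hfin
  simp only [ENNReal.add_ne_top] at hfin
  rw [hsplit γ, hsplit η, eVariationOn.eq_of_eqOn e₁, eVariationOn.eq_of_eqOn e₂,
    eVariationOn.eq_of_eqOn e₃, ENNReal.add_le_add_iff_right hfin.2,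
    ENNReal.add_le_add_iff_left hfin.1.1] at hle
  exact hle.trans (eVariationOn_lineMap_le _ _ hst)

/-- A curve whose variation does not exceed the distance between its endpoints traverses the
segment between them. -/
theorem image_Icc_eq_segment_of_eVariationOn_le_edist {E : Type*} [NormedAddCommGroup E]
    [InnerProductSpace ℝ E] {γ : ℝ → E} {s t : ℝ} (hst : s ≤ t)
    (hcont : ContinuousOn γ (Set.Icc s t))
    (hvar : eVariationOn γ (Set.Icc s t) ≤ edist (γ s) (γ t)) :
    γ '' Set.Icc s t = segment ℝ (γ s) (γ t) := by
  have hmem : ∀ u ∈ Set.Icc s t, γ u ∈ segment ℝ (γ s) (γ t) := fun u hu => by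
    rw [mem_segment_iff_wbtw, ← dist_add_dist_eq_iff]
    refine le_antisymm ?_ (dist_triangle _ _ _)
    have hsplit := eVariationOn.Icc_add_Icc γ (s := Set.univ) hu.1 hu.2 (Set.mem_univ u)
    simp only [Set.univ_inter] at hsplit
    have : edist (γ s) (γ u) + edist (γ u) (γ t) ≤ edist (γ s) (γ t) := by
      refine le_trans ?_ (hsplit.le.trans hvar)
      gcongr
      · exact eVariationOn.edist_le γ (Set.left_mem_Icc.2 hu.1) (Set.right_mem_Icc.2 hu.1)
      · exact eVariationOn.edist_le γ (Set.left_mem_Icc.2 hu.2) (Set.right_mem_Icc.2 hu.2)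
    rw [edist_dist, edist_dist, edist_dist, ← ENNReal.ofReal_add dist_nonneg dist_nonneg] at this
    exact (ENNReal.ofReal_le_ofReal_iff dist_nonneg).1 this
  refine Set.Subset.antisymm (Set.image_subset_iff.2 hmem) fun p hp => ?_
  have hdist : ∀ c : ℝ, 0 ≤ c →
      dist (γ s) (AffineMap.lineMap (γ s) (γ t) c) = c * dist (γ s) (γ t) := fun c hc => by
    rw [dist_left_lineMap, Real.norm_of_nonneg hc]
  rw [segment_eq_image_lineMap] at hp hmem
  obtain ⟨r, hr, rfl⟩ := hp
  have hivt := intermediate_value_Icc hst (f := fun u => dist (γ s) (γ u)) (by fun_prop)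
  obtain ⟨u, hu, hur⟩ : r * dist (γ s) (γ t) ∈ (fun u => dist (γ s) (γ u)) '' Set.Icc s t :=
    hivt ⟨by simpa using mul_nonneg hr.1 dist_nonneg,
      by simpa using mul_le_of_le_one_left dist_nonneg hr.2⟩
  refine ⟨u, hu, ?_⟩
  obtain ⟨c, hc, hcu⟩ := hmem u hu
  dsimp only at hur
  rw [← hcu, hdist c hc.1] at hur
  rw [← hcu]
  rcases mul_eq_mul_right_iff.1 hur with h | h
  · rw [h]
  · simp [dist_eq_zero.1 h]

/-- The key claim in the proof of Lemma 2.3: if a shortest path `γ` on the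
boundary `S = frontier P` of a convex polytope `P ⊆ ℝ^{d+1}` with nonempty
interior has `γ s` and `γ t` (for `0 ≤ s < t ≤ 1`) in a common proper face `F`
of `P`, then `γ` traverses the straight segment `[γ s, γ t]` on `[s, t]`. -/
theorem shortest_path_straight_on_common_face {d : ℕ} (hd : 1 ≤ d)
    (P : Set (EuclideanSpace ℝ (Fin (d + 1))))
    (hP : ∃ A : Finset (EuclideanSpace ℝ (Fin (d + 1))),
      P = convexHull ℝ (A : Set (EuclideanSpace ℝ (Fin (d + 1)))))
    (hint : (interior P).Nonempty)
    (a b : EuclideanSpace ℝ (Fin (d + 1)))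
    (γ : ℝ → EuclideanSpace ℝ (Fin (d + 1)))
    (hγ : IsShortestPath (frontier P) a b γ)
    (F : Set (EuclideanSpace ℝ (Fin (d + 1))))
    (hF : IsFace P F) (hFproper : F ≠ P)
    (s t : ℝ) (hs : 0 ≤ s) (hst : s < t) (ht : t ≤ 1)
    (hγs : γ s ∈ F) (hγt : γ t ∈ F) :
    γ '' Set.Icc s t = segment ℝ (γ s) (γ t) := by
  obtain ⟨A, rfl⟩ := hP
  have hcomp := A.finite_toSet.isCompact_convexHull (𝕜 := ℝ)
  have hpath := hγ.1
  have hfin : pathLength γ ≠ ⊤ := by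
    obtain ⟨σ, hσ, hσfin⟩ := exists_isPathIn_frontier_pathLength_ne_top
      (by rw [finrank_euclideanSpace_fin]; omega) (convex_convexHull ℝ _) hcomp hint
      (hpath.2.1 ▸ hpath.2.2.2 (by simp)) (hpath.2.2.1 ▸ hpath.2.2.2 (by simp))
    exact ne_top_of_le_ne_top hσfin (hγ.2 ▸ iInf₂_le σ hσ)
  have hseg := (hF.2.1.segment_subset hγs hγt).trans (hF.subset_frontier hFproper)
  exact image_Icc_eq_segment_of_eVariationOn_le_edist hst.le
    (hpath.1.mono (Set.Icc_subset_Icc hs ht))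
    (hγ.eVariationOn_le_edist hfin hs hst ht hseg)
end

section
/- Fix d ≥ 1, let P ⊆ EuclideanSpace ℝ (Fin (d+1)) be a convex polytope with nonempty interior, let S = frontier P, let γ be a shortest path in S, and let F be a proper face of P. Then the set {t ∈ [0,1] : γ(t) ∈ F} is a convex subset of [0,1] (an interval); in particular, a shortest path on the boundary of a convex polytope meets each face in a single interval of time, so each facet appears at most once in its facet sequence. (From the proof of Lemma 2.3 of the paper.) -/
open scoped RealInnerProductSpace ENNReal

theorem LipschitzOnWith.eVariationOn_Icc_le {E : Type*} [PseudoEMetricSpace E] {f : ℝ → E}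
    {K : NNReal} {a b : ℝ} (hf : LipschitzOnWith K f (Set.Icc a b)) :
    eVariationOn f (Set.Icc a b) ≤ K * ENNReal.ofReal (b - a) := by
  have h := hf.comp_eVariationOn_le (g := id) (s := Set.Icc a b) (Set.mapsTo_id _)
  refine h.trans (mul_le_mul_right ?_ _)
  simp

theorem eVariationOn_Icc_add_Icc {E : Type*} [PseudoEMetricSpace E] (f : ℝ → E) {a b c : ℝ}
    (hab : a ≤ b) (hbc : b ≤ c) :
    eVariationOn f (Set.Icc a b) + eVariationOn f (Set.Icc b c) = eVariationOn f (Set.Icc a c) := by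
  simpa using eVariationOn.Icc_add_Icc f hab hbc (Set.mem_univ b)

section

variable {E : Type*} [NormedAddCommGroup E] [InnerProductSpace ℝ E]

/-- The piece of a path between times `s` and `u` may be replaced by a straight segment. -/
theorem IsPathIn.exists_shortcut {S : Set E} {a b : E} {γ : ℝ → E} (hγ : IsPathIn S a b γ)
    {s u : ℝ} (hs : 0 ≤ s) (hsu : s < u) (hu : u ≤ 1) (hseg : segment ℝ (γ s) (γ u) ⊆ S) :
    ∃ γ' : ℝ → E, IsPathIn S a b γ' ∧ pathLength γ' ≤
      eVariationOn γ (Set.Icc 0 s) + edist (γ s) (γ u) + eVariationOn γ (Set.Icc u 1) := by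
  obtain ⟨hcont, h0, h1, hmaps⟩ := hγ
  have hpos : 0 < u - s := sub_pos.2 hsu
  let ℓ : ℝ → E := fun r => AffineMap.lineMap (γ s) (γ u) ((r - s) / (u - s))
  let γ' : ℝ → E := fun r => if r ≤ s then γ r else if r ≤ u then ℓ r else γ r
  have e1 : Set.EqOn γ' γ (Set.Icc 0 s) := fun r hr => if_pos hr.2
  have e2 : Set.EqOn γ' ℓ (Set.Icc s u) := by
    intro r hr
    rcases hr.1.eq_or_lt with rfl | h
    · simp [γ', ℓ]
    · simp [γ', h.not_ge, hr.2]
  have e3 : Set.EqOn γ' γ (Set.Icc u 1) := by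
    intro r hr
    rcases hr.1.eq_or_lt with rfl | h
    · simp [γ', ℓ, hsu.not_ge, div_self hpos.ne']
    · simp [γ', h.not_ge, (hsu.trans h).not_ge]
  have hℓ : LipschitzOnWith (nndist (γ s) (γ u) * (u - s).toNNReal⁻¹) ℓ (Set.Icc s u) := by
    refine LipschitzOnWith.of_dist_le_mul fun x _ y _ => ?_
    simp only [ℓ, dist_lineMap_lineMap]
    have : dist ((x - s) / (u - s)) ((y - s) / (u - s)) = (u - s)⁻¹ * dist x y := by
      rw [Real.dist_eq, Real.dist_eq, ← sub_div, abs_div, abs_of_pos hpos]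
      ring_nf
    rw [this]
    simp only [NNReal.coe_mul, coe_nndist, NNReal.coe_inv, Real.coe_toNNReal _ hpos.le]
    apply le_of_eq
    ring
  have hu2 : Set.Icc (0 : ℝ) 1 = Set.Icc 0 s ∪ (Set.Icc s u ∪ Set.Icc u 1) := by
    rw [Set.Icc_union_Icc_eq_Icc hsu.le hu, Set.Icc_union_Icc_eq_Icc hs (hsu.le.trans hu)]
  refine ⟨γ', ⟨?_, ?_, ?_, ?_⟩, ?_⟩
  · rw [hu2]
    refine ContinuousOn.union_of_isClosed ?_ (ContinuousOn.union_of_isClosed ?_ ?_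
      isClosed_Icc isClosed_Icc) isClosed_Icc (isClosed_Icc.union isClosed_Icc)
    · exact (hcont.mono (Set.Icc_subset_Icc_right (hsu.le.trans hu))).congr e1
    · exact hℓ.continuousOn.congr e2
    · exact (hcont.mono (Set.Icc_subset_Icc_left (hs.trans hsu.le))).congr e3
  · rw [e1 ⟨le_rfl, hs⟩, h0]
  · rw [e3 ⟨hu, le_rfl⟩, h1]
  · intro r hr
    rw [hu2] at hr
    rcases hr with hr | hr | hr
    · rw [e1 hr]
      exact hmaps ⟨hr.1, hr.2.trans (hsu.le.trans hu)⟩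
    · rw [e2 hr]
      refine hseg ?_
      rw [segment_eq_image_lineMap]
      exact ⟨_, ⟨div_nonneg (sub_nonneg.2 hr.1) hpos.le,
        (div_le_one hpos).2 (sub_le_sub_right hr.2 s)⟩, rfl⟩
    · rw [e3 hr]
      exact hmaps ⟨(hs.trans hsu.le).trans hr.1, hr.2⟩
  · rw [pathLength, ← eVariationOn_Icc_add_Icc γ' (hs.trans hsu.le) hu,
      ← eVariationOn_Icc_add_Icc γ' hs hsu.le, eVariationOn.congr e1, eVariationOn.congr e2,
      eVariationOn.congr e3]
    gcongr
    refine (hℓ.eVariationOn_Icc_le).trans (le_of_eq ?_)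
    rw [edist_nndist, ENNReal.ofReal, ← ENNReal.coe_mul, mul_assoc,
      inv_mul_cancel₀ (Real.toNNReal_pos.2 hpos).ne', mul_one]

/-- A shortest path of finite length between two points whose connecting segment lies in `S`
runs along that segment. -/
theorem IsShortestPath.wbtw {S : Set E} {a b : E} {γ : ℝ → E} (hγ : IsShortestPath S a b γ)
    (hfin : intrinsicDist S a b ≠ ⊤) {s t u : ℝ} (hs : 0 ≤ s) (hst : s ≤ t) (htu : t ≤ u)
    (hu : u ≤ 1) (hseg : segment ℝ (γ s) (γ u) ⊆ S) : Wbtw ℝ (γ s) (γ t) (γ u) := by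
  rcases (hst.trans htu).eq_or_lt with rfl | hsu
  · obtain rfl : t = s := le_antisymm htu hst
    exact wbtw_self_left ℝ _ _
  obtain ⟨γ', hγ', hlen⟩ := hγ.1.exists_shortcut hs hsu hu hseg
  have hle : eVariationOn γ (Set.Icc 0 1) ≤
      eVariationOn γ (Set.Icc 0 s) + edist (γ s) (γ u) + eVariationOn γ (Set.Icc u 1) := by
    refine (hγ.2.le.trans ?_).trans hlen
    exact iInf₂_le γ' hγ'
  have hne : eVariationOn γ (Set.Icc 0 1) ≠ ⊤ := by
    rw [← pathLength, hγ.2]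
    exact hfin
  have hu0 : 0 ≤ u := hs.trans hsu.le
  have hne1 : eVariationOn γ (Set.Icc 0 s) ≠ ⊤ :=
    ne_top_of_le_ne_top hne (eVariationOn.mono _ (Set.Icc_subset_Icc_right (hsu.le.trans hu)))
  have hne2 : eVariationOn γ (Set.Icc u 1) ≠ ⊤ :=
    ne_top_of_le_ne_top hne (eVariationOn.mono _ (Set.Icc_subset_Icc_left hu0))
  rw [← eVariationOn_Icc_add_Icc γ hu0 hu, ← eVariationOn_Icc_add_Icc γ hs hsu.le,
    ENNReal.add_le_add_iff_right hne2, ENNReal.add_le_add_iff_left hne1,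
    ← eVariationOn_Icc_add_Icc γ hst htu] at hle
  have h1 := eVariationOn.edist_le γ (Set.left_mem_Icc.2 hst) (Set.right_mem_Icc.2 hst)
  have h2 := eVariationOn.edist_le γ (Set.left_mem_Icc.2 htu) (Set.right_mem_Icc.2 htu)
  have h3 := (add_le_add h1 h2).trans hle
  rw [edist_dist, edist_dist, edist_dist, ← ENNReal.ofReal_add dist_nonneg dist_nonneg,
    ENNReal.ofReal_le_ofReal_iff dist_nonneg] at h3
  exact dist_add_dist_eq_iff.1 (le_antisymm h3 (dist_triangle _ _ _))

/-- Any two nonzero points of a real vector space of dimension at least two are joined by a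
smooth curve avoiding the origin. -/
theorem exists_contDiff_curve_ne_zero (hE : 1 < Module.rank ℝ E) {a b : E} (ha : a ≠ 0)
    (hb : b ≠ 0) :
    ∃ f : ℝ → E, ContDiff ℝ 1 f ∧ f 0 = a ∧ f 1 = b ∧ ∀ t, t ∈ Set.Icc (0 : ℝ) 1 → f t ≠ 0 := by
  by_cases h : ∀ t, t ∈ Set.Icc (0 : ℝ) 1 → (1 - t) • a + t • b ≠ 0
  · exact ⟨fun t => (1 - t) • a + t • b, by fun_prop, by simp, by simp, h⟩
  push Not at h
  obtain ⟨t₀, -, h₀⟩ := h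
  have ht₀ : t₀ ≠ 0 := by
    rintro rfl
    simp [ha] at h₀
  have hb' : ∃ k : ℝ, b = k • a := by
    refine ⟨-(t₀⁻¹ * (1 - t₀)), ?_⟩
    rw [neg_smul, mul_smul, eq_neg_of_add_eq_zero_left h₀, smul_neg, neg_neg, smul_smul,
      inv_mul_cancel₀ ht₀, one_smul]
  obtain ⟨k, rfl⟩ := hb'
  obtain ⟨c, hc⟩ : ∃ c : E, ∀ r : ℝ, r • a ≠ c := by
    by_contra! hcon
    exact (rank_le_one_iff.2 ⟨a, hcon⟩).not_gt hE
  refine ⟨fun t => (1 - t) • a + t • k • a + (t * (1 - t)) • c, by fun_prop, by simp, by simp, ?_⟩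
  intro t _ h
  rcases eq_or_ne (t * (1 - t)) 0 with h0 | h0
  · rcases mul_eq_zero.1 h0 with rfl | h1
    · simp [ha] at h
    · obtain rfl : t = 1 := by linarith
      apply hb
      simpa using h
  · apply hc ((t * (1 - t))⁻¹ * -((1 - t) + t * k))
    rw [mul_smul, neg_smul, add_smul, mul_smul, neg_eq_of_add_eq_zero_right h, smul_smul,
      inv_mul_cancel₀ h0, one_smul]

/-- Two points on the boundary of a bounded convex neighbourhood of the origin, in dimension at
least two, are joined by a Lipschitz path in that boundary. -/
theorem exists_lipschitz_path_frontier (hE : 1 < Module.rank ℝ E) {K : Set E} (hK : Convex ℝ K)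
    (hb : Bornology.IsBounded K) (h0 : K ∈ nhds (0 : E)) {a b : E} (ha : a ∈ frontier K)
    (hb' : b ∈ frontier K) :
    ∃ (γ : ℝ → E) (C : NNReal), IsPathIn (frontier K) a b γ ∧
      LipschitzOnWith C γ (Set.Icc 0 1) := by
  have habs : Absorbent ℝ K := absorbent_nhds_zero h0
  have hvon := NormedSpace.isVonNBounded_of_isBounded ℝ hb
  have hga := (gauge_eq_one_iff_mem_frontier hK h0).2 ha
  have hgb := (gauge_eq_one_iff_mem_frontier hK h0).2 hb'
  have hne : ∀ x : E, gauge K x = 1 → x ≠ 0 := by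
    rintro x hx rfl
    simp at hx
  obtain ⟨f, hf, f0, f1, hfne⟩ := exists_contDiff_curve_ne_zero hE (hne a hga) (hne b hgb)
  obtain ⟨L, hL⟩ := hK.lipschitz_gauge h0
  have hpos : ∀ t ∈ Set.Icc (0 : ℝ) 1, 0 < gauge K (f t) := fun t ht =>
    (gauge_pos habs hvon).2 (hfne t ht)
  let γ : ℝ → E := fun t => (gauge K (f t))⁻¹ • f t
  have hloc : LocallyLipschitzOn (Set.Icc 0 1) γ := by
    intro t ht
    obtain ⟨C₁, U, hU, hC₁⟩ := hf.contDiffAt.exists_lipschitzOnWith (x := t)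
    have hsm : ContDiffAt ℝ 1 (fun p : ℝ × E => p.1⁻¹ • p.2) (gauge K (f t), f t) :=
      (contDiffAt_fst.inv (hpos t ht).ne').smul contDiffAt_snd
    obtain ⟨C₂, V, hV, hC₂⟩ := hsm.exists_lipschitzOnWith
    have hpair : LipschitzOnWith (max (L * C₁) C₁) (fun r => (gauge K (f r), f r)) U :=
      (hL.comp_lipschitzOnWith hC₁).prodMk hC₁
    have hcts : Filter.Tendsto (fun r => (gauge K (f r), f r)) (nhds t)
        (nhds (gauge K (f t), f t)) :=
      ((hL.continuous.comp hf.continuous).prodMk hf.continuous).tendsto t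
    refine ⟨_, _, mem_nhdsWithin_of_mem_nhds (Filter.inter_mem hU (hcts hV)),
      hC₂.comp (hpair.mono Set.inter_subset_left) fun r hr => hr.2⟩
  obtain ⟨C, hC⟩ := hloc.exists_lipschitzOnWith_of_compact isCompact_Icc
  refine ⟨γ, C, ⟨hC.continuousOn, by simp [γ, f0, hga], by simp [γ, f1, hgb], ?_⟩, hC⟩
  intro t ht
  rw [← gauge_eq_one_iff_mem_frontier hK h0, gauge_smul_of_nonneg (inv_nonneg.2 (gauge_nonneg _)),
    smul_eq_mul, inv_mul_cancel₀ (hpos t ht).ne']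

/-- The intrinsic distance on the boundary of a bounded convex body of dimension at least two is
finite. -/
theorem intrinsicDist_frontier_ne_top (hE : 1 < Module.rank ℝ E) {K : Set E} (hK : Convex ℝ K)
    (hb : Bornology.IsBounded K) (hint : (interior K).Nonempty) {a b : E} (ha : a ∈ frontier K)
    (hb' : b ∈ frontier K) : intrinsicDist (frontier K) a b ≠ ⊤ := by
  obtain ⟨x₀, hx₀⟩ := hint
  let e := Homeomorph.addRight x₀
  have hfr : ∀ x, x ∈ frontier (e ⁻¹' K) ↔ x + x₀ ∈ frontier K := fun x => by
    rw [← e.preimage_frontier]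
    rfl
  obtain ⟨γ, C, ⟨-, h0, h1, hmaps⟩, hC⟩ := exists_lipschitz_path_frontier hE
    (K := e ⁻¹' K) (a := a - x₀) (b := b - x₀) (hK.translate_preimage_left x₀)
    ((Bornology.IsBounded.vadd hb (-x₀)).subset fun x hx => by
      refine Set.mem_vadd_set.2 ⟨x + x₀, hx, by simp⟩)
    (e.continuous.continuousAt.preimage_mem_nhds (by
      simpa [e] using mem_interior_iff_mem_nhds.1 hx₀))
    (by rw [hfr]; simpa using ha) (by rw [hfr]; simpa using hb')
  have hC' : LipschitzOnWith C (fun t => γ t + x₀) (Set.Icc 0 1) := fun x hx y hy => by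
    simpa using hC hx hy
  have hpath : IsPathIn (frontier K) a b fun t => γ t + x₀ :=
    ⟨hC'.continuousOn, by simp [h0], by simp [h1], fun t ht => (hfr _).1 (hmaps ht)⟩
  refine ne_top_of_le_ne_top ?_ ((iInf₂_le _ hpath).trans hC'.eVariationOn_Icc_le)
  finiteness

/-- A face containing an interior point is everything. -/
theorem IsFace.disjoint_interior {P F : Set E} (hF : IsFace P F) (hne : F ≠ P) :
    Disjoint F (interior P) := by
  rw [Set.disjoint_left]
  intro x hxF hx
  refine hne (hF.2.2.subset.antisymm fun y hy => ?_)
  have hcts : Filter.Tendsto (fun ε : ℝ => x + ε • (x - y)) (nhds 0) (nhds x) := by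
    have : Continuous fun ε : ℝ => x + ε • (x - y) := by fun_prop
    simpa using this.tendsto 0
  have hev : ∀ᶠ ε : ℝ in nhdsWithin 0 (Set.Ioi 0), x + ε • (x - y) ∈ P :=
    (hcts.mono_left nhdsWithin_le_nhds).eventually (mem_interior_iff_mem_nhds.1 hx)
  obtain ⟨ε, hε, hε0 : 0 < ε⟩ := (hev.and self_mem_nhdsWithin).exists
  refine hF.2.2.left_mem_of_mem_openSegment (𝕜 := ℝ) hy hε hxF ?_
  have h1 : (1 : ℝ) + ε ≠ 0 := by positivity
  refine ⟨ε / (1 + ε), 1 / (1 + ε), by positivity, by positivity, by field_simp; ring, ?_⟩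
  have : x = (1 / (1 + ε)) • ((1 + ε) • x) := by rw [smul_smul]; field_simp; simp
  conv_rhs => rw [this]
  module

end

/-- From the proof of Lemma 2.3: a shortest path on the boundary of a convex
polytope meets each proper face in a single interval of time: the set of times
`t ∈ [0,1]` with `γ t ∈ F` is a convex subset of `[0,1]`. -/
theorem shortest_path_face_times_convex {d : ℕ} (hd : 1 ≤ d)
    (P : Set (EuclideanSpace ℝ (Fin (d + 1))))
    (hP : ∃ A : Finset (EuclideanSpace ℝ (Fin (d + 1))),
      P = convexHull ℝ (A : Set (EuclideanSpace ℝ (Fin (d + 1)))))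
    (hint : (interior P).Nonempty)
    (a b : EuclideanSpace ℝ (Fin (d + 1)))
    (γ : ℝ → EuclideanSpace ℝ (Fin (d + 1)))
    (hγ : IsShortestPath (frontier P) a b γ)
    (F : Set (EuclideanSpace ℝ (Fin (d + 1))))
    (hF : IsFace P F) (hFproper : F ≠ P) :
    Convex ℝ {t : ℝ | t ∈ Set.Icc (0 : ℝ) 1 ∧ γ t ∈ F} := by
  obtain ⟨A, hA⟩ := hP
  have hconv : Convex ℝ P := hA ▸ convex_convexHull ℝ _
  have hcomp : IsCompact P := hA ▸ A.finite_toSet.isCompact_convexHull (𝕜 := ℝ)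
  have hFS : F ⊆ frontier P := fun x hx => by
    rw [hcomp.isClosed.frontier_eq]
    exact ⟨hF.2.2.subset hx, Set.disjoint_left.1 (hF.disjoint_interior hFproper) hx⟩
  have hrank : 1 < Module.rank ℝ (EuclideanSpace ℝ (Fin (d + 1))) := by
    rw [← Module.finrank_eq_rank, finrank_euclideanSpace_fin]
    exact_mod_cast Nat.lt_add_one_of_le hd
  have ha : a ∈ frontier P := hγ.1.2.1 ▸ hγ.1.2.2.2 (Set.left_mem_Icc.2 zero_le_one)
  have hb : b ∈ frontier P := hγ.1.2.2.1 ▸ hγ.1.2.2.2 (Set.right_mem_Icc.2 zero_le_one)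
  have hfin := intrinsicDist_frontier_ne_top hrank hconv hcomp.isBounded hint ha hb
  refine Set.OrdConnected.convex ⟨fun s hs u hu t ht => ?_⟩
  have hseg : segment ℝ (γ s) (γ u) ⊆ F := hF.2.1.segment_subset hs.2 hu.2
  refine ⟨⟨hs.1.1.trans ht.1, ht.2.trans hu.1.2⟩, hseg (mem_segment_iff_wbtw.2 ?_)⟩
  exact hγ.wbtw hfin hs.1.1 ht.1 ht.2 hu.1.2 (hseg.trans hFS)
end

section
/- Fix d ≥ 1, let P ⊆ EuclideanSpace ℝ (Fin (d+1)) be a convex polytope with nonempty interior, and let S = frontier P. Let γ be a shortest path in S from a = γ(0) to b = γ(1), and suppose no face of P of dimension d contains both a and b. Then for every t ∈ (0,1) with γ(t) ∉ {a, b}, the point γ(t) lies in no face of P of dimension at most d−2; that is, the relative interior of a shortest path connecting two points not lying on a common facet contains no warped point. (Proposition 1.1 of the paper.) -/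
open scoped RealInnerProductSpace ENNReal

section Paths

variable {E : Type*} [NormedAddCommGroup E] [InnerProductSpace ℝ E] {S T : Set E} {x y z : E}
  {L M : ℝ≥0∞}

/-- `x` and `y` are joined in `S` by a path of length at most `L`. -/
def JoinedWithin (S : Set E) (x y : E) (L : ℝ≥0∞) : Prop :=
  ∃ f : ℝ → E, IsPathIn S x y f ∧ pathLength f ≤ L

/-- A path parametrized by an arbitrary interval `[s, t]` can be reparametrized by `[0, 1]`. -/
theorem JoinedWithin.of_continuousOn {f : ℝ → E} {s t : ℝ} (hst : s ≤ t)
    (hf : ContinuousOn f (Set.Icc s t)) (hS : Set.MapsTo f (Set.Icc s t) S) :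
    JoinedWithin S (f s) (f t) (eVariationOn f (Set.Icc s t)) := by
  have hm : Set.MapsTo (fun r : ℝ => s + r * (t - s)) (Set.Icc 0 1) (Set.Icc s t) := by
    rintro r ⟨h0, h1⟩
    constructor <;> nlinarith
  refine ⟨f ∘ fun r => s + r * (t - s), ⟨hf.comp (by fun_prop) hm, by simp, by simp,
    hS.comp hm⟩, eVariationOn.comp_le_of_monotoneOn f _ ?_ hm⟩
  intro p _ q _ hpq
  have := mul_le_mul_of_nonneg_right hpq (sub_nonneg.2 hst)
  simpa using this

theorem JoinedWithin.mono (h : JoinedWithin S x y L) (hST : S ⊆ T) (hLM : L ≤ M) :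
    JoinedWithin T x y M := by
  obtain ⟨f, ⟨h1, h2, h3, h4⟩, h5⟩ := h
  exact ⟨f, ⟨h1, h2, h3, h4.mono_right hST⟩, h5.trans hLM⟩

theorem JoinedWithin.intrinsicDist_le (h : JoinedWithin S x y L) : intrinsicDist S x y ≤ L := by
  obtain ⟨f, h1, h2⟩ := h
  exact (iInf₂_le f h1).trans h2

theorem JoinedWithin.trans (h : JoinedWithin S x y L) (h' : JoinedWithin S y z M) :
    JoinedWithin S x z (L + M) := by
  obtain ⟨f, ⟨f1, f2, f3, f4⟩, f5⟩ := h
  obtain ⟨g, ⟨g1, g2, g3, g4⟩, g5⟩ := h'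
  have hm : Set.MapsTo (fun r : ℝ => r - 1) (Set.Icc 1 2) (Set.Icc 0 1) := by
    rintro r ⟨h0, h1⟩
    constructor <;> linarith
  let k : ℝ → E := fun r => if r ≤ 1 then f r else g (r - 1)
  have kf : Set.EqOn k f (Set.Icc 0 1) := fun r hr => by simp [k, hr.2]
  have kg : Set.EqOn k (g ∘ fun r => r - 1) (Set.Icc 1 2) := by
    intro r hr
    rcases hr.1.eq_or_lt with h | h
    · simp [k, ← h, f3, g2]
    · simp [k, h.not_ge]
  have hU : Set.Icc (0 : ℝ) 1 ∪ Set.Icc 1 2 = Set.Icc 0 2 :=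
    Set.Icc_union_Icc_eq_Icc zero_le_one one_le_two
  have hc : ContinuousOn k (Set.Icc 0 2) := by
    rw [← hU]
    exact (f1.congr kf).union_of_isClosed ((g1.comp (by fun_prop) hm).congr kg)
      isClosed_Icc isClosed_Icc
  have hS : Set.MapsTo k (Set.Icc 0 2) S := by
    rw [← hU]
    exact (f4.congr kf.symm).union ((g4.comp hm).congr kg.symm)
  have key := JoinedWithin.of_continuousOn zero_le_two hc hS
  have k0 : k 0 = x := by simp [k, f2]
  have k2 : k 2 = z := by
    have : (2 : ℝ) - 1 = 1 := by norm_num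
    simp [k, this, g3]
  rw [k0, k2] at key
  refine key.mono subset_rfl ?_
  have hadd := eVariationOn.Icc_add_Icc k (s := Set.univ) (zero_le_one' ℝ) one_le_two trivial
  simp only [Set.univ_inter] at hadd
  rw [← hadd, eVariationOn.congr kf, eVariationOn.congr kg]
  refine add_le_add f5 ((eVariationOn.comp_le_of_monotoneOn g _ ?_ hm).trans g5)
  intro p _ q _ hpq
  simpa using hpq

theorem JoinedWithin.of_segment (h : segment ℝ x y ⊆ S) : JoinedWithin S x y (edist x y) := by
  have hL : LipschitzWith (nndist x y) (AffineMap.lineMap x y : ℝ → E) :=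
    lipschitzWith_lineMap x y
  refine ⟨AffineMap.lineMap x y, ⟨hL.continuous.continuousOn, by simp, by simp, ?_⟩, ?_⟩
  · intro r hr
    apply h
    rw [segment_eq_image_lineMap]
    exact ⟨r, hr, rfl⟩
  · have := (hL.lipschitzOnWith (s := Set.univ)).comp_eVariationOn_le (g := (id : ℝ → ℝ))
      (s := Set.Icc 0 1) (Set.mapsTo_univ _ _)
    refine (this.trans ?_)
    have h1 : eVariationOn (id : ℝ → ℝ) (Set.Icc 0 1) ≤ 1 := by
      simpa only [Set.univ_inter, id, sub_zero, ENNReal.ofReal_one] using ((monotone_id (α := ℝ)).monotoneOn Set.univ |>.eVariationOn_eq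
        (a := 0) (b := 1) trivial trivial).le
    calc (nndist x y : ℝ≥0∞) * eVariationOn (id : ℝ → ℝ) (Set.Icc 0 1)
        ≤ (nndist x y : ℝ≥0∞) * 1 := by gcongr
      _ = edist x y := by rw [mul_one, edist_nndist]

/-- Nearest-point projection onto a closed convex set pushes paths avoiding the interior to paths
in the frontier without increasing length. -/
theorem JoinedWithin.frontier_of_compl_interior [CompleteSpace E] {K : Set E} (hK : Convex ℝ K)
    (hcl : IsClosed K) (h : JoinedWithin (interior K)ᶜ x y L) (hx : x ∈ frontier K)
    (hy : y ∈ frontier K) : JoinedWithin (frontier K) x y L := by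
  have hxK : x ∈ K := hcl.frontier_subset hx
  have hyK : y ∈ K := hcl.frontier_subset hy
  choose π hπK hπ using fun u : E =>
    exists_norm_eq_iInf_of_complete_convex ⟨x, hxK⟩ hcl.isComplete hK u
  have hin : ∀ u, ∀ q ∈ K, ⟪u - π u, q - π u⟫ ≤ 0 := fun u =>
    (norm_eq_iInf_iff_real_inner_le_zero hK (hπK u)).1 (hπ u)
  have hfix : ∀ u ∈ K, π u = u := by
    intro u hu
    have := hin u u hu
    rw [real_inner_self_eq_norm_sq] at this
    have h0 : ‖u - π u‖ = 0 := by nlinarith [norm_nonneg (u - π u)]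
    exact (sub_eq_zero.1 (norm_eq_zero.1 h0)).symm
  have hlip : LipschitzWith 1 π := by
    refine LipschitzWith.of_dist_le_mul fun u v => ?_
    rw [NNReal.coe_one, one_mul, dist_eq_norm, dist_eq_norm]
    have h1 := hin u (π v) (hπK v)
    have h2 := hin v (π u) (hπK u)
    have h3 : ‖π u - π v‖ * ‖π u - π v‖ ≤ ⟪u - v, π u - π v⟫ := by
      rw [← real_inner_self_eq_norm_mul_norm]
      have e1 : u - v = (u - π u) - (v - π v) + (π u - π v) := by abel
      have e2 : ⟪u - π u, π v - π u⟫ = -⟪u - π u, π u - π v⟫ := by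
        rw [← inner_neg_right, neg_sub]
      rw [e1, inner_add_left (_ - _), inner_sub_left (u - π u)]
      linarith
    have h4 := h3.trans (real_inner_le_norm _ _)
    rcases (norm_nonneg (π u - π v)).eq_or_lt with h | h
    · rw [← h]; positivity
    · exact le_of_mul_le_mul_right h4 h
  have hfr : ∀ u ∉ interior K, π u ∈ frontier K := by
    intro u hu
    refine ⟨subset_closure (hπK u), fun hi => hu ?_⟩
    have hev : ∀ᶠ t in nhdsWithin (0 : ℝ) (Set.Ioi 0), π u + t • (u - π u) ∈ interior K := by
      have hc : Continuous fun t : ℝ => π u + t • (u - π u) := by fun_prop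
      refine (hc.continuousAt.eventually_mem ?_).filter_mono nhdsWithin_le_nhds
      simpa using isOpen_interior.mem_nhds hi
    obtain ⟨t, ht, ht0⟩ := (hev.and self_mem_nhdsWithin).exists
    have h1 := hin u _ (interior_subset ht)
    rw [add_sub_cancel_left, inner_smul_right, real_inner_self_eq_norm_sq] at h1
    have h2 : ‖u - π u‖ ^ 2 ≤ 0 := nonpos_of_mul_nonpos_right h1 ht0
    have h3 : ‖u - π u‖ = 0 := by nlinarith [norm_nonneg (u - π u)]
    rwa [sub_eq_zero.1 (norm_eq_zero.1 h3)]
  obtain ⟨f, ⟨f1, f2, f3, f4⟩, f5⟩ := h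
  refine ⟨π ∘ f, ⟨hlip.continuous.comp_continuousOn f1, by simp [f2, hfix x hxK],
    by simp [f3, hfix y hyK], fun r hr => hfr _ (f4 hr)⟩, ?_⟩
  have := (hlip.lipschitzOnWith (s := Set.univ)).comp_eVariationOn_le (g := f)
    (s := Set.Icc 0 1) (Set.mapsTo_univ _ _)
  rw [ENNReal.coe_one, one_mul] at this
  exact this.trans f5

/-- Every subpath of a shortest path of finite length is shortest. -/
theorem IsShortestPath.eVariationOn_le {a b : E} {γ : ℝ → E} (hγ : IsShortestPath S a b γ)
    (hfin : intrinsicDist S a b ≠ ⊤) {s t : ℝ} (hs : 0 ≤ s) (hst : s ≤ t) (ht : t ≤ 1)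
    (h : JoinedWithin S (γ s) (γ t) L) : eVariationOn γ (Set.Icc s t) ≤ L := by
  obtain ⟨⟨g1, g2, g3, g4⟩, g5⟩ := hγ
  have i1 : Set.Icc 0 s ⊆ Set.Icc (0 : ℝ) 1 := Set.Icc_subset_Icc le_rfl (hst.trans ht)
  have i2 : Set.Icc t 1 ⊆ Set.Icc (0 : ℝ) 1 := Set.Icc_subset_Icc (hs.trans hst) le_rfl
  have j1 := JoinedWithin.of_continuousOn hs (g1.mono i1) (g4.mono_left i1)
  have j2 := JoinedWithin.of_continuousOn ht (g1.mono i2) (g4.mono_left i2)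
  rw [g2] at j1
  rw [g3] at j2
  have key := ((j1.trans h).trans j2).intrinsicDist_le
  rw [← g5] at key hfin
  have a1 := eVariationOn.Icc_add_Icc γ (s := Set.univ) hs hst trivial
  have a2 := eVariationOn.Icc_add_Icc γ (s := Set.univ) (hs.trans hst) ht trivial
  simp only [Set.univ_inter] at a1 a2
  rw [pathLength] at key hfin
  rw [← a2, ← a1] at key hfin
  simp only [ne_eq, ENNReal.add_eq_top, not_or] at hfin
  rwa [ENNReal.add_le_add_iff_right hfin.2, ENNReal.add_le_add_iff_left hfin.1.1] at key

theorem IsShortestPath.eqOn_of_eq {a b : E} {γ : ℝ → E} (hγ : IsShortestPath S a b γ)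
    (hfin : intrinsicDist S a b ≠ ⊤) {s t : ℝ} (hs : 0 ≤ s) (hst : s ≤ t) (ht : t ≤ 1)
    (h : γ s = γ t) : ∀ r ∈ Set.Icc s t, γ r = γ s := by
  have hj : JoinedWithin S (γ s) (γ t) (edist (γ s) (γ t)) := by
    apply JoinedWithin.of_segment
    rw [h, segment_same, Set.singleton_subset_iff]
    exact hγ.1.2.2.2 ⟨hs.trans hst, ht⟩
  have key := hγ.eVariationOn_le hfin hs hst ht hj
  rw [h, edist_self] at key
  intro r hr
  have := (eVariationOn.edist_le γ hr (Set.left_mem_Icc.2 hst)).trans key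
  exact edist_le_zero.1 this

end Paths

section Geometry

variable {E : Type*} [NormedAddCommGroup E] [InnerProductSpace ℝ E]

theorem Convex.exists_supporting_normal [FiniteDimensional ℝ E] {K : Set E} (hK : Convex ℝ K)
    (hint : (interior K).Nonempty) {x : E} (hx : x ∉ interior K) :
    ∃ n : E, n ≠ 0 ∧ (∀ y ∈ K, ⟪n, y⟫ ≤ ⟪n, x⟫) ∧ ∀ y ∈ interior K, ⟪n, y⟫ < ⟪n, x⟫ := by
  obtain ⟨f, hf⟩ := geometric_hahn_banach_open_point hK.interior isOpen_interior hx
  obtain ⟨n, rfl⟩ := (InnerProductSpace.toDual ℝ E).surjective f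
  simp only [InnerProductSpace.toDual_apply_apply] at hf
  refine ⟨n, ?_, fun y hy => ?_, hf⟩
  · rintro rfl
    obtain ⟨y, hy⟩ := hint
    simpa using hf y hy
  · have hcl : y ∈ closure (interior K) := by
      rw [hK.closure_interior_eq_closure_of_nonempty_interior hint]
      exact subset_closure hy
    have hc : IsClosed {z : E | ⟪n, z⟫ ≤ ⟪n, x⟫} := isClosed_le (by fun_prop) (by fun_prop)
    exact closure_minimal (fun z hz => (hf z hz).le) hc hcl

/-- Two half-spaces whose outer normals are not opposite intersect. -/
theorem exists_le_inner_of_ne_neg {n m : E} (hn : ‖n‖ = 1) (hm : ‖m‖ = 1) (h : m ≠ -n) (r s : ℝ) :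
    ∃ z : E, r ≤ ⟪n, z⟫ ∧ s ≤ ⟪m, z⟫ := by
  have hlt : 0 < 1 + ⟪n, m⟫ := by
    have h0 : 0 < ‖n + m‖ := norm_pos_iff.2 fun h' => h (eq_neg_of_add_eq_zero_right h')
    have h1 := norm_add_sq_real n m
    rw [hn, hm] at h1
    nlinarith
  have e1 : ⟪n, n + m⟫ = 1 + ⟪n, m⟫ := by
    rw [inner_add_right, real_inner_self_eq_norm_sq, hn]; ring
  have e2 : ⟪m, n + m⟫ = 1 + ⟪n, m⟫ := by
    rw [inner_add_right, real_inner_self_eq_norm_sq, hm, real_inner_comm]; ring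
  refine ⟨(max r s / (1 + ⟪n, m⟫)) • (n + m), ?_, ?_⟩
  · rw [inner_smul_right, e1, div_mul_cancel₀ _ hlt.ne']
    exact le_max_left _ _
  · rw [inner_smul_right, e2, div_mul_cancel₀ _ hlt.ne']
    exact le_max_right _ _

theorem segment_subset_of_supporting {K : Set E} {n x y : E} {c : ℝ}
    (hn : ∀ z ∈ interior K, ⟪n, z⟫ < c) (hx : c ≤ ⟪n, x⟫) (hy : c ≤ ⟪n, y⟫) :
    segment ℝ x y ⊆ (interior K)ᶜ := by
  intro z hz hi
  have hc : Convex ℝ {z : E | c ≤ ⟪n, z⟫} :=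
    convex_halfSpace_ge (innerₛₗ ℝ n).isLinear c
  exact (hn z hi).not_ge (hc.segment_subset hx hy hz)

theorem Convex.exists_supporting_unit_normal [FiniteDimensional ℝ E] {K : Set E}
    (hK : Convex ℝ K) (hint : (interior K).Nonempty) {x : E} (hx : x ∉ interior K) :
    ∃ n : E, ‖n‖ = 1 ∧ ∀ y ∈ interior K, ⟪n, y⟫ < ⟪n, x⟫ := by
  obtain ⟨n, hn, -, h⟩ := hK.exists_supporting_normal hint hx
  refine ⟨‖n‖⁻¹ • n, norm_smul_inv_norm hn, fun y hy => ?_⟩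
  rw [real_inner_smul_left, real_inner_smul_left]
  have : 0 < ‖n‖⁻¹ := inv_pos.2 (norm_pos_iff.2 hn)
  exact mul_lt_mul_of_pos_left (h y hy) this

/-- The intrinsic distance in the boundary of a convex body of dimension at least two is finite. -/
theorem Convex.intrinsicDist_frontier_ne_top [FiniteDimensional ℝ E] {K : Set E}
    (hK : Convex ℝ K) (hcomp : IsCompact K) (hint : (interior K).Nonempty)
    (hdim : 2 ≤ Module.finrank ℝ E) {x y : E} (hx : x ∈ frontier K) (hy : y ∈ frontier K) :
    intrinsicDist (frontier K) x y ≠ ⊤ := by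
  suffices h : ∃ L : ℝ≥0∞, L ≠ ⊤ ∧ JoinedWithin (interior K)ᶜ x y L by
    obtain ⟨L, hL, h⟩ := h
    exact ne_top_of_le_ne_top hL
      (h.frontier_of_compl_interior hK hcomp.isClosed hx hy).intrinsicDist_le
  obtain ⟨n, hn1, hn⟩ := hK.exists_supporting_unit_normal hint hx.2
  obtain ⟨m, hm1, hm⟩ := hK.exists_supporting_unit_normal hint hy.2
  by_cases hnm : m = -n
  · obtain ⟨k, hk0, hkn⟩ : ∃ k : E, k ≠ 0 ∧ ⟪n, k⟫ = 0 := by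
      have : ((ℝ ∙ n)ᗮ : Submodule ℝ E) ≠ ⊥ := by
        intro h
        have h1 := Submodule.finrank_add_finrank_orthogonal (ℝ ∙ n)
        rw [h, finrank_bot] at h1
        have h2 : Module.finrank ℝ (ℝ ∙ n) ≤ 1 := (finrank_span_le_card {n}).trans (by simp)
        omega
      obtain ⟨k, hk, hk0⟩ := Submodule.exists_mem_ne_zero_of_ne_bot this
      exact ⟨k, hk0, Submodule.mem_orthogonal_singleton_iff_inner_right.1 hk⟩
    set l := ‖k‖⁻¹ • k with hl
    have hl1 : ‖l‖ = 1 := norm_smul_inv_norm hk0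
    have hln : ⟪n, l⟫ = 0 := by rw [hl, inner_smul_right, hkn, mul_zero]
    have hl0 : ∀ j : E, ‖j‖ = 1 → ⟪j, l⟫ = 0 → l ≠ -j := by
      intro j hj hjl h
      rw [h, inner_neg_right, real_inner_self_eq_norm_sq, hj] at hjl
      norm_num at hjl
    obtain ⟨B, hB⟩ := hcomp.isBounded.exists_norm_le
    have hlK : ∀ z ∈ interior K, ⟪l, z⟫ < B + 1 := by
      intro z hz
      have h1 := real_inner_le_norm l z
      have h2 := hB z (interior_subset hz)
      rw [hl1, one_mul] at h1
      linarith
    obtain ⟨z₁, h1, h1'⟩ := exists_le_inner_of_ne_neg hn1 hl1 (hl0 n hn1 hln) ⟪n, x⟫ (B + 1)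
    obtain ⟨z₂, h2, h2'⟩ := exists_le_inner_of_ne_neg hm1 hl1
      (hl0 m hm1 (by rw [hnm, inner_neg_left, hln, neg_zero])) ⟪m, y⟫ (B + 1)
    exact ⟨_, by finiteness,
      ((JoinedWithin.of_segment (segment_subset_of_supporting hn le_rfl h1)).trans
        (JoinedWithin.of_segment (segment_subset_of_supporting hlK h1' h2'))).trans
        (JoinedWithin.of_segment (segment_subset_of_supporting hm h2 le_rfl))⟩
  · obtain ⟨z, h1, h2⟩ := exists_le_inner_of_ne_neg hn1 hm1 hnm ⟪n, x⟫ ⟪m, y⟫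
    exact ⟨_, by finiteness,
      (JoinedWithin.of_segment (segment_subset_of_supporting hn le_rfl h1)).trans
        (JoinedWithin.of_segment (segment_subset_of_supporting hm h2 le_rfl))⟩

end Geometry

section Polytope

/-- Carathéodory's theorem for conic combinations. -/
theorem exists_linearIndepOn_conic_combination {V : Type*} [AddCommGroup V] [Module ℝ V]
    (A : Finset V) (c : V → ℝ) (hc : ∀ v ∈ A, 0 ≤ c v) :
    ∃ B ⊆ A, LinearIndepOn ℝ id (B : Set V) ∧ ∃ e : V → ℝ, (∀ v ∈ B, 0 ≤ e v) ∧
      ∑ v ∈ B, e v • v = ∑ v ∈ A, c v • v := by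
  classical
  induction A using Finset.strongInduction generalizing c with
  | H A ih =>
  by_cases hA : LinearIndepOn ℝ id (A : Set V)
  · exact ⟨A, subset_rfl, hA, c, hc, rfl⟩
  obtain ⟨g, hg, i, hiA, hi⟩ : ∃ g : V → ℝ, ∑ v ∈ A, g v • v = 0 ∧ ∃ v ∈ A, 0 < g v := by
    rw [linearIndepOn_finset_iff] at hA
    push Not at hA
    obtain ⟨g, hg, i, hi, hgi⟩ := hA
    rcases hgi.lt_or_gt with h | h
    · refine ⟨-g, ?_, i, hi, by simpa using h⟩
      simpa using hg
    · exact ⟨g, hg, i, hi, h⟩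
  obtain ⟨j, hj, hmin⟩ := (A.filter fun v => 0 < g v).exists_min_image (fun v => c v / g v)
    ⟨i, Finset.mem_filter.2 ⟨hiA, hi⟩⟩
  rw [Finset.mem_filter] at hj
  have hk : ∀ v ∈ A, 0 ≤ c v - c j / g j * g v := by
    intro v hv
    rw [sub_nonneg]
    by_cases hgv : 0 < g v
    · rw [← le_div_iff₀ hgv]
      exact hmin v (Finset.mem_filter.2 ⟨hv, hgv⟩)
    · exact (mul_nonpos_of_nonneg_of_nonpos (div_nonneg (hc j hj.1) hj.2.le)
        (not_lt.1 hgv)).trans (hc v hv)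
  obtain ⟨B, hB, hli, e, he, hsum⟩ := ih (A.erase j) (Finset.erase_ssubset hj.1)
    (fun v => c v - c j / g j * g v) fun v hv => hk v (Finset.mem_of_mem_erase hv)
  refine ⟨B, hB.trans (A.erase_subset j), hli, e, he, hsum.trans ?_⟩
  rw [Finset.sum_erase]
  · simp only [sub_smul, mul_smul, Finset.sum_sub_distrib, ← Finset.smul_sum, hg, smul_zero,
      sub_zero]
  · rw [div_mul_cancel₀ _ hj.2.ne', sub_self, zero_smul]

theorem LinearIndepOn.exists_sum_le_mul_norm {V : Type*} [NormedAddCommGroup V] [NormedSpace ℝ V]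
    {B : Finset V} (hB : LinearIndepOn ℝ id (B : Set V)) :
    ∃ C : ℝ, 0 ≤ C ∧ ∀ e : V → ℝ, ∑ v ∈ B, e v ≤ C * ‖∑ v ∈ B, e v • v‖ := by
  have hker : LinearMap.ker (Fintype.linearCombination ℝ (fun v : B => (v : V))) = ⊥ := by
    rw [LinearMap.ker_eq_bot]
    exact linearIndependent_iff_injective_fintypeLinearCombination.1 hB
  obtain ⟨K, -, hK⟩ := LinearMap.exists_antilipschitzWith _ hker
  refine ⟨B.card * K, by positivity, fun e => ?_⟩
  have h1 := hK.le_mul_dist (fun v : B => e v) 0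
  rw [map_zero, dist_zero_right, dist_zero_right, Fintype.linearCombination_apply,
    Finset.sum_coe_sort B (fun v => e v • v)] at h1
  have h2 : ∀ v ∈ B, e v ≤ K * ‖∑ v ∈ B, e v • v‖ := fun v hv =>
    (Real.le_norm_self _).trans ((norm_le_pi_norm (fun v : B => e v) ⟨v, hv⟩).trans h1)
  have h3 := Finset.sum_le_card_nsmul B e _ h2
  rwa [nsmul_eq_mul, ← mul_assoc] at h3

/-- Near a point `w`, a polytope agrees with its tangent cone at `w`. -/
theorem exists_radius_dilation_mem_convexHull {V : Type*} [NormedAddCommGroup V]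
    [NormedSpace ℝ V] (A : Finset V) {w : V} (hw : w ∈ convexHull ℝ (A : Set V)) :
    ∃ r : ℝ, 0 < r ∧ ∀ x : V, w + x ∈ convexHull ℝ (A : Set V) → ∀ c : ℝ, 0 ≤ c → c * ‖x‖ ≤ r →
      w + c • x ∈ convexHull ℝ (A : Set V) := by
  classical
  let A' := A.image fun v => v - w
  have hfin : ∀ B : Finset V, ∃ C : ℝ, 0 ≤ C ∧ (LinearIndepOn ℝ id (B : Set V) →
      ∀ e : V → ℝ, ∑ v ∈ B, e v ≤ C * ‖∑ v ∈ B, e v • v‖) := by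
    intro B
    by_cases h : LinearIndepOn ℝ id (B : Set V)
    · obtain ⟨C, hC, h'⟩ := h.exists_sum_le_mul_norm
      exact ⟨C, hC, fun _ => h'⟩
    · exact ⟨0, le_rfl, fun h' => (h h').elim⟩
  choose C hC0 hC using hfin
  let M := ∑ B ∈ A'.powerset, C B
  have hM : 0 ≤ M := Finset.sum_nonneg fun B _ => hC0 B
  refine ⟨(M + 1)⁻¹, by positivity, fun x hx c hc hcx => ?_⟩
  obtain ⟨f, hf0, hf1, hfx⟩ := Finset.mem_convexHull'.1 hx
  have hx' : ∑ v ∈ A', f (v + w) • v = x := by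
    rw [Finset.sum_image (by simp)]
    simp only [sub_add_cancel, smul_sub, Finset.sum_sub_distrib, hfx, ← Finset.sum_smul, hf1]
    simp
  obtain ⟨B, hB, hli, e, he, hsum⟩ := exists_linearIndepOn_conic_combination A'
    (fun v => f (v + w)) (by
      intro v hv
      obtain ⟨u, hu, rfl⟩ := Finset.mem_image.1 hv
      simpa using hf0 u hu)
  rw [hx'] at hsum
  have hCM : C B ≤ M := Finset.single_le_sum (f := C) (fun B _ => hC0 B) (Finset.mem_powerset.2 hB)
  have hle : c * ∑ v ∈ B, e v ≤ 1 := by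
    have h1 := hC B hli e
    rw [hsum] at h1
    calc c * ∑ v ∈ B, e v ≤ c * (M * ‖x‖) := by gcongr; exact h1.trans (by gcongr)
      _ = M * (c * ‖x‖) := by ring
      _ ≤ M * (M + 1)⁻¹ := by gcongr
      _ ≤ 1 := by rw [← div_eq_mul_inv]; exact div_le_one_of_le₀ (by linarith) (by positivity)
  have key : w + c • x = (1 - ∑ v ∈ B, c * e v) • w + ∑ v ∈ B, (c * e v) • (v + w) := by
    simp only [smul_add, Finset.sum_add_distrib, ← Finset.sum_smul, mul_smul, ← Finset.smul_sum,
      hsum, sub_smul, one_smul, ← Finset.mul_sum]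
    abel
  rw [key]
  rw [Finset.mul_sum] at hle
  have hconv := convex_convexHull ℝ (A : Set V)
  have hmem := hconv.sum_mem (t := insert none (B.image some))
    (w := fun o : Option V => o.elim (1 - ∑ v ∈ B, c * e v) fun v => c * e v)
    (z := fun o : Option V => o.elim w fun v => v + w) ?_ ?_ ?_
  · rw [Finset.sum_insert (by simp), Finset.sum_image (by simp)] at hmem
    simpa using hmem
  · intro o ho
    rcases Finset.mem_insert.1 ho with rfl | ho
    · simpa using hle
    · obtain ⟨v, hv, rfl⟩ := Finset.mem_image.1 ho
      exact mul_nonneg hc (he v hv)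
  · rw [Finset.sum_insert (by simp), Finset.sum_image (by simp)]
    simp
  · intro o ho
    rcases Finset.mem_insert.1 ho with rfl | ho
    · exact hw
    · obtain ⟨v, hv, rfl⟩ := Finset.mem_image.1 ho
      obtain ⟨u, hu, rfl⟩ := Finset.mem_image.1 (hB hv)
      simpa using subset_convexHull ℝ _ hu

/-- Boundary points sufficiently close to a boundary point `w` see `w` along the boundary. -/
theorem Convex.segment_subset_frontier {V : Type*} [NormedAddCommGroup V] [NormedSpace ℝ V]
    {K : Set V} (hK : Convex ℝ K) (hcl : IsClosed K) {w x : V} (hw : w ∈ K)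
    (hx : w + x ∈ frontier K) (h2 : w + (2 : ℝ) • x ∈ K) :
    segment ℝ w (w + x) ⊆ frontier K := by
  intro z hz
  have hxK := hcl.frontier_subset hx
  refine ⟨subset_closure (hK.segment_subset hw hxK hz), fun hi => ?_⟩
  obtain ⟨a, b, ha, hb, hab, rfl⟩ := hz
  apply hx.2
  have hpos : 0 < 2 - b := by linarith
  have key : w + x = (1 / (2 - b)) • (a • w + b • (w + x)) +
      ((1 - b) / (2 - b)) • (w + (2 : ℝ) • x) := by
    have e : a = 1 - b := by linarith
    subst e
    match_scalars <;> field_simp <;> ring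
  rw [key]
  refine hK.combo_interior_self_mem_interior hi h2 (by positivity)
    (div_nonneg (by linarith) hpos.le) ?_
  field_simp
  ring

end Polytope

section Shortcut

variable {E : Type*} [NormedAddCommGroup E] [InnerProductSpace ℝ E]

theorem norm_sub_smul_le {u x : E} {ρ t : ℝ} (hρ : 0 < ρ) (hu : ‖u‖ = ρ) :
    ‖u - t • x‖ ≤ ρ - t * ⟪u, x⟫ / ρ + t ^ 2 * ‖x‖ ^ 2 / (2 * ρ) := by
  have h1 : ‖u - t • x‖ ^ 2 = ρ ^ 2 - 2 * (t * ⟪u, x⟫) + t ^ 2 * ‖x‖ ^ 2 := by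
    rw [norm_sub_sq_real, hu, inner_smul_right, norm_smul, mul_pow, Real.norm_eq_abs, sq_abs]
  have h2 : 2 * ρ * ‖u - t • x‖ ≤ ρ ^ 2 + ‖u - t • x‖ ^ 2 := by
    nlinarith [sq_nonneg (ρ - ‖u - t • x‖)]
  have h3 : ρ - t * ⟪u, x⟫ / ρ + t ^ 2 * ‖x‖ ^ 2 / (2 * ρ) =
      (ρ ^ 2 + (ρ ^ 2 - 2 * (t * ⟪u, x⟫) + t ^ 2 * ‖x‖ ^ 2)) / (2 * ρ) := by
    field_simp
    ring
  rw [h3, le_div_iff₀ (by positivity), ← h1]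
  linarith

/-- First variation: a broken path through the origin is shortened by a small displacement which
decreases its length to first order. -/
theorem exists_small_displacement_shorter {u v x y : E} {ρ D t₀ : ℝ} (hρ : 0 < ρ) (hu : ‖u‖ = ρ)
    (hv : ‖v‖ = ρ) (ht₀ : 0 < t₀) (h : ρ * D < ⟪u, x⟫ + ⟪v, y⟫) :
    ∃ t : ℝ, 0 < t ∧ t ≤ t₀ ∧ ‖u - t • x‖ + t * D + ‖v - t • y‖ < 2 * ρ := by
  set M := ‖x‖ ^ 2 + ‖y‖ ^ 2 + 1 with hM
  have hM0 : 0 < M := by positivity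
  set C := ⟪u, x⟫ + ⟪v, y⟫ - ρ * D with hC
  have hC0 : 0 < C := by linarith
  refine ⟨min t₀ (C / M), lt_min ht₀ (by positivity), min_le_left _ _, ?_⟩
  set t := min t₀ (C / M) with ht
  have ht0 : 0 < t := lt_min ht₀ (by positivity)
  have htM : t * M ≤ C := (le_div_iff₀ hM0).1 (min_le_right _ _)
  have h1 := norm_sub_smul_le (x := x) (t := t) hρ hu
  have h2 := norm_sub_smul_le (x := y) (t := t) hρ hv
  have h3 : (ρ - t * ⟪u, x⟫ / ρ + t ^ 2 * ‖x‖ ^ 2 / (2 * ρ)) + t * D +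
      (ρ - t * ⟪v, y⟫ / ρ + t ^ 2 * ‖y‖ ^ 2 / (2 * ρ)) =
      2 * ρ - t * (2 * C - t * (M - 1)) / (2 * ρ) := by
    rw [hC, hM]
    field_simp
    ring
  have h4 : 0 < t * (2 * C - t * (M - 1)) / (2 * ρ) := by
    apply div_pos (mul_pos ht0 _) (by positivity)
    nlinarith
  linarith

theorem norm_sub_lt_two_mul {u v : E} {ρ : ℝ} (hρ : 0 < ρ) (hu : ‖u‖ = ρ) (hv : ‖v‖ = ρ)
    (huv : u + v ≠ 0) : ‖u - v‖ < 2 * ρ := by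
  have h1 := parallelogram_law_with_norm ℝ u v
  rw [hu, hv] at h1
  have h2 : 0 < ‖u + v‖ := norm_pos_iff.2 huv
  nlinarith [norm_nonneg (u - v)]

variable [FiniteDimensional ℝ E]

theorem Convex.exists_normal_of_segment_subset_frontier {K : Set E} (hK : Convex ℝ K)
    (hcl : IsClosed K) (hint : (interior K).Nonempty) {w u : E}
    (h : segment ℝ w (w + u) ⊆ frontier K) :
    ∃ n : E, ⟪n, u⟫ = 0 ∧ ∀ y ∈ interior K, ⟪n, y⟫ < ⟪n, w⟫ := by
  have hmid : w + (1 / 2 : ℝ) • u ∈ segment ℝ w (w + u) :=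
    ⟨1 / 2, 1 / 2, by norm_num, by norm_num, by norm_num, by module⟩
  obtain ⟨n, -, hn, hn'⟩ := hK.exists_supporting_normal hint (h hmid).2
  have h1 := hn _ (hcl.frontier_subset (h (left_mem_segment ℝ _ _)))
  have h2 := hn _ (hcl.frontier_subset (h (right_mem_segment ℝ _ _)))
  simp only [inner_add_right, inner_smul_right] at h1 h2
  have h0 : ⟪n, u⟫ = 0 := by linarith
  refine ⟨n, h0, fun y hy => ?_⟩
  simpa [inner_add_right, inner_smul_right, h0] using hn' y hy

/-- Given two normals at a point `w` of a face of codimension at least three, there is a direction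
orthogonal to both and, if orthogonal to `s`, pointing out of `K`. -/
theorem IsFace.exists_orthogonal_direction {K F : Set E} (hF : IsFace K F) {w : E} (hw : w ∈ F)
    (hdim : faceDim F + 3 ≤ Module.finrank ℝ E) (n m s : E) :
    ∃ x : E, ⟪n, x⟫ = 0 ∧ ⟪m, x⟫ = 0 ∧
      (0 < ⟪s, x⟫ ∨ ⟪s, x⟫ = 0 ∧ ∀ ε : ℝ, 0 < ε → w + ε • x ∉ K) := by
  classical
  obtain ⟨x, hx, hxF⟩ : ∃ x ∈ (Submodule.span ℝ {n, m})ᗮ, x ∉ (affineSpan ℝ F).direction := by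
    by_contra! hle
    have h1 := Submodule.finrank_mono (R := ℝ) (M := E)
      (show (Submodule.span ℝ {n, m})ᗮ ≤ (affineSpan ℝ F).direction from hle)
    have h2 := Submodule.finrank_add_finrank_orthogonal (Submodule.span ℝ {n, m})
    have h3 : Module.finrank ℝ (Submodule.span ℝ ({n, m} : Set E)) ≤ 2 := by
      have := (finrank_span_finset_le_card (R := ℝ) ({n, m} : Finset E)).trans Finset.card_le_two
      rwa [Set.finrank, Finset.coe_pair] at this
    rw [faceDim] at hdim
    omega
  have hnx : ⟪n, x⟫ = 0 := hx n (Submodule.subset_span (by simp))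
  have hmx : ⟪m, x⟫ = 0 := hx m (Submodule.subset_span (by simp))
  rcases lt_trichotomy ⟪s, x⟫ 0 with h | h | h
  · exact ⟨-x, by simp [hnx], by simp [hmx], Or.inl (by simpa using h)⟩
  · by_cases h1 : ∀ ε : ℝ, 0 < ε → w + ε • x ∉ K
    · exact ⟨x, hnx, hmx, Or.inr ⟨h, h1⟩⟩
    · refine ⟨-x, by simp [hnx], by simp [hmx], Or.inr ⟨by simp [h], fun ε hε hεK => ?_⟩⟩
      push Not at h1
      obtain ⟨δ, hδ, hδK⟩ := h1
      have hseg : w ∈ openSegment ℝ (w + δ • x) (w + ε • -x) := by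
        refine ⟨ε / (δ + ε), δ / (δ + ε), by positivity, by positivity, by field_simp; ring, ?_⟩
        match_scalars <;> field_simp <;> ring
      have hmem := hF.2.2.left_mem_of_mem_openSegment hδK hεK hw hseg
      have hdir := AffineSubspace.vsub_mem_direction (subset_affineSpan ℝ F hmem)
        (subset_affineSpan ℝ F hw)
      rw [vsub_eq_sub, add_sub_cancel_left] at hdir
      exact hxF ((Submodule.smul_mem_iff _ hδ.ne').1 hdir)
  · exact ⟨x, hnx, hmx, Or.inl h⟩

/-- A path in the boundary of a polytope which bends at a point of a face of codimension at least
three can be shortened outside the interior. -/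
theorem exists_joinedWithin_lt {A : Finset E} {K F : Set E} (hKA : K = convexHull ℝ (A : Set E))
    (hint : (interior K).Nonempty) (hF : IsFace K F) (hdim : faceDim F + 3 ≤ Module.finrank ℝ E)
    {w u v : E} (hw : w ∈ F) {r ρ : ℝ} (hr : 0 < r)
    (hdil : ∀ x : E, w + x ∈ K → ∀ c : ℝ, 0 ≤ c → c * ‖x‖ ≤ r → w + c • x ∈ K)
    (hρ : 0 < ρ) (hρr : 2 * ρ ≤ r) (hu : ‖u‖ = ρ) (hv : ‖v‖ = ρ) (huv : u + v ≠ 0)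
    (hwu : w + u ∈ frontier K) (hwv : w + v ∈ frontier K) :
    ∃ L < ENNReal.ofReal (2 * ρ), JoinedWithin (interior K)ᶜ (w + u) (w + v) L := by
  have hK : Convex ℝ K := hKA ▸ convex_convexHull ℝ _
  have hcl : IsClosed K := hKA ▸ A.finite_toSet.isClosed_convexHull ℝ
  have hwK : w ∈ K := hF.2.2.subset hw
  obtain ⟨n, hnu, hn⟩ := hK.exists_normal_of_segment_subset_frontier hcl hint
    (hK.segment_subset_frontier hcl hwK hwu
      (hdil u (hcl.frontier_subset hwu) 2 zero_le_two (by rwa [hu])))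
  obtain ⟨m, hmv, hm⟩ := hK.exists_normal_of_segment_subset_frontier hcl hint
    (hK.segment_subset_frontier hcl hwK hwv
      (hdil v (hcl.frontier_subset hwv) 2 zero_le_two (by rwa [hv])))
  suffices h : ∃ (x : E) (δ t₀ : ℝ), 0 ≤ δ ∧ 0 < t₀ ∧ ⟪n, x⟫ = 0 ∧ ⟪m, x⟫ = 0 ∧
      ρ * (δ * ‖u - v‖) < ⟪u, x + δ • u⟫ + ⟪v, x + δ • v⟫ ∧
      ∀ t, 0 < t → t ≤ t₀ →
        segment ℝ (w + t • (x + δ • u)) (w + t • (x + δ • v)) ⊆ (interior K)ᶜ by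
    obtain ⟨x, δ, t₀, hδ, ht₀, hnx, hmx, hlt, hseg⟩ := h
    obtain ⟨t, ht, htt, hlen⟩ := exists_small_displacement_shorter hρ hu hv ht₀ hlt
    refine ⟨_, ?_, ((JoinedWithin.of_segment (segment_subset_of_supporting hn ?_ ?_)).trans
      (JoinedWithin.of_segment (hseg t ht htt))).trans
      (JoinedWithin.of_segment (segment_subset_of_supporting hm ?_ ?_))⟩
    · have e1 : w + u - (w + t • (x + δ • u)) = u - t • (x + δ • u) := by abel
      have e2 : w + t • (x + δ • u) - (w + t • (x + δ • v)) = (t * δ) • (u - v) := by module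
      have e3 : w + t • (x + δ • v) - (w + v) = -(v - t • (x + δ • v)) := by abel
      rw [edist_dist, edist_dist, edist_dist, dist_eq_norm, dist_eq_norm, dist_eq_norm, e1, e2, e3,
        norm_neg, ← ENNReal.ofReal_add (by positivity) (by positivity),
        ← ENNReal.ofReal_add (by positivity) (by positivity),
        ENNReal.ofReal_lt_ofReal_iff (by positivity), norm_smul, Real.norm_eq_abs,
        abs_of_nonneg (by positivity), mul_assoc]
      exact hlen
    · simp [inner_add_right, hnu]
    · simp [inner_add_right, inner_smul_right, hnu, hnx]
    · simp [inner_add_right, inner_smul_right, hmv, hmx]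
    · simp [inner_add_right, hmv]
  obtain ⟨x, hnx, hmx, h | ⟨h, hout⟩⟩ := hF.exists_orthogonal_direction hw hdim n m (u + v)
  · refine ⟨x, 0, 1, le_rfl, one_pos, hnx, hmx, ?_, fun t ht _ => ?_⟩
    · rw [inner_add_left] at h
      simpa using h
    · refine segment_subset_of_supporting hn ?_ ?_ <;>
        simp [inner_add_right, inner_smul_right, hnx]
  · obtain ⟨t₀, ht₀, ht₀r⟩ : ∃ t₀ : ℝ, 0 < t₀ ∧ t₀ * ‖x‖ ≤ r / 2 := by
      refine ⟨r / 2 / (‖x‖ + 1), by positivity, ?_⟩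
      rw [div_mul_eq_mul_div, div_le_iff₀ (by positivity)]
      nlinarith [norm_nonneg x]
    obtain ⟨η, hη, hball⟩ := Metric.isOpen_iff.1 hcl.isOpen_compl _ (hout t₀ ht₀)
    obtain ⟨δ, hδ, hδη, hδr⟩ : ∃ δ : ℝ, 0 < δ ∧ t₀ * δ * ρ < η ∧ t₀ * δ * ρ ≤ r / 2 := by
      have hpos : 0 < min (η / 2) (r / 2) := by positivity
      refine ⟨min (η / 2) (r / 2) / (t₀ * ρ), by positivity, ?_, ?_⟩
      · have e : t₀ * (min (η / 2) (r / 2) / (t₀ * ρ)) * ρ = min (η / 2) (r / 2) := by field_simp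
        rw [e]
        exact (min_le_left _ _).trans_lt (by linarith)
      · have e : t₀ * (min (η / 2) (r / 2) / (t₀ * ρ)) * ρ = min (η / 2) (r / 2) := by field_simp
        rw [e]
        exact min_le_right _ _
    refine ⟨x, δ, t₀, hδ.le, ht₀, hnx, hmx, ?_, fun t ht htt z hz hzi => ?_⟩
    · have h1 := norm_sub_lt_two_mul hρ hu hv huv
      rw [inner_add_left] at h
      rw [inner_add_right, inner_add_right, inner_smul_right, inner_smul_right,
        real_inner_self_eq_norm_sq, real_inner_self_eq_norm_sq, hu, hv]
      have h2 := mul_lt_mul_of_pos_left h1 (mul_pos hρ hδ)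
      nlinarith
    · obtain ⟨α, β, hα, hβ, hαβ, rfl⟩ := hz
      set y := α • u + β • v with hy
      have hyρ : ‖y‖ ≤ ρ := by
        refine (norm_add_le _ _).trans ?_
        rw [norm_smul, norm_smul, hu, hv, Real.norm_of_nonneg hα, Real.norm_of_nonneg hβ,
          ← add_mul, hαβ, one_mul]
      have e : α • (w + t • (x + δ • u)) + β • (w + t • (x + δ • v)) = w + t • (x + δ • y) := by
        have : α = 1 - β := by linarith
        rw [hy, this]
        module
      rw [e] at hzi
      have hsm : ‖(t₀ * δ) • y‖ ≤ t₀ * δ * ρ := by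
        rw [norm_smul, Real.norm_of_nonneg (by positivity)]
        gcongr
      have e2 : (t₀ / t) • t • (x + δ • y) = t₀ • x + (t₀ * δ) • y := by
        rw [smul_smul, div_mul_cancel₀ _ ht.ne', smul_add, smul_smul]
      have hmem := hdil _ (interior_subset hzi) (t₀ / t) (by positivity) (by
        rw [← Real.norm_of_nonneg (show 0 ≤ t₀ / t by positivity), ← norm_smul, e2]
        refine (norm_add_le _ _).trans ?_
        rw [norm_smul, Real.norm_of_nonneg ht₀.le]
        linarith)
      rw [e2] at hmem
      refine hball ?_ hmem
      rw [Metric.mem_ball, dist_eq_norm]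
      have e3 : w + (t₀ • x + (t₀ * δ) • y) - (w + t₀ • x) = (t₀ * δ) • y := by abel
      rw [e3]
      exact hsm.trans_lt hδη

end Shortcut

section Faces

variable {E : Type*} [NormedAddCommGroup E] [InnerProductSpace ℝ E]

/-- The points of `K` lying on the hyperplane through `a` with normal `n`. -/
def exposedSlice (K : Set E) (a n : E) : Set E :=
  {y ∈ K | ⟪n, y⟫ = ⟪n, a⟫}

theorem isFace_exposedSlice {K : Set E} (hK : Convex ℝ K) {a n : E} (ha : a ∈ K)
    (hn : ∀ y ∈ K, ⟪n, y⟫ ≤ ⟪n, a⟫) : IsFace K (exposedSlice K a n) := by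
  refine ⟨⟨a, ha, rfl⟩, ?_, fun y hy => hy.1, ?_⟩
  · exact hK.inter (convex_hyperplane (innerₛₗ ℝ n).isLinear ⟪n, a⟫)
  · rintro x hx y hy z ⟨-, hz⟩ ⟨α, β, hα, hβ, hαβ, rfl⟩
    refine ⟨hx, le_antisymm (hn x hx) ?_⟩
    rw [inner_add_right, inner_smul_right, inner_smul_right] at hz
    have h1 := hn y hy
    have h2 : α * ⟪n, a⟫ + β * ⟪n, a⟫ = ⟪n, a⟫ := by rw [← add_mul, hαβ, one_mul]
    have h3 : α * ⟪n, a⟫ ≤ α * ⟪n, x⟫ := by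
      have := mul_le_mul_of_nonneg_left h1 hβ.le
      linarith
    exact le_of_mul_le_mul_left h3 hα

theorem direction_exposedSlice_le {K : Set E} {a n : E} :
    (affineSpan ℝ (exposedSlice K a n)).direction ≤ (ℝ ∙ n)ᗮ := by
  rw [direction_affineSpan, vectorSpan_def, Submodule.span_le]
  rintro _ ⟨y, ⟨-, hy⟩, z, ⟨-, hz⟩, rfl⟩
  rw [SetLike.mem_coe, Submodule.mem_orthogonal_singleton_iff_inner_right]
  simp [inner_sub_right, hy, hz]

theorem IsFace.notMem_interior {K F : Set E} (hF : IsFace K F)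
    (hdim : faceDim F < Module.finrank ℝ E) {x : E} (hx : x ∈ F) : x ∉ interior K := by
  intro hi
  have hKF : K ⊆ F := by
    intro y hy
    have hev : ∀ᶠ t in nhdsWithin (0 : ℝ) (Set.Ioi 0), x + t • (x - y) ∈ interior K := by
      have hc : Continuous fun t : ℝ => x + t • (x - y) := by fun_prop
      refine (hc.continuousAt.eventually_mem ?_).filter_mono nhdsWithin_le_nhds
      simpa using isOpen_interior.mem_nhds hi
    obtain ⟨t, ht, ht0 : 0 < t⟩ := (hev.and self_mem_nhdsWithin).exists
    refine hF.2.2.left_mem_of_mem_openSegment hy (interior_subset ht) hx ?_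
    refine ⟨t / (1 + t), 1 / (1 + t), by positivity, by positivity, by field_simp; ring, ?_⟩
    match_scalars <;> field_simp; ring
  have htop : affineSpan ℝ F = ⊤ := by
    have h1 := isOpen_interior.affineSpan_eq_top ⟨x, hi⟩
    rw [eq_top_iff, ← h1]
    exact affineSpan_mono ℝ (interior_subset.trans hKF)
  rw [faceDim, htop, AffineSubspace.direction_top, finrank_top] at hdim
  exact lt_irrefl _ hdim

variable [FiniteDimensional ℝ E]

theorem faceDim_exposedSlice_lt {K : Set E} {a n : E} (hn : n ≠ 0) :
    faceDim (exposedSlice K a n) + 1 ≤ Module.finrank ℝ E := by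
  have h1 := Submodule.finrank_mono (direction_exposedSlice_le (K := K) (a := a) (n := n))
  have h2 := Submodule.finrank_add_finrank_orthogonal (ℝ ∙ n)
  rw [finrank_span_singleton hn] at h2
  rw [faceDim]
  omega

/-- An exposed face of a polytope of codimension at least two lies in a larger exposed face,
obtained by rotating the supporting hyperplane. -/
theorem exists_exposedSlice_faceDim_lt {A : Finset E} {K : Set E}
    (hKA : K = convexHull ℝ (A : Set E)) (hint : (interior K).Nonempty) {a b n : E} (ha : a ∈ K)
    (hb : b ∈ K) (hn : ∀ y ∈ K, ⟪n, y⟫ ≤ ⟪n, a⟫) (hnb : ⟪n, b⟫ = ⟪n, a⟫)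
    (hdim : faceDim (exposedSlice K a n) + 1 < Module.finrank ℝ E) :
    ∃ n' : E, n' ≠ 0 ∧ (∀ y ∈ K, ⟪n', y⟫ ≤ ⟪n', a⟫) ∧ ⟪n', b⟫ = ⟪n', a⟫ ∧
      faceDim (exposedSlice K a n) < faceDim (exposedSlice K a n') := by
  set D := (affineSpan ℝ (exposedSlice K a n)).direction with hD
  obtain ⟨m₀, hm₀D, hm₀⟩ : ∃ m ∈ Dᗮ, m ∉ (ℝ ∙ n) := by
    by_contra! hle
    have h1 := Submodule.finrank_mono (show Dᗮ ≤ (ℝ ∙ n) from hle)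
    have h2 := Submodule.finrank_add_finrank_orthogonal D
    have h3 : Module.finrank ℝ (ℝ ∙ n) ≤ 1 := (finrank_span_le_card {n}).trans (by simp)
    rw [faceDim, ← hD] at hdim
    omega
  have hne : ∃ v ∈ A, ⟪m₀, v⟫ ≠ ⟪m₀, a⟫ := by
    by_contra! hall
    have hsub : K ⊆ {y | ⟪m₀, y⟫ = ⟪m₀, a⟫} := by
      rw [hKA]
      exact convexHull_min hall (convex_hyperplane (innerₛₗ ℝ m₀).isLinear _)
    obtain ⟨p, hp⟩ := hint
    have hev : ∀ᶠ t in nhdsWithin (0 : ℝ) (Set.Ioi 0), p + t • m₀ ∈ interior K := by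
      have hc : Continuous fun t : ℝ => p + t • m₀ := by fun_prop
      refine (hc.continuousAt.eventually_mem ?_).filter_mono nhdsWithin_le_nhds
      simpa using isOpen_interior.mem_nhds hp
    obtain ⟨t, ht, ht0⟩ := (hev.and self_mem_nhdsWithin).exists
    have h1 : ⟪m₀, p + t • m₀⟫ = ⟪m₀, a⟫ := hsub (interior_subset ht)
    have h2 : ⟪m₀, p⟫ = ⟪m₀, a⟫ := hsub (interior_subset hp)
    rw [inner_add_right, h2, inner_smul_right, add_eq_left] at h1
    rcases mul_eq_zero.1 h1 with h | h
    · exact (ne_of_gt ht0) h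
    · exact hm₀ (by rw [inner_self_eq_zero.1 h]; exact Submodule.zero_mem _)
  obtain ⟨m, hmD, hmn, v₁, hv₁, hlt₁⟩ :
      ∃ m ∈ Dᗮ, m ∉ (ℝ ∙ n) ∧ ∃ v ∈ A, ⟪m, a⟫ < ⟪m, v⟫ := by
    obtain ⟨v, hv, hne⟩ := hne
    rcases hne.lt_or_gt with h | h
    · exact ⟨-m₀, neg_mem hm₀D, by rwa [neg_mem_iff], v, hv, by simpa using h⟩
    · exact ⟨m₀, hm₀D, hm₀, v, hv, h⟩
  have hAK : ∀ v ∈ A, v ∈ K := fun v hv => hKA ▸ subset_convexHull ℝ _ hv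
  have hmF : ∀ y ∈ exposedSlice K a n, ⟪m, y⟫ = ⟪m, a⟫ := by
    intro y hy
    have h1 : y - a ∈ D :=
      AffineSubspace.vsub_mem_direction (subset_affineSpan ℝ _ hy) (subset_affineSpan ℝ _ ⟨ha, rfl⟩)
    have h2 := Submodule.inner_left_of_mem_orthogonal h1 hmD
    rwa [inner_sub_right, sub_eq_zero] at h2
  have hnA : ∀ v ∈ A, ⟪m, a⟫ < ⟪m, v⟫ → ⟪n, v⟫ < ⟪n, a⟫ := fun v hv h =>
    lt_of_le_of_ne (hn v (hAK v hv)) fun h' => h.ne' (hmF v ⟨hAK v hv, h'⟩)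
  obtain ⟨v₀, hv₀, hmin⟩ := (A.filter fun v => ⟪m, a⟫ < ⟪m, v⟫).exists_min_image
    (fun v => (⟪n, a⟫ - ⟪n, v⟫) / (⟪m, v⟫ - ⟪m, a⟫)) ⟨v₁, Finset.mem_filter.2 ⟨hv₁, hlt₁⟩⟩
  rw [Finset.mem_filter] at hv₀
  set s := (⟪n, a⟫ - ⟪n, v₀⟫) / (⟪m, v₀⟫ - ⟪m, a⟫) with hs
  have hv₀n := hnA v₀ hv₀.1 hv₀.2
  have hs0 : 0 < s := div_pos (sub_pos.2 hv₀n) (sub_pos.2 hv₀.2)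
  have hin : ∀ y, ⟪n + s • m, y⟫ = ⟪n, y⟫ + s * ⟪m, y⟫ := fun y => by
    rw [inner_add_left, real_inner_smul_left]
  have hn'A : ∀ v ∈ A, ⟪n + s • m, v⟫ ≤ ⟪n + s • m, a⟫ := by
    intro v hv
    rw [hin, hin]
    by_cases h : ⟪m, a⟫ < ⟪m, v⟫
    · have h1 := hmin v (Finset.mem_filter.2 ⟨hv, h⟩)
      rw [le_div_iff₀ (sub_pos.2 h)] at h1
      linarith
    · have h1 := hn v (hAK v hv)
      have h2 := mul_le_mul_of_nonneg_left (not_lt.1 h) hs0.le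
      linarith
  have hn'K : ∀ y ∈ K, ⟪n + s • m, y⟫ ≤ ⟪n + s • m, a⟫ := by
    have hsub : K ⊆ {y | ⟪n + s • m, y⟫ ≤ ⟪n + s • m, a⟫} := by
      rw [hKA]
      exact convexHull_min hn'A (convex_halfSpace_le (innerₛₗ ℝ (n + s • m)).isLinear _)
    exact hsub
  have hv₀F : v₀ ∈ exposedSlice K a (n + s • m) := by
    refine ⟨hAK v₀ hv₀.1, ?_⟩
    rw [hin, hin]
    have h1 : s * (⟪m, v₀⟫ - ⟪m, a⟫) = ⟪n, a⟫ - ⟪n, v₀⟫ :=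
      div_mul_cancel₀ _ (sub_pos.2 hv₀.2).ne'
    linarith
  refine ⟨n + s • m, ?_, hn'K, ?_, Submodule.finrank_lt_finrank_of_lt (lt_of_le_of_ne ?_ ?_)⟩
  · intro h0
    apply hmn
    rw [← Submodule.smul_mem_iff _ hs0.ne', eq_neg_of_add_eq_zero_right h0]
    exact neg_mem (Submodule.mem_span_singleton_self n)
  · rw [hin, hin, hnb, hmF b ⟨hb, hnb⟩]
  · refine AffineSubspace.direction_le (affineSpan_mono ℝ fun y hy => ⟨hy.1, ?_⟩)
    rw [hin, hin, hmF y hy, hy.2]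
  · intro heq
    have h1 : v₀ - a ∈ (affineSpan ℝ (exposedSlice K a (n + s • m))).direction :=
      AffineSubspace.vsub_mem_direction (subset_affineSpan ℝ _ hv₀F)
        (subset_affineSpan ℝ _ ⟨ha, rfl⟩)
    rw [← heq] at h1
    have h2 := Submodule.mem_orthogonal_singleton_iff_inner_right.1 (direction_exposedSlice_le h1)
    rw [inner_sub_right] at h2
    linarith

theorem exists_facet_of_supporting {A : Finset E} {K : Set E}
    (hKA : K = convexHull ℝ (A : Set E)) (hint : (interior K).Nonempty) {a b : E} (ha : a ∈ K)
    (hb : b ∈ K) (n : E) (hn0 : n ≠ 0) (hn : ∀ y ∈ K, ⟪n, y⟫ ≤ ⟪n, a⟫)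
    (hnb : ⟪n, b⟫ = ⟪n, a⟫) :
    ∃ G, IsFace K G ∧ faceDim G + 1 = Module.finrank ℝ E ∧ a ∈ G ∧ b ∈ G := by
  induction hk : Module.finrank ℝ E - faceDim (exposedSlice K a n) using Nat.strong_induction_on
    generalizing n with
  | h k ih =>
  have hK : Convex ℝ K := hKA ▸ convex_convexHull ℝ _
  rcases (faceDim_exposedSlice_lt (K := K) (a := a) hn0).eq_or_lt with h | h
  · exact ⟨_, isFace_exposedSlice hK ha hn, h, ⟨ha, rfl⟩, ⟨hb, hnb⟩⟩
  · obtain ⟨n', h1, h2, h3, h4⟩ := exists_exposedSlice_faceDim_lt hKA hint ha hb hn hnb h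
    exact ih _ (by omega) n' h1 h2 h3 rfl

/-- Two points of a proper face of a polytope lie in a common facet. -/
theorem IsFace.exists_facet {A : Finset E} {K F : Set E} (hKA : K = convexHull ℝ (A : Set E))
    (hint : (interior K).Nonempty) (hF : IsFace K F) (hdim : faceDim F < Module.finrank ℝ E)
    {a b : E} (ha : a ∈ F) (hb : b ∈ F) :
    ∃ G, IsFace K G ∧ faceDim G + 1 = Module.finrank ℝ E ∧ a ∈ G ∧ b ∈ G := by
  have hK : Convex ℝ K := hKA ▸ convex_convexHull ℝ _
  have haK := hF.2.2.subset ha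
  have hbK := hF.2.2.subset hb
  have hmid : (1 / 2 : ℝ) • a + (1 / 2 : ℝ) • b ∈ F :=
    hF.2.1 ha hb (by norm_num) (by norm_num) (by norm_num)
  obtain ⟨n, hn0, hn, -⟩ := hK.exists_supporting_normal hint (hF.notMem_interior hdim hmid)
  have h1 := hn a haK
  have h2 := hn b hbK
  have e : ⟪n, (1 / 2 : ℝ) • a + (1 / 2 : ℝ) • b⟫ = 1 / 2 * ⟪n, a⟫ + 1 / 2 * ⟪n, b⟫ := by
    rw [inner_add_right, inner_smul_right, inner_smul_right]
  rw [e] at h1 h2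
  refine exists_facet_of_supporting hKA hint haK hbK n hn0 (fun y hy => ?_) (by linarith)
  have h3 := hn y hy
  rw [e] at h3
  linarith

theorem IsFace.isClosed {K F : Set E} (hF : IsFace K F) (hK : IsClosed K) : IsClosed F := by
  have heq : F = K ∩ affineSpan ℝ F := by
    refine Set.Subset.antisymm
      (Set.subset_inter hF.2.2.subset (subset_affineSpan ℝ F)) ?_
    rintro y ⟨hyK, hy⟩
    obtain ⟨z₀, hz₀⟩ := hF.1.intrinsicInterior hF.2.1
    obtain ⟨z, hz, rfl⟩ := mem_intrinsicInterior.1 hz₀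
    have : Nonempty (affineSpan ℝ F) := ⟨z⟩
    have hev : ∀ᶠ t in nhdsWithin (0 : ℝ) (Set.Iio 0),
        AffineMap.lineMap z (⟨y, hy⟩ : affineSpan ℝ F) t ∈
          interior ((↑) ⁻¹' F : Set (affineSpan ℝ F)) := by
      have hc : Continuous (AffineMap.lineMap z (⟨y, hy⟩ : affineSpan ℝ F) :
        ℝ → affineSpan ℝ F) := AffineMap.lineMap_continuous
      refine (hc.continuousAt.eventually_mem ?_).filter_mono nhdsWithin_le_nhds
      simpa using isOpen_interior.mem_nhds hz
    obtain ⟨t, ht, ht0 : t < 0⟩ := (hev.and self_mem_nhdsWithin).exists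
    have htF : (z : E) + t • (y - z) ∈ F := by
      have h1 : ((AffineMap.lineMap z (⟨y, hy⟩ : affineSpan ℝ F) t : affineSpan ℝ F) : E) ∈ F :=
        interior_subset (s := ((↑) ⁻¹' F : Set (affineSpan ℝ F))) ht
      have h2 : ((AffineMap.lineMap z (⟨y, hy⟩ : affineSpan ℝ F) t : affineSpan ℝ F) : E) =
          (z : E) + t • (y - z) := by
        simp [AffineMap.lineMap_apply, add_comm]
      rwa [h2] at h1
    have hzF : (z : E) ∈ F := interior_subset (s := ((↑) ⁻¹' F : Set (affineSpan ℝ F))) hz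
    refine hF.2.2.left_mem_of_mem_openSegment hyK (hF.2.2.subset htF) hzF ?_
    have hpos : 0 < 1 - t := by linarith
    refine ⟨-t / (1 - t), 1 / (1 - t), div_pos (by linarith) hpos, by positivity, ?_, ?_⟩
    · field_simp; ring
    · match_scalars <;> (field_simp; ring)
  rw [heq]
  exact hK.inter (AffineSubspace.closed_of_finiteDimensional _)

end Faces

section ShortestPaths

variable {E : Type*} [NormedAddCommGroup E] [InnerProductSpace ℝ E]

theorem mem_of_forall_exists_Ioc {V : Type*} [TopologicalSpace V] {F : Set V}
    (hF : IsClosed F) {f : ℝ → V} {s t : ℝ} (hst : s ≤ t)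
    (hf : ContinuousOn f (Set.Icc s t)) (hs : f s ∈ F)
    (h : ∀ x ∈ Set.Ico s t, f x ∈ F → ∃ ε > 0, ∀ y ∈ Set.Ioc x t, y < x + ε → f y ∈ F) :
    f t ∈ F := by
  have hcl : IsClosed (f ⁻¹' F ∩ Set.Icc s t) := by
    rw [Set.inter_comm]
    exact hf.preimage_isClosed_of_isClosed isClosed_Icc hF
  refine hcl.Icc_subset_of_forall_exists_gt hs ?_ (Set.right_mem_Icc.2 hst)
  rintro x ⟨hxF, hx⟩ y hy
  obtain ⟨ε, hε, h'⟩ := h x hx hxF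
  have hlt : x < min (min y t) (x + ε / 2) := lt_min (lt_min hy hx.2) (by linarith)
  refine ⟨min (min y t) (x + ε / 2), h' _ ⟨hlt, ?_⟩ ?_, hlt, ?_⟩
  · exact (min_le_left _ _).trans (min_le_right _ _)
  · exact (min_le_right _ _).trans_lt (by linarith)
  · exact (min_le_left _ _).trans (min_le_left _ _)

variable [FiniteDimensional ℝ E] {A : Finset E} {K F : Set E} {a b : E} {γ : ℝ → E}

/-- A shortest path through a face of codimension at least three passes straight through it,
hence stays in the face. -/
theorem IsShortestPath.mem_face_of_norm_eq (hγ : IsShortestPath (frontier K) a b γ)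
    (hfin : intrinsicDist (frontier K) a b ≠ ⊤) (hKA : K = convexHull ℝ (A : Set E))
    (hint : (interior K).Nonempty) (hF : IsFace K F) (hdim : faceDim F + 3 ≤ Module.finrank ℝ E)
    {s s₁ s₂ : ℝ} (h0 : 0 ≤ s₁) (h1 : s₁ ≤ s) (h2 : s ≤ s₂) (h3 : s₂ ≤ 1) (hs : γ s ∈ F)
    {r ρ : ℝ} (hr : 0 < r)
    (hdil : ∀ x : E, γ s + x ∈ K → ∀ c : ℝ, 0 ≤ c → c * ‖x‖ ≤ r → γ s + c • x ∈ K)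
    (hρ : 0 < ρ) (hρr : 2 * ρ ≤ r) (hn₁ : ‖γ s₁ - γ s‖ = ρ) (hn₂ : ‖γ s₂ - γ s‖ = ρ) :
    γ s₁ ∈ F ∧ γ s₂ ∈ F := by
  have hK : Convex ℝ K := hKA ▸ convex_convexHull ℝ _
  have hcl : IsClosed K := hKA ▸ A.finite_toSet.isClosed_convexHull ℝ
  have hf₁ : γ s₁ ∈ frontier K := hγ.1.2.2.2 ⟨h0, h1.trans (h2.trans h3)⟩
  have hf₂ : γ s₂ ∈ frontier K := hγ.1.2.2.2 ⟨h0.trans (h1.trans h2), h3⟩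
  have hk₁ := hcl.frontier_subset hf₁
  have hk₂ := hcl.frontier_subset hf₂
  by_cases huv : (γ s₁ - γ s) + (γ s₂ - γ s) = 0
  · have hmid : γ s = (1 / 2 : ℝ) • γ s₁ + (1 / 2 : ℝ) • γ s₂ := by
      have e : (1 / 2 : ℝ) • γ s₁ + (1 / 2 : ℝ) • γ s₂ =
          γ s + (1 / 2 : ℝ) • ((γ s₁ - γ s) + (γ s₂ - γ s)) := by module
      rw [e, huv, smul_zero, add_zero]
    have hseg : γ s ∈ openSegment ℝ (γ s₁) (γ s₂) :=
      ⟨1 / 2, 1 / 2, by norm_num, by norm_num, by norm_num, hmid.symm⟩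
    exact ⟨hF.2.2.left_mem_of_mem_openSegment hk₁ hk₂ hs hseg,
      hF.2.2.left_mem_of_mem_openSegment hk₂ hk₁ hs (openSegment_symm ℝ (γ s₁) (γ s₂) ▸ hseg)⟩
  · exfalso
    obtain ⟨L, hL, hj⟩ := exists_joinedWithin_lt hKA hint hF hdim hs hr hdil hρ hρr hn₁ hn₂ huv
      (by rwa [add_sub_cancel]) (by rwa [add_sub_cancel])
    rw [add_sub_cancel, add_sub_cancel] at hj
    have hle := hγ.eVariationOn_le hfin h0 (h1.trans h2) h3
      (hj.frontier_of_compl_interior hK hcl hf₁ hf₂)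
    have hadd := eVariationOn.Icc_add_Icc γ (s := Set.univ) h1 h2 trivial
    simp only [Set.univ_inter] at hadd
    have e₁ := eVariationOn.edist_le γ (Set.left_mem_Icc.2 h1) (Set.right_mem_Icc.2 h1)
    have e₂ := eVariationOn.edist_le γ (Set.right_mem_Icc.2 h2) (Set.left_mem_Icc.2 h2)
    rw [edist_dist, dist_eq_norm, hn₁] at e₁
    rw [edist_dist, dist_eq_norm, hn₂] at e₂
    have hge := add_le_add e₁ e₂
    rw [hadd, ← ENNReal.ofReal_add hρ.le hρ.le, ← two_mul] at hge
    exact ((hge.trans hle).trans_lt hL).false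

theorem IsShortestPath.eventually_mem_face (hγ : IsShortestPath (frontier K) a b γ)
    (hfin : intrinsicDist (frontier K) a b ≠ ⊤) (hKA : K = convexHull ℝ (A : Set E))
    (hint : (interior K).Nonempty) (hF : IsFace K F) (hdim : faceDim F + 3 ≤ Module.finrank ℝ E)
    {s : ℝ} (hs : s ∈ Set.Icc (0 : ℝ) 1) (hsF : γ s ∈ F) (hsa : γ s ≠ a) (hsb : γ s ≠ b) :
    ∃ ε > 0, ∀ y ∈ Set.Icc (0 : ℝ) 1, |y - s| < ε → γ y ∈ F := by
  obtain ⟨r, hr, hdil⟩ := exists_radius_dilation_mem_convexHull A (hKA ▸ hF.2.2.subset hsF)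
  rw [← hKA] at hdil
  have hγc := hγ.1.1
  set η := min (r / 2) (min ‖a - γ s‖ ‖b - γ s‖) with hη
  have hη0 : 0 < η := lt_min (by positivity)
    (lt_min (norm_pos_iff.2 (sub_ne_zero.2 hsa.symm)) (norm_pos_iff.2 (sub_ne_zero.2 hsb.symm)))
  obtain ⟨ε, hε, hball⟩ := Metric.continuousOn_iff.1 hγc s hs η hη0
  refine ⟨ε, hε, fun y hy hys => ?_⟩
  have hlt := hball y hy hys
  rw [dist_eq_norm] at hlt
  have hr' : 2 * ‖γ y - γ s‖ ≤ r := by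
    have := hlt.le.trans (min_le_left _ _)
    linarith
  have hya : ‖γ y - γ s‖ ≤ ‖γ 0 - γ s‖ := by
    rw [hγ.1.2.1]
    exact hlt.le.trans ((min_le_right _ _).trans (min_le_left _ _))
  have hyb : ‖γ y - γ s‖ ≤ ‖γ 1 - γ s‖ := by
    rw [hγ.1.2.2.1]
    exact hlt.le.trans ((min_le_right _ _).trans (min_le_right _ _))
  rcases eq_or_ne (γ y) (γ s) with h | h
  · rwa [h]
  have hpos : 0 < ‖γ y - γ s‖ := norm_pos_iff.2 (sub_ne_zero.2 h)
  rcases le_total s y with hsy | hsy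
  · have hc : ContinuousOn (fun z => ‖γ z - γ s‖) (Set.Icc 0 s) :=
      ((hγc.mono (Set.Icc_subset_Icc le_rfl hs.2)).sub continuousOn_const).norm
    obtain ⟨z, hz, hzn⟩ := intermediate_value_Icc' hs.1 hc ⟨by simp, hya⟩
    exact (hγ.mem_face_of_norm_eq hfin hKA hint hF hdim hz.1 hz.2 hsy hy.2 hsF hr hdil hpos hr'
      hzn rfl).2
  · have hc : ContinuousOn (fun z => ‖γ z - γ s‖) (Set.Icc s 1) :=
      ((hγc.mono (Set.Icc_subset_Icc hs.1 le_rfl)).sub continuousOn_const).norm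
    obtain ⟨z, hz, hzn⟩ := intermediate_value_Icc hs.2 hc ⟨by simp, hyb⟩
    exact (hγ.mem_face_of_norm_eq hfin hKA hint hF hdim hy.1 hsy hz.1 hz.2 hsF hr hdil hpos hr'
      rfl hzn).1

/-- If a shortest path meets a face of codimension at least three away from its endpoints, then
both endpoints lie in that face. -/
theorem IsShortestPath.endpoints_mem_face (hγ : IsShortestPath (frontier K) a b γ)
    (hfin : intrinsicDist (frontier K) a b ≠ ⊤) (hKA : K = convexHull ℝ (A : Set E))
    (hint : (interior K).Nonempty) (hF : IsFace K F) (hdim : faceDim F + 3 ≤ Module.finrank ℝ E)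
    {t : ℝ} (ht : t ∈ Set.Icc (0 : ℝ) 1) (htF : γ t ∈ F) (hta : γ t ≠ a) (htb : γ t ≠ b) :
    a ∈ F ∧ b ∈ F := by
  have hFc : IsClosed F := hF.isClosed (hKA ▸ A.finite_toSet.isClosed_convexHull ℝ)
  have h0 := hγ.1.2.1
  have h1 := hγ.1.2.2.1
  have hconst_a : ∀ x ∈ Set.Icc (0 : ℝ) 1, γ x = a → ∀ y ∈ Set.Icc 0 x, γ y = a :=
    fun x hx hxa y hy => (hγ.eqOn_of_eq hfin le_rfl hx.1 hx.2 (h0.trans hxa.symm) y hy).trans h0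
  have hconst_b : ∀ x ∈ Set.Icc (0 : ℝ) 1, γ x = b → ∀ y ∈ Set.Icc x 1, γ y = b :=
    fun x hx hxb y hy => (hγ.eqOn_of_eq hfin hx.1 hx.2 le_rfl (hxb.trans h1.symm) y hy).trans hxb
  constructor
  · have hmaps : Set.MapsTo (fun x : ℝ => -x) (Set.Icc (-t) 0) (Set.Icc 0 1) := by
      rintro x ⟨hx, hx'⟩
      exact ⟨by linarith, by linarith [ht.2]⟩
    have key := mem_of_forall_exists_Ioc hFc (f := fun x => γ (-x)) (s := -t) (t := 0)
      (by linarith [ht.1]) (hγ.1.1.comp (by fun_prop) hmaps) (by simpa using htF) ?_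
    · simpa [h0] using key
    intro x hx hxF
    have hx1 : -x ∈ Set.Icc (0 : ℝ) 1 := hmaps ⟨hx.1, hx.2.le⟩
    by_cases hxa : γ (-x) = a
    · refine ⟨1, one_pos, fun y hy _ => ?_⟩
      rw [hconst_a _ hx1 hxa (-y) ⟨by linarith [hy.2], by linarith [hy.1]⟩, ← hxa]
      exact hxF
    · have hxb : γ (-x) ≠ b := fun h =>
        htb (hconst_b _ hx1 h t ⟨by linarith [hx.1], ht.2⟩)
      obtain ⟨ε, hε, h⟩ := hγ.eventually_mem_face hfin hKA hint hF hdim hx1 hxF hxa hxb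
      refine ⟨ε, hε, fun y hy hyε => h (-y) (hmaps ⟨hx.1.trans hy.1.le, hy.2⟩) ?_⟩
      rw [abs_lt]
      constructor <;> linarith [hy.1]
  · have hsub : Set.Icc t 1 ⊆ Set.Icc (0 : ℝ) 1 := Set.Icc_subset_Icc ht.1 le_rfl
    rw [← h1]
    refine mem_of_forall_exists_Ioc hFc ht.2 (hγ.1.1.mono hsub) htF fun x hx hxF => ?_
    have hx1 : x ∈ Set.Icc (0 : ℝ) 1 := hsub ⟨hx.1, hx.2.le⟩
    by_cases hxb : γ x = b
    · refine ⟨1, one_pos, fun y hy _ => ?_⟩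
      rw [hconst_b _ hx1 hxb y ⟨hy.1.le, hy.2⟩, ← hxb]
      exact hxF
    · have hxa : γ x ≠ a := fun h => hta (hconst_a _ hx1 h t ⟨ht.1, hx.1⟩)
      obtain ⟨ε, hε, h⟩ := hγ.eventually_mem_face hfin hKA hint hF hdim hx1 hxF hxa hxb
      refine ⟨ε, hε, fun y hy hyε => h y (hsub ⟨hx.1.trans hy.1.le, hy.2⟩) ?_⟩
      rw [abs_lt]
      constructor <;> linarith [hy.1]

end ShortestPaths

/-- Proposition 1.1: if a shortest path `γ` in the boundary `S = frontier P` of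
a convex polytope `P ⊆ ℝ^{d+1}` connects two points `a`, `b` not lying on a
common facet (face of dimension `d`), then the relative interior of `γ`
contains no warped point (point of a face of dimension at most `d - 2`). -/
theorem shortest_path_no_warped_interior {d : ℕ} (hd : 1 ≤ d)
    (P : Set (EuclideanSpace ℝ (Fin (d + 1))))
    (hP : ∃ A : Finset (EuclideanSpace ℝ (Fin (d + 1))),
      P = convexHull ℝ (A : Set (EuclideanSpace ℝ (Fin (d + 1)))))
    (hint : (interior P).Nonempty)
    (a b : EuclideanSpace ℝ (Fin (d + 1)))
    (γ : ℝ → EuclideanSpace ℝ (Fin (d + 1)))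
    (hγ : IsShortestPath (frontier P) a b γ)
    (hab : ∀ F : Set (EuclideanSpace ℝ (Fin (d + 1))),
      IsFace P F → faceDim F = d → ¬(a ∈ F ∧ b ∈ F)) :
    ∀ t ∈ Set.Ioo (0 : ℝ) 1, γ t ≠ a → γ t ≠ b →
      ∀ F : Set (EuclideanSpace ℝ (Fin (d + 1))),
        IsFace P F → faceDim F + 2 ≤ d → γ t ∉ F := by
  intro t ht hta htb F hF hdim htF
  obtain ⟨A, hPA⟩ := hP
  have hrank : Module.finrank ℝ (EuclideanSpace ℝ (Fin (d + 1))) = d + 1 :=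
    finrank_euclideanSpace_fin
  have hfin : intrinsicDist (frontier P) a b ≠ ⊤ := by
    refine Convex.intrinsicDist_frontier_ne_top (hPA ▸ convex_convexHull ℝ _)
      (hPA ▸ A.finite_toSet.isCompact_convexHull ℝ) hint (by omega) ?_ ?_
    · exact hγ.1.2.1 ▸ hγ.1.2.2.2 (Set.left_mem_Icc.2 zero_le_one)
    · exact hγ.1.2.2.1 ▸ hγ.1.2.2.2 (Set.right_mem_Icc.2 zero_le_one)
  obtain ⟨ha, hb⟩ := hγ.endpoints_mem_face hfin hPA hint hF (by omega)
    (Set.Ioo_subset_Icc_self ht) htF hta htb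
  obtain ⟨G, hG, hGdim, haG, hbG⟩ := hF.exists_facet hPA hint (by omega) ha hb
  exact hab G hG (by omega) ⟨haG, hbG⟩
end
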